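/- Let d ≥ 2, 1 < p < ∞, C₀ > 0 and ρ > 0. Let V be a locally bounded measurable function on B_ρ \ {0} ⊆ ℝ^d which is spherically symmetric (V(x) depends only on ‖x‖) and satisfies ‖x‖^p |V(x)| ≤ C₀ for almost every x. Then for any two positive C¹ weak solutions u, v of -Δ_p w + V|w|^{p-2}w = 0 in B_ρ \ {0}, the limit lim_{x → 0} u(x)/v(x) exists in the extended interval [0, +∞]. -/

import Mathlib

open MeasureTheory Metric Filter Topology Set
open scoped RealInnerProductSpace ENNReal

noncomputable section

/-- `u` is a positive `C¹` weak solution of `-Δ_p u + V|u|^{p-2}u = 0` in the open set `Ω`. -/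
def IsPosWeakSol {d : ℕ} (p : ℝ) (V : EuclideanSpace ℝ (Fin d) → ℝ)
    (Ω : Set (EuclideanSpace ℝ (Fin d))) (u : EuclideanSpace ℝ (Fin d) → ℝ) : Prop :=
  ContDiffOn ℝ 1 u Ω ∧ (∀ x ∈ Ω, 0 < u x) ∧
  ∀ φ : EuclideanSpace ℝ (Fin d) → ℝ, ContDiff ℝ (⊤ : ℕ∞) φ → HasCompactSupport φ →
    tsupport φ ⊆ Ω →
    ∫ x in Ω, (‖gradient u x‖ ^ (p - 2) * ⟪gradient u x, gradient φ x⟫ +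
      V x * |u x| ^ (p - 2) * u x * φ x) = 0

set_option linter.unusedSectionVars false

section Vector

variable {E : Type*} [NormedAddCommGroup E] [InnerProductSpace ℝ E]

/-- The vector field `a ↦ ‖a‖^(p-2) a` of the `p`-Laplacian. -/
def pflux (p : ℝ) (a : E) : E := ‖a‖ ^ (p - 2) • a

theorem norm_pflux {p : ℝ} (hp : 1 < p) (a : E) : ‖pflux p a‖ = ‖a‖ ^ (p - 1) := by
  rcases eq_or_ne a 0 with rfl | ha
  · simp [pflux, Real.zero_rpow (by linarith : p - 1 ≠ 0)]
  · have h : 0 < ‖a‖ := norm_pos_iff.2 ha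
    rw [pflux, norm_smul, Real.norm_of_nonneg (by positivity), ← Real.rpow_add_one h.ne']
    congr 1; ring

theorem inner_pflux_self {p : ℝ} (hp : 1 < p) (a : E) : ⟪pflux p a, a⟫ = ‖a‖ ^ p := by
  rcases eq_or_ne a 0 with rfl | ha
  · simp [pflux, Real.zero_rpow (by linarith : p ≠ 0)]
  · have h : 0 < ‖a‖ := norm_pos_iff.2 ha
    rw [pflux, real_inner_smul_left, real_inner_self_eq_norm_sq, ← Real.rpow_natCast,
      ← Real.rpow_add h]
    congr 1; push_cast; ring

theorem continuous_pflux {p : ℝ} (hp : 1 < p) : Continuous (pflux p : E → E) := by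
  rw [continuous_iff_continuousAt]
  intro a
  rcases eq_or_ne a 0 with rfl | ha
  · rw [ContinuousAt, tendsto_iff_norm_sub_tendsto_zero]
    have h0 : pflux p (0 : E) = 0 := by simp [pflux]
    simp only [h0, sub_zero, norm_pflux hp]
    have : Continuous fun x : E => ‖x‖ ^ (p - 1) :=
      continuous_norm.rpow_const fun _ => Or.inr (by linarith)
    simpa [Real.zero_rpow (by linarith : p - 1 ≠ 0)] using this.tendsto 0
  · exact (continuousAt_id.norm.rpow_const (Or.inl (norm_ne_zero_iff.2 ha))).smul continuousAt_id

theorem pflux_neg (p : ℝ) (a : E) : pflux p (-a) = -pflux p a := by simp [pflux]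

theorem pflux_smul {p : ℝ} (hp : 1 < p) {s : ℝ} (hs : 0 ≤ s) (a : E) :
    pflux p (s • a) = s ^ (p - 1) • pflux p a := by
  rcases hs.eq_or_lt with rfl | hs
  · simp [pflux, Real.zero_rpow (by linarith : p - 1 ≠ 0)]
  · rw [pflux, pflux, norm_smul, Real.norm_of_nonneg hs.le, Real.mul_rpow hs.le (norm_nonneg _),
      smul_smul, smul_smul]
    congr 1
    rw [show p - 1 = (p - 2) + 1 by ring, Real.rpow_add_one hs.ne']; ring

theorem pflux_map (p : ℝ) (T : E ≃ₗᵢ[ℝ] E) (a : E) : pflux p (T a) = T (pflux p a) := by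
  simp [pflux]

theorem pflux_sub_eq (p : ℝ) (a b : E) :
    pflux p a - pflux p b = ‖a‖ ^ (p - 2) • (a - b) + (‖a‖ ^ (p - 2) - ‖b‖ ^ (p - 2)) • b := by
  simp only [pflux]; module

theorem abs_one_sub_rpow_mul_le {q τ : ℝ} (hq : -1 < q) (h0 : 0 ≤ τ) (h1 : τ ≤ 1) :
    |1 - τ ^ q| * τ ≤ (q + 2) * (1 - τ) := by
  rcases h0.eq_or_lt with rfl | h0
  · simp; linarith
  rcases le_total 1 q with h | h
  · have hb := one_add_mul_self_le_rpow_one_add (by linarith : -1 ≤ τ - 1) h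
    have h2 : τ ^ q ≤ 1 := Real.rpow_le_one h0.le h1 (by linarith)
    rw [abs_of_nonneg (by linarith)]
    have : 1 + (τ - 1) = τ := by ring
    rw [this] at hb
    nlinarith
  rcases le_total 0 q with h' | h'
  · have h2 : τ ^ q ≤ 1 := Real.rpow_le_one h0.le h1 (by linarith)
    have h3 : τ ^ (1 : ℝ) ≤ τ ^ q := Real.rpow_le_rpow_of_exponent_ge h0 h1 h
    rw [Real.rpow_one] at h3
    rw [abs_of_nonneg (by linarith)]
    nlinarith
  · have h2 : 1 ≤ τ ^ q := Real.one_le_rpow_of_pos_of_le_one_of_nonpos h0 h1 h'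
    have h3 : τ ^ (q + 1) ≤ 1 := Real.rpow_le_one h0.le h1 (by linarith)
    rw [Real.rpow_add_one h0.ne'] at h3
    rw [abs_of_nonpos (by linarith)]
    nlinarith

theorem rpow_sub_mul_le {q A B : ℝ} (hq : -1 < q) (hB : 0 ≤ B) (hA : B ≤ A) :
    |A ^ q - B ^ q| * B ≤ (q + 2) * (A ^ q * (A - B)) := by
  rcases (hB.trans hA).eq_or_lt with h | h
  · have : B = 0 := le_antisymm (h ▸ hA) hB
    subst h; subst this; simp
  · have h1 := abs_one_sub_rpow_mul_le hq (div_nonneg hB h.le) ((div_le_one h).2 hA)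
    have hAq : 0 < A ^ q := by positivity
    have e1 : A ^ q - B ^ q = A ^ q * (1 - (B / A) ^ q) := by
      rw [Real.div_rpow hB h.le]; field_simp
    have e2 : B = A * (B / A) := by field_simp
    have e3 : A - B = A * (1 - B / A) := by field_simp
    rw [e1, abs_mul, abs_of_pos hAq, e3]
    calc A ^ q * |1 - (B / A) ^ q| * B
        = A ^ q * A * (|1 - (B / A) ^ q| * (B / A)) := by
          conv_lhs => rw [e2]
          ring_nf
          field_simp
      _ ≤ A ^ q * A * ((q + 2) * (1 - B / A)) := by gcongr
      _ = _ := by ring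

theorem exists_pflux_upper {p : ℝ} (hp : 1 < p) :
    ∃ C : ℝ, 0 < C ∧ ∀ a b : E, ‖pflux p a - pflux p b‖ ≤
      C * ((‖a‖ + ‖b‖) ^ (p - 2) * ‖a - b‖) := by
  refine ⟨(p + 1) * 2 ^ |p - 2|, by positivity, ?_⟩
  have key : ∀ a b : E, ‖b‖ ≤ ‖a‖ → ‖pflux p a - pflux p b‖ ≤
      (p + 1) * 2 ^ |p - 2| * ((‖a‖ + ‖b‖) ^ (p - 2) * ‖a - b‖) := by
    intro a b hab
    rcases eq_or_ne a 0 with rfl | ha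
    · have : b = 0 := by simpa using hab
      simp [this]
    have hA : 0 < ‖a‖ := norm_pos_iff.2 ha
    have h1 : ‖pflux p a - pflux p b‖ ≤ (p + 1) * (‖a‖ ^ (p - 2) * ‖a - b‖) := by
      rw [pflux_sub_eq]
      refine (norm_add_le _ _).trans ?_
      rw [norm_smul, norm_smul, Real.norm_of_nonneg (by positivity), Real.norm_eq_abs]
      have h2 := rpow_sub_mul_le (q := p - 2) (by linarith) (norm_nonneg b) hab
      have h3 : ‖a‖ - ‖b‖ ≤ ‖a - b‖ := norm_sub_norm_le a b
      have h4 : ‖a‖ ^ (p - 2) * (‖a‖ - ‖b‖) ≤ ‖a‖ ^ (p - 2) * ‖a - b‖ := by gcongr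
      nlinarith
    have h5 : ‖a‖ ^ (p - 2) ≤ 2 ^ |p - 2| * (‖a‖ + ‖b‖) ^ (p - 2) := by
      have hS : 0 < ‖a‖ + ‖b‖ := by positivity
      rcases le_total 0 (p - 2) with h | h
      · rw [abs_of_nonneg h]
        have : ‖a‖ ^ (p - 2) ≤ (‖a‖ + ‖b‖) ^ (p - 2) :=
          Real.rpow_le_rpow hA.le (by linarith [norm_nonneg b]) h
        have h2 : (1 : ℝ) ≤ 2 ^ (p - 2) := Real.one_le_rpow (by norm_num) h
        have h3 : 0 < (‖a‖ + ‖b‖) ^ (p - 2) := by positivity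
        nlinarith
      · rw [abs_of_nonpos h]
        have : (2 * ‖a‖) ^ (p - 2) ≤ (‖a‖ + ‖b‖) ^ (p - 2) :=
          Real.rpow_le_rpow_of_nonpos hS (by linarith) h
        rw [Real.mul_rpow (by norm_num) hA.le] at this
        rw [Real.rpow_neg (by norm_num)]
        have h2 : (0 : ℝ) < 2 ^ (p - 2) := by positivity
        rw [inv_mul_eq_div, le_div_iff₀ h2]; linarith
    calc _ ≤ _ := h1
      _ ≤ (p + 1) * (2 ^ |p - 2| * (‖a‖ + ‖b‖) ^ (p - 2) * ‖a - b‖) := by gcongr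
      _ = _ := by ring
  intro a b
  rcases le_total ‖b‖ ‖a‖ with h | h
  · exact key a b h
  · have := key b a h
    rwa [norm_sub_rev, add_comm ‖b‖, norm_sub_rev b a] at this

theorem exists_pflux_lower {p : ℝ} (hp : 1 < p) :
    ∃ c : ℝ, 0 < c ∧ ∀ a b : E, c * ((‖a‖ + ‖b‖) ^ (p - 2) * ‖a - b‖ ^ 2) ≤
      ⟪pflux p a - pflux p b, a - b⟫ := by
  refine ⟨min (p - 1) (1 / 2 * 2 ^ (-(p - 2))), by have : 0 < p - 1 := by linarith
                                                   positivity, ?_⟩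
  have key : ∀ a b : E, ‖b‖ ≤ ‖a‖ → min (p - 1) (1 / 2 * 2 ^ (-(p - 2))) *
      ((‖a‖ + ‖b‖) ^ (p - 2) * ‖a - b‖ ^ 2) ≤ ⟪pflux p a - pflux p b, a - b⟫ := by
    intro a b hab
    rcases eq_or_ne a 0 with rfl | ha
    · have : b = 0 := by simpa using hab
      simp [this]
    have hA : 0 < ‖a‖ := norm_pos_iff.2 ha
    have hS : 0 < ‖a‖ + ‖b‖ := by positivity
    have hSq : 0 < (‖a‖ + ‖b‖) ^ (p - 2) := by positivity
    have ht : ‖a - b‖ ^ 2 = ‖a‖ ^ 2 - 2 * ⟪a, b⟫ + ‖b‖ ^ 2 := norm_sub_sq_real a b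
    have e : ⟪pflux p a - pflux p b, a - b⟫ =
        ‖a‖ ^ (p - 2) * (‖a‖ ^ 2 - ⟪a, b⟫) - ‖b‖ ^ (p - 2) * (⟪a, b⟫ - ‖b‖ ^ 2) := by
      simp only [pflux, inner_sub_left, inner_sub_right, real_inner_smul_left,
        real_inner_self_eq_norm_sq, real_inner_comm a b]
      ring
    rcases le_total 0 (p - 2) with h | h
    · have h1 : ‖b‖ ^ (p - 2) ≤ ‖a‖ ^ (p - 2) := Real.rpow_le_rpow (norm_nonneg _) hab h
      have h0 : 0 ≤ ‖b‖ ^ (p - 2) := by positivity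
      have h2 : 1 / 2 * (‖a‖ ^ (p - 2) * ‖a - b‖ ^ 2) ≤ ⟪pflux p a - pflux p b, a - b⟫ := by
        rw [e]
        have h3 : 0 ≤ (‖a‖ ^ (p - 2) - ‖b‖ ^ (p - 2)) * (‖a‖ ^ 2 - ‖b‖ ^ 2) :=
          mul_nonneg (by linarith) (by nlinarith [norm_nonneg b])
        have h4 : 0 ≤ ‖b‖ ^ (p - 2) * ‖a - b‖ ^ 2 := by positivity
        rw [ht] at h4 ⊢
        nlinarith
      refine le_trans ?_ h2
      have h5 : (‖a‖ + ‖b‖) ^ (p - 2) ≤ 2 ^ (p - 2) * ‖a‖ ^ (p - 2) := by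
        rw [← Real.mul_rpow (by norm_num) hA.le]
        exact Real.rpow_le_rpow hS.le (by linarith) h
      have h6 : (2:ℝ) ^ (-(p - 2)) * (‖a‖ + ‖b‖) ^ (p - 2) ≤ ‖a‖ ^ (p - 2) := by
        rw [Real.rpow_neg (by norm_num), inv_mul_le_iff₀ (by positivity)]; exact h5
      calc _ ≤ 1 / 2 * 2 ^ (-(p - 2)) * ((‖a‖ + ‖b‖) ^ (p - 2) * ‖a - b‖ ^ 2) := by
            gcongr; exact min_le_right _ _
        _ = 1 / 2 * ((2 ^ (-(p - 2)) * (‖a‖ + ‖b‖) ^ (p - 2)) * ‖a - b‖ ^ 2) := by ring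
        _ ≤ _ := by gcongr
    · have h2 : (p - 1) * (‖a‖ ^ (p - 2) * ‖a - b‖ ^ 2) ≤ ⟪pflux p a - pflux p b, a - b⟫ := by
        have e2 : ⟪pflux p a - pflux p b, a - b⟫ = ‖a‖ ^ (p - 2) * ‖a - b‖ ^ 2 -
            (‖b‖ ^ (p - 2) - ‖a‖ ^ (p - 2)) * (⟪a, b⟫ - ‖b‖ ^ 2) := by
          rw [e, ht]; ring
        rcases eq_or_ne b 0 with rfl | hb
        · simp only [sub_zero, norm_zero] at e2 ⊢
          rw [e2]
          have : 0 < ‖a‖ ^ (p - 2) * ‖a‖ ^ 2 := by positivity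
          simp; nlinarith
        have hB : 0 < ‖b‖ := norm_pos_iff.2 hb
        have h3 : ⟪a, b⟫ - ‖b‖ ^ 2 ≤ ‖b‖ * (‖a‖ - ‖b‖) := by
          nlinarith [real_inner_le_norm a b]
        have h4 : ‖a‖ ^ (p - 2) ≤ ‖b‖ ^ (p - 2) := Real.rpow_le_rpow_of_nonpos hB hab h
        have h5 : (‖b‖ ^ (p - 2) - ‖a‖ ^ (p - 2)) * ‖b‖ ≤
            (2 - p) * (‖a‖ ^ (p - 2) * (‖a‖ - ‖b‖)) := by
          have hτ : 0 < ‖b‖ / ‖a‖ := by positivity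
          have h6 := rpow_one_add_le_one_add_mul_self (s := ‖b‖ / ‖a‖ - 1) (by linarith)
            (p := p - 1) (by linarith) (by linarith)
          rw [show 1 + (‖b‖ / ‖a‖ - 1) = ‖b‖ / ‖a‖ by ring,
            show p - 1 = (p - 2) + 1 by ring, Real.rpow_add_one hτ.ne',
            Real.div_rpow hB.le hA.le] at h6
          have hAq : 0 < ‖a‖ ^ (p - 2) := by positivity
          have h7 := mul_le_mul_of_nonneg_left h6 (mul_pos hAq hA).le
          have e3 : ‖a‖ ^ (p - 2) * ‖a‖ * (‖b‖ ^ (p - 2) / ‖a‖ ^ (p - 2) * (‖b‖ / ‖a‖)) =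
            ‖b‖ ^ (p - 2) * ‖b‖ := by field_simp
          have e4 : ‖a‖ ^ (p - 2) * ‖a‖ * (1 + (p - 2 + 1) * (‖b‖ / ‖a‖ - 1)) =
            ‖a‖ ^ (p - 2) * (‖a‖ + (p - 1) * (‖b‖ - ‖a‖)) := by field_simp; ring
          rw [e3, e4] at h7
          nlinarith
        have h8 : (‖a‖ - ‖b‖) ^ 2 ≤ ‖a - b‖ ^ 2 := by
          rw [ht]; nlinarith [real_inner_le_norm a b]
        have hAq : 0 < ‖a‖ ^ (p - 2) := by positivity
        have h9 : (‖b‖ ^ (p - 2) - ‖a‖ ^ (p - 2)) * (⟪a, b⟫ - ‖b‖ ^ 2) ≤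
            (2 - p) * (‖a‖ ^ (p - 2) * ‖a - b‖ ^ 2) := by
          calc _ ≤ (‖b‖ ^ (p - 2) - ‖a‖ ^ (p - 2)) * (‖b‖ * (‖a‖ - ‖b‖)) :=
                mul_le_mul_of_nonneg_left h3 (by linarith)
            _ = (‖b‖ ^ (p - 2) - ‖a‖ ^ (p - 2)) * ‖b‖ * (‖a‖ - ‖b‖) := by ring
            _ ≤ (2 - p) * (‖a‖ ^ (p - 2) * (‖a‖ - ‖b‖)) * (‖a‖ - ‖b‖) :=
                mul_le_mul_of_nonneg_right h5 (by linarith)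
            _ = (2 - p) * (‖a‖ ^ (p - 2) * (‖a‖ - ‖b‖) ^ 2) := by ring
            _ ≤ _ := by
                have : 0 ≤ 2 - p := by linarith
                gcongr
        rw [e2]; nlinarith
      refine le_trans ?_ h2
      have h5 : (‖a‖ + ‖b‖) ^ (p - 2) ≤ ‖a‖ ^ (p - 2) :=
        Real.rpow_le_rpow_of_nonpos hA (by linarith [norm_nonneg b]) h
      have : 0 < p - 1 := by linarith
      gcongr
      exact min_le_left _ _
  intro a b
  rcases le_total ‖b‖ ‖a‖ with h | h
  · exact key a b h
  · have := key b a h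
    rw [add_comm ‖b‖, norm_sub_rev b a] at this
    refine this.trans_eq ?_
    rw [← neg_sub a b, ← neg_sub (pflux p a), inner_neg_neg]

/-- The excess in the convexity inequality of `‖·‖^p`. -/
def pexcess (p : ℝ) (a b : E) : ℝ := ‖b‖ ^ p + (p - 1) * ‖a‖ ^ p - p * ⟪pflux p a, b⟫

theorem pexcess_nonneg_and_eq {p : ℝ} (hp : 1 < p) (a b : E) :
    0 ≤ pexcess p a b ∧ (pexcess p a b = 0 → a = b) := by
  unfold pexcess
  rcases eq_or_ne a 0 with rfl | ha
  · simp only [norm_zero, pflux, smul_zero, inner_zero_left,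
      Real.zero_rpow (by linarith : p ≠ 0)]
    refine ⟨by simp; positivity, fun h => ?_⟩
    simp only [mul_zero, add_zero, sub_zero] at h
    rw [Real.rpow_eq_zero (norm_nonneg _) (by linarith)] at h
    exact (norm_eq_zero.1 h).symm
  have hA : 0 < ‖a‖ := norm_pos_iff.2 ha
  have hAp : 0 < ‖a‖ ^ p := by positivity
  have hAq : 0 < ‖a‖ ^ (p - 2) := by positivity
  have eA : ‖a‖ ^ (p - 2) * ‖a‖ * ‖a‖ = ‖a‖ ^ p := by
    rw [← Real.rpow_add_one hA.ne', ← Real.rpow_add_one hA.ne']; congr 1; ring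
  have e1 : ⟪pflux p a, b⟫ = ‖a‖ ^ (p - 2) * ⟪a, b⟫ := real_inner_smul_left _ _ _
  have h1 : ⟪a, b⟫ ≤ ‖a‖ * ‖b‖ := real_inner_le_norm a b
  have e2 : ‖b‖ ^ p = ‖a‖ ^ p * (‖b‖ / ‖a‖) ^ p := by
    rw [Real.div_rpow (norm_nonneg _) hA.le]; field_simp
  have e3 : ‖a‖ ^ (p - 2) * (‖a‖ * ‖b‖) = ‖a‖ ^ p * (‖b‖ / ‖a‖) := by
    rw [← eA]; field_simp
  have h2 : ‖a‖ ^ (p - 2) * ⟪a, b⟫ ≤ ‖a‖ ^ p * (‖b‖ / ‖a‖) := by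
    rw [← e3]; gcongr
  have hτ : 0 ≤ ‖b‖ / ‖a‖ := by positivity
  have h3 := one_add_mul_self_le_rpow_one_add (s := ‖b‖ / ‖a‖ - 1) (by linarith) hp.le
  have e4 : 1 + (‖b‖ / ‖a‖ - 1) = ‖b‖ / ‖a‖ := by ring
  rw [e4] at h3
  have h4 := mul_le_mul_of_nonneg_left h3 hAp.le
  have h5 := mul_le_mul_of_nonneg_left h2 (by linarith : (0:ℝ) ≤ p)
  rw [e1, e2]
  refine ⟨by nlinarith, fun h => ?_⟩
  have h6 : ‖b‖ / ‖a‖ - 1 = 0 := by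
    by_contra hne
    have h7 := one_add_mul_self_lt_rpow_one_add (s := ‖b‖ / ‖a‖ - 1) (by linarith) hne hp
    rw [e4] at h7
    have := mul_lt_mul_of_pos_left h7 hAp
    nlinarith
  have h7 : ‖b‖ / ‖a‖ = 1 := by linarith
  have h8 : ‖b‖ = ‖a‖ := by rwa [div_eq_one_iff_eq hA.ne'] at h7
  rw [h7] at h h2 h5
  simp only [Real.one_rpow, mul_one] at h h2
  have h9 : ‖a‖ ^ (p - 2) * ⟪a, b⟫ = ‖a‖ ^ p := by
    have hp0 : 0 < p := by linarith
    have : p * (‖a‖ ^ (p - 2) * ⟪a, b⟫) = p * ‖a‖ ^ p := by linarith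
    exact mul_left_cancel₀ hp0.ne' this
  have h10 : ⟪a, b⟫ = ‖a‖ * ‖a‖ := by
    rw [← eA, mul_assoc] at h9
    exact mul_left_cancel₀ hAq.ne' h9
  have h11 : ‖a - b‖ ^ 2 = 0 := by
    rw [norm_sub_sq_real, h10, h8]; ring
  exact sub_eq_zero.1 (norm_eq_zero.1 (pow_eq_zero_iff (two_ne_zero) |>.1 h11))

theorem continuous_pexcess {p : ℝ} (hp : 1 < p) :
    Continuous fun x : E × E => pexcess p x.1 x.2 := by
  unfold pexcess
  have h1 : Continuous fun x : E × E => ‖x.2‖ ^ p :=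
    continuous_snd.norm.rpow_const fun _ => Or.inr (by linarith)
  have h2 : Continuous fun x : E × E => ‖x.1‖ ^ p :=
    continuous_fst.norm.rpow_const fun _ => Or.inr (by linarith)
  have h3 : Continuous fun x : E × E => ⟪pflux p x.1, x.2⟫ :=
    ((continuous_pflux hp).comp continuous_fst).inner continuous_snd
  fun_prop

end Vector

section Calculus

variable {E : Type*} [NormedAddCommGroup E] [InnerProductSpace ℝ E] [CompleteSpace E]

theorem HasGradientAt.comp_real {f : E → ℝ} {x f' : E} {h : ℝ → ℝ} {h' : ℝ}
    (hh : HasDerivAt h h' (f x)) (hf : HasGradientAt f f' x) :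
    HasGradientAt (fun y => h (f y)) (h' • f') x := by
  rw [hasGradientAt_iff_hasFDerivAt] at hf ⊢
  refine (hh.comp_hasFDerivAt x hf).congr_fderiv ?_
  simp

theorem HasGradientAt.mul' {f g : E → ℝ} {x f' g' : E}
    (hf : HasGradientAt f f' x) (hg : HasGradientAt g g' x) :
    HasGradientAt (fun y => f y * g y) (f x • g' + g x • f') x := by
  rw [hasGradientAt_iff_hasFDerivAt] at hf hg ⊢
  refine (hf.mul hg).congr_fderiv ?_
  simp

theorem HasGradientAt.sub' {f g : E → ℝ} {x f' g' : E}
    (hf : HasGradientAt f f' x) (hg : HasGradientAt g g' x) :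
    HasGradientAt (fun y => f y - g y) (f' - g') x := by
  rw [hasGradientAt_iff_hasFDerivAt] at hf hg ⊢
  refine (hf.sub hg).congr_fderiv ?_
  simp

theorem HasGradientAt.add' {f g : E → ℝ} {x f' g' : E}
    (hf : HasGradientAt f f' x) (hg : HasGradientAt g g' x) :
    HasGradientAt (fun y => f y + g y) (f' + g') x := by
  rw [hasGradientAt_iff_hasFDerivAt] at hf hg ⊢
  refine (hf.add hg).congr_fderiv ?_
  simp

theorem gradient_norm_eq (f : E → ℝ) (x : E) : ‖gradient f x‖ = ‖fderiv ℝ f x‖ := by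
  rw [← toDual_gradient, LinearIsometryEquiv.norm_map]

theorem ContDiffOn.hasGradientAt {f : E → ℝ} {Ω : Set E} (hf : ContDiffOn ℝ 1 f Ω)
    (hΩ : IsOpen Ω) {x : E} (hx : x ∈ Ω) : HasGradientAt f (gradient f x) x :=
  ((hf.contDiffAt (hΩ.mem_nhds hx)).differentiableAt (by norm_num)).hasGradientAt

theorem ContDiff.hasGradientAt' {f : E → ℝ} (hf : ContDiff ℝ 1 f) (x : E) :
    HasGradientAt f (gradient f x) x :=
  (hf.differentiable (by norm_num) x).hasGradientAt

theorem ContDiffOn.continuousOn_gradient {f : E → ℝ} {Ω : Set E} (hf : ContDiffOn ℝ 1 f Ω)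
    (hΩ : IsOpen Ω) : ContinuousOn (gradient f) Ω :=
  (InnerProductSpace.toDual ℝ E).symm.continuous.comp_continuousOn
    (hf.continuousOn_fderiv_of_isOpen hΩ (by norm_num))

theorem ContDiff.continuous_gradient {f : E → ℝ} (hf : ContDiff ℝ 1 f) :
    Continuous (gradient f) :=
  (InnerProductSpace.toDual ℝ E).symm.continuous.comp (hf.continuous_fderiv (by norm_num))

theorem gradient_of_notMem_tsupport {f : E → ℝ} {x : E} (hx : x ∉ tsupport f) :
    gradient f x = 0 := by
  have h : f =ᶠ[𝓝 x] 0 := notMem_tsupport_iff_eventuallyEq.1 hx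
  rw [h.gradient_eq]
  exact (hasGradientAt_const x (0 : ℝ)).gradient

/-- `η` is a `C¹` function with compact support in `Ω`. -/
structure TestFun (Ω : Set E) (η : E → ℝ) : Prop where
  contDiff : ContDiff ℝ 1 η
  compact : HasCompactSupport η
  supp : tsupport η ⊆ Ω

theorem TestFun.mono {Ω Ω' : Set E} {η : E → ℝ} (h : TestFun Ω η) (hs : Ω ⊆ Ω') :
    TestFun Ω' η := ⟨h.1, h.2, h.3.trans hs⟩

theorem TestFun.mul_left {Ω : Set E} {η g : E → ℝ} (h : TestFun Ω η) (hΩ : IsOpen Ω)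
    (hg : ContDiffOn ℝ 1 g Ω) : TestFun Ω (fun x => g x * η x) := by
  have hsub : tsupport (fun x => g x * η x) ⊆ tsupport η :=
    closure_mono (Function.support_mul_subset_right g η)
  refine ⟨?_, h.compact.mul_left, hsub.trans h.supp⟩
  rw [contDiff_iff_contDiffAt]
  intro x
  by_cases hx : x ∈ tsupport η
  · exact (hg.contDiffAt (hΩ.mem_nhds (h.supp hx))).mul h.contDiff.contDiffAt
  · have h0 : (fun x => g x * η x) =ᶠ[𝓝 x] fun _ => (0:ℝ) := by
      filter_upwards [notMem_tsupport_iff_eventuallyEq.1 hx] with y hy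
      simp [hy]
    exact contDiffAt_const.congr_of_eventuallyEq h0

theorem TestFun.eq_zero {Ω : Set E} {η : E → ℝ} {x : E} (h : TestFun Ω η) (hx : x ∉ Ω) :
    η x = 0 := image_eq_zero_of_notMem_tsupport fun h' => hx (h.supp h')

theorem TestFun.gradient_eq_zero {Ω : Set E} {η : E → ℝ} {x : E} (h : TestFun Ω η)
    (hx : x ∉ Ω) : gradient η x = 0 :=
  gradient_of_notMem_tsupport fun h' => hx (h.supp h')

end Calculus

section Forms

variable {E : Type*} [NormedAddCommGroup E] [InnerProductSpace ℝ E] [FiniteDimensional ℝ E]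
  [MeasurableSpace E] [BorelSpace E]

theorem integrable_of_compact {g : E → ℝ} {K : Set E} (hK : IsCompact K)
    (hg : ContinuousOn g K) (h0 : ∀ x ∉ K, g x = 0) : Integrable g := by
  rw [← integrableOn_iff_integrable_of_support_subset (s := K)]
  · exact hg.integrableOn_compact hK
  · intro x hx
    by_contra h
    exact hx (h0 x h)

theorem integrable_mul_of_compact {g V : E → ℝ} {K : Set E} (hK : IsCompact K)
    (hg : ContinuousOn g K) (h0 : ∀ x ∉ K, g x = 0) (hV : Measurable V) {M : ℝ}
    (hM : ∀ x ∈ K, |V x| ≤ M) : Integrable fun x => V x * g x := by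
  rw [← integrableOn_iff_integrable_of_support_subset (s := K)]
  · refine Integrable.bdd_mul (c := M) (hg.integrableOn_compact hK) hV.aestronglyMeasurable ?_
    filter_upwards [ae_restrict_mem hK.measurableSet] with x hx
    exact hM x hx
  · intro x hx
    by_contra h
    exact hx (by simp [h0 x h])

/-- The integrand of the weak form of the equation satisfied by `f = log u`. -/
def logForm (p : ℝ) (V f η : E → ℝ) (x : E) : ℝ :=
  ⟪pflux p (gradient f x), gradient η x⟫ + (V x - (p - 1) * ‖gradient f x‖ ^ p) * η x

/-- `exp f` is a weak supersolution in `Ω`. -/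
def LogSuper (p : ℝ) (V : E → ℝ) (Ω : Set E) (f : E → ℝ) : Prop :=
  ContDiffOn ℝ 1 f Ω ∧ ∀ η : E → ℝ, TestFun Ω η → (∀ x, 0 ≤ η x) →
    0 ≤ ∫ x, logForm p V f η x

/-- `exp f` is a weak subsolution in `Ω`. -/
def LogSub (p : ℝ) (V : E → ℝ) (Ω : Set E) (f : E → ℝ) : Prop :=
  ContDiffOn ℝ 1 f Ω ∧ ∀ η : E → ℝ, TestFun Ω η → (∀ x, 0 ≤ η x) →
    ∫ x, logForm p V f η x ≤ 0

/-- `V` is measurable and bounded on `Ω`. -/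
def BddPot (V : E → ℝ) (Ω : Set E) : Prop := Measurable V ∧ ∃ M : ℝ, ∀ x ∈ Ω, |V x| ≤ M

theorem BddPot.mono {V : E → ℝ} {Ω Ω' : Set E} (h : BddPot V Ω) (hs : Ω' ⊆ Ω) : BddPot V Ω' :=
  ⟨h.1, h.2.imp fun _ hM x hx => hM x (hs hx)⟩

theorem LogSuper.mono {p : ℝ} {V f : E → ℝ} {Ω Ω' : Set E} (h : LogSuper p V Ω f)
    (hs : Ω' ⊆ Ω) : LogSuper p V Ω' f := ⟨h.1.mono hs, fun η hη h0 => h.2 η (hη.mono hs) h0⟩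

theorem LogSub.mono {p : ℝ} {V f : E → ℝ} {Ω Ω' : Set E} (h : LogSub p V Ω f)
    (hs : Ω' ⊆ Ω) : LogSub p V Ω' f := ⟨h.1.mono hs, fun η hη h0 => h.2 η (hη.mono hs) h0⟩

section Integrability

variable {p : ℝ} {V f η : E → ℝ} {Ω : Set E}

theorem continuousOn_pflux_gradient (hp : 1 < p) (hΩ : IsOpen Ω) (hf : ContDiffOn ℝ 1 f Ω) :
    ContinuousOn (fun x => pflux p (gradient f x)) Ω :=
  (continuous_pflux hp).comp_continuousOn (hf.continuousOn_gradient hΩ)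

theorem continuousOn_norm_gradient_rpow {q : ℝ} (hq : 0 ≤ q) (hΩ : IsOpen Ω)
    (hf : ContDiffOn ℝ 1 f Ω) :
    ContinuousOn (fun x => ‖gradient f x‖ ^ q) Ω :=
  (hf.continuousOn_gradient hΩ).norm.rpow_const fun _ _ => Or.inr hq

theorem TestFun.integrable_mul (hη : TestFun Ω η) {g : E → ℝ} (hg : ContinuousOn g Ω) :
    Integrable fun x => g x * η x := by
  refine integrable_of_compact hη.compact ((hg.mono hη.supp).mul
    hη.contDiff.continuous.continuousOn) fun x hx => ?_
  simp [image_eq_zero_of_notMem_tsupport hx]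

theorem TestFun.integrable_inner (hη : TestFun Ω η) {g : E → E} (hg : ContinuousOn g Ω) :
    Integrable fun x => ⟪g x, gradient η x⟫ := by
  refine integrable_of_compact hη.compact ((hg.mono hη.supp).inner
    hη.contDiff.continuous_gradient.continuousOn) fun x hx => ?_
  simp [gradient_of_notMem_tsupport hx]

theorem TestFun.integrable_pot (hη : TestFun Ω η) (hV : BddPot V Ω) {g : E → ℝ}
    (hg : ContinuousOn g Ω) : Integrable fun x => V x * (g x * η x) := by
  obtain ⟨hm, M, hM⟩ := hV
  refine integrable_mul_of_compact hη.compact ((hg.mono hη.supp).mul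
    hη.contDiff.continuous.continuousOn) (fun x hx => ?_) hm fun x hx => hM x (hη.supp hx)
  simp [image_eq_zero_of_notMem_tsupport hx]

theorem integrable_logForm (hp : 1 < p) (hΩ : IsOpen Ω) (hV : BddPot V Ω)
    (hf : ContDiffOn ℝ 1 f Ω) (hη : TestFun Ω η) : Integrable (logForm p V f η) := by
  have h1 := hη.integrable_inner (continuousOn_pflux_gradient hp hΩ hf)
  have h2 := hη.integrable_pot hV (continuousOn_const (c := (1:ℝ)))
  have h3 := hη.integrable_mul
    ((continuousOn_norm_gradient_rpow (by linarith : 0 ≤ p) hΩ hf).const_smul (p - 1))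
  refine ((h1.add h2).sub h3).congr (ae_of_all _ fun x => ?_)
  simp only [Pi.add_apply, Pi.sub_apply, Pi.smul_apply, logForm, smul_eq_mul]
  ring

end Integrability

section WeakSolution

theorem exists_smooth_approx {φ : E → ℝ} (hφ : ContDiff ℝ 1 φ) (hc : HasCompactSupport φ)
    {δ : ℝ} (hδ : 0 < δ) {ε : ℝ} (hε : 0 < ε) :
    ∃ ψ : E → ℝ, ContDiff ℝ (⊤ : ℕ∞) ψ ∧ tsupport ψ ⊆ cthickening δ (tsupport φ) ∧
      (∀ x, |ψ x - φ x| ≤ ε) ∧ ∀ x, ‖gradient ψ x - gradient φ x‖ ≤ ε := by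
  have hu1 : UniformContinuous φ := hc.uniformContinuous_of_continuous hφ.continuous
  have hu2 : UniformContinuous (fderiv ℝ φ) :=
    (hc.fderiv ℝ).uniformContinuous_of_continuous (hφ.continuous_fderiv (by norm_num))
  obtain ⟨r1, hr1, h1⟩ := Metric.uniformContinuous_iff.1 hu1 ε hε
  obtain ⟨r2, hr2, h2⟩ := Metric.uniformContinuous_iff.1 hu2 ε hε
  set r := min δ (min r1 r2) with hr
  have hr0 : 0 < r := by positivity
  let b : ContDiffBump (0 : E) := ⟨r / 2, r, by positivity, by linarith⟩
  have hbr : b.rOut = r := rfl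
  set L := ContinuousLinearMap.lsmul ℝ ℝ (E := ℝ)
  set ψ : E → ℝ := convolution (b.normed volume) φ L volume with hψ
  have hloc : LocallyIntegrable φ := hφ.continuous.locallyIntegrable
  have hbint : LocallyIntegrable (b.normed volume) := b.continuous_normed.locallyIntegrable
  refine ⟨ψ, ?_, ?_, ?_, ?_⟩
  · exact b.hasCompactSupport_normed.contDiff_convolution_left L b.contDiff_normed hloc
  · refine closure_minimal ?_ isClosed_cthickening
    refine (support_convolution_subset L).trans ?_
    rw [b.support_normed_eq, hbr]
    rintro x ⟨y, hy, z, hz, rfl⟩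
    refine mem_cthickening_of_dist_le _ z _ _ (subset_tsupport _ hz) ?_
    have : ‖y‖ < r := by simpa using hy
    simp only [dist_eq_norm, add_sub_cancel_right]
    exact this.le.trans (min_le_left _ _)
  · intro x
    have := b.dist_normed_convolution_le (μ := volume) (x₀ := x) (g := φ) (ε := ε)
      hφ.continuous.aestronglyMeasurable (fun y hy => (h1 (lt_of_lt_of_le (mem_ball.1 hy)
        ((min_le_right _ _).trans (min_le_left _ _)))).le)
    rwa [Real.dist_eq] at this
  · intro x
    have hd := hc.hasFDerivAt_convolution_right (L := L) (μ := volume) hbint hφ x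
    have hL : L.precompR E = ContinuousLinearMap.lsmul ℝ ℝ (E := E →L[ℝ] ℝ) := by
      ext a T
      simp [L, ContinuousLinearMap.precompR_apply]
    have := b.dist_normed_convolution_le (μ := volume) (x₀ := x) (g := fderiv ℝ φ) (ε := ε)
      (hφ.continuous_fderiv (by norm_num)).aestronglyMeasurable
      (fun y hy => (h2 (lt_of_lt_of_le (mem_ball.1 hy)
        ((min_le_right _ _).trans (min_le_right _ _)))).le)
    rw [gradient, gradient, ← map_sub, LinearIsometryEquiv.norm_map, hd.fderiv, hL]
    rwa [dist_eq_norm] at this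

/-- Smooth test functions may be replaced by `C¹` ones. -/
theorem integral_eq_zero_of_smooth {Ω : Set E} (hΩ : IsOpen Ω) {A : E → E} {B : E → ℝ}
    (hA : LocallyIntegrableOn A Ω) (hB : LocallyIntegrableOn B Ω)
    (h : ∀ φ : E → ℝ, ContDiff ℝ (⊤ : ℕ∞) φ → HasCompactSupport φ → tsupport φ ⊆ Ω →
      ∫ x in Ω, (⟪A x, gradient φ x⟫ + B x * φ x) = 0) {φ : E → ℝ} (hφ : TestFun Ω φ) :
    ∫ x in Ω, (⟪A x, gradient φ x⟫ + B x * φ x) = 0 := by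
  obtain ⟨δ, hδ, hsub⟩ := hφ.compact.isCompact.exists_cthickening_subset_open hΩ hφ.supp
  set K := cthickening δ (tsupport φ)
  have hK : IsCompact K := hφ.compact.isCompact.cthickening
  have hAK : IntegrableOn A K := hA.integrableOn_compact_subset hsub hK
  have hBK : IntegrableOn B K := hB.integrableOn_compact_subset hsub hK
  have hval : ∀ ψ : E → ℝ, tsupport ψ ⊆ K →
      ∫ x in Ω, (⟪A x, gradient ψ x⟫ + B x * ψ x) =
      ∫ x in K, (⟪A x, gradient ψ x⟫ + B x * ψ x) := by
    intro ψ hψ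
    refine setIntegral_eq_of_subset_of_forall_sdiff_eq_zero hΩ.measurableSet hsub ?_
    intro x hx
    have : x ∉ tsupport ψ := fun h' => hx.2 (hψ h')
    simp [gradient_of_notMem_tsupport this, image_eq_zero_of_notMem_tsupport this]
  have hint : ∀ ψ : E → ℝ, ContDiff ℝ 1 ψ →
      IntegrableOn (fun x => ⟪A x, gradient ψ x⟫ + B x * ψ x) K := by
    intro ψ hψ
    have hc1 := hψ.continuous_gradient
    have hc2 := hψ.continuous
    obtain ⟨C1, hC1⟩ := hK.exists_bound_of_continuousOn hc1.continuousOn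
    obtain ⟨C2, hC2⟩ := hK.exists_bound_of_continuousOn hc2.continuousOn
    refine Integrable.add ?_ ?_
    · refine (hAK.norm.mul_const C1).mono' (hAK.aestronglyMeasurable.inner
        hc1.aestronglyMeasurable) ?_
      filter_upwards [ae_restrict_mem hK.measurableSet] with x hx
      exact (norm_inner_le_norm _ _).trans (by gcongr; exact hC1 x hx)
    · refine (hBK.norm.mul_const C2).mono' (hBK.aestronglyMeasurable.mul
        hc2.aestronglyMeasurable) ?_
      filter_upwards [ae_restrict_mem hK.measurableSet] with x hx
      rw [norm_mul]
      gcongr; exact hC2 x hx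
  rw [hval φ (self_subset_cthickening _)]
  set I := ∫ x in K, (‖A x‖ + ‖B x‖)
  have hI : 0 ≤ I := integral_nonneg fun x => by positivity
  refine norm_eq_zero.1 (le_antisymm (le_of_forall_pos_le_add fun ε hε => ?_) (norm_nonneg _))
  obtain ⟨ψ, hψ1, hψ2, hψ3, hψ4⟩ := exists_smooth_approx hφ.contDiff hφ.compact hδ
    (ε := ε / (I + 1)) (by positivity)
  have hψ0 := h ψ hψ1 (hK.of_isClosed_subset (isClosed_tsupport _) hψ2) (hψ2.trans hsub)
  rw [hval ψ hψ2] at hψ0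
  have hsubst := integral_sub (hint φ hφ.contDiff) (hint ψ (hψ1.of_le (by exact_mod_cast le_top)))
  rw [hψ0, sub_zero] at hsubst
  rw [← hsubst]
  calc _ ≤ ∫ x in K, (‖A x‖ + ‖B x‖) * (ε / (I + 1)) := by
        refine norm_integral_le_of_norm_le ((hAK.norm.add hBK.norm).mul_const _)
          (ae_of_all _ fun x => ?_)
        have e : ⟪A x, gradient φ x⟫ + B x * φ x - (⟪A x, gradient ψ x⟫ + B x * ψ x) =
          -(⟪A x, gradient ψ x - gradient φ x⟫ + B x * (ψ x - φ x)) := by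
          rw [inner_sub_right]; ring
        rw [e, norm_neg, add_mul]
        refine (norm_add_le _ _).trans (add_le_add ?_ ?_)
        · exact (norm_inner_le_norm _ _).trans (by gcongr; exact hψ4 x)
        · rw [norm_mul]; gcongr; exact hψ3 x
    _ = I * (ε / (I + 1)) := integral_mul_const _ _
    _ ≤ 0 + ε := by
        rw [zero_add, mul_div_assoc', div_le_iff₀ (by positivity)]
        nlinarith

theorem logForm_integral_eq_zero {p : ℝ} (hp : 1 < p) {Ω : Set E} (hΩ : IsOpen Ω)
    {V u : E → ℝ} (hV : Measurable V)
    (hVloc : ∀ K : Set E, IsCompact K → K ⊆ Ω → ∃ M : ℝ, ∀ x ∈ K, |V x| ≤ M)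
    (hu : ContDiffOn ℝ 1 u Ω) (hpos : ∀ x ∈ Ω, 0 < u x)
    (h : ∀ φ : E → ℝ, ContDiff ℝ (⊤ : ℕ∞) φ → HasCompactSupport φ → tsupport φ ⊆ Ω →
      ∫ x in Ω, (‖gradient u x‖ ^ (p - 2) * ⟪gradient u x, gradient φ x⟫ +
        V x * |u x| ^ (p - 2) * u x * φ x) = 0) {η : E → ℝ} (hη : TestFun Ω η) :
    ∫ x, logForm p V (fun x => Real.log (u x)) η x = 0 := by
  have hA : LocallyIntegrableOn (fun x => pflux p (gradient u x)) Ω :=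
    (continuousOn_pflux_gradient hp hΩ hu).locallyIntegrableOn hΩ.measurableSet
  have hupow : ContinuousOn (fun x => |u x| ^ (p - 2) * u x) Ω := by
    refine (hu.continuousOn.abs.rpow_const fun x hx => Or.inl ?_).mul hu.continuousOn
    exact (abs_pos.2 (hpos x hx).ne').ne'
  have hB : LocallyIntegrableOn (fun x => V x * (|u x| ^ (p - 2) * u x)) Ω := by
    rw [locallyIntegrableOn_iff hΩ.isLocallyClosed]
    intro K hK hKc
    obtain ⟨M, hM⟩ := hVloc K hKc hK
    refine Integrable.bdd_mul (c := M) ((hupow.mono hK).integrableOn_compact hKc)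
      hV.aestronglyMeasurable ?_
    filter_upwards [ae_restrict_mem hKc.measurableSet] with x hx
    exact hM x hx
  have hφ : TestFun Ω (fun x => (u x) ^ (1 - p) * η x) :=
    hη.mul_left hΩ (hu.rpow_const_of_ne fun x hx => (hpos x hx).ne')
  have key := integral_eq_zero_of_smooth hΩ hA hB (fun φ h1 h2 h3 => by
    rw [← h φ h1 h2 h3]
    refine integral_congr_ae (ae_of_all _ fun x => ?_)
    simp only [pflux, real_inner_smul_left]
    ring) hφ
  rw [← key, setIntegral_eq_integral_of_forall_compl_eq_zero]
  · refine integral_congr_ae (ae_of_all _ fun x => ?_)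
    by_cases hx : x ∈ Ω
    · have hux := hpos x hx
      have hgu := hu.hasGradientAt hΩ hx
      have hgη := hη.contDiff.hasGradientAt' x
      have e1 : gradient (fun x => Real.log (u x)) x = (u x)⁻¹ • gradient u x :=
        (HasGradientAt.comp_real (Real.hasDerivAt_log hux.ne') hgu).gradient
      have e2 : gradient (fun x => (u x) ^ (1 - p) * η x) x = _ :=
        ((HasGradientAt.comp_real (h := fun t => t ^ (1 - p))
          (Real.hasDerivAt_rpow_const (Or.inl hux.ne')) hgu).mul' hgη).gradient
      simp only [logForm, e1, e2]
      rw [pflux_smul hp (by positivity), norm_smul, Real.norm_of_nonneg (by positivity),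
        Real.mul_rpow (by positivity) (norm_nonneg _), ← inner_pflux_self hp, abs_of_pos hux]
      simp only [inner_add_right, real_inner_smul_left, real_inner_smul_right]
      have r1 : (u x)⁻¹ ^ (p - 1) = u x ^ (1 - p) := by
        rw [Real.inv_rpow hux.le, ← Real.rpow_neg hux.le]; congr 1; ring
      have r2 : (u x)⁻¹ ^ p = u x ^ (1 - p - 1) := by
        rw [Real.inv_rpow hux.le, ← Real.rpow_neg hux.le]; congr 1; ring
      have r3 : u x ^ (p - 2) * u x * u x ^ (1 - p) = 1 := by
        rw [← Real.rpow_add_one hux.ne', ← Real.rpow_add hux,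
          show p - 2 + 1 + (1 - p) = 0 by ring, Real.rpow_zero]
      rw [r1, r2]
      linear_combination (-(V x * η x)) * r3
    · simp [logForm, hη.eq_zero hx, hη.gradient_eq_zero hx, hφ.gradient_eq_zero hx]
  · intro x hx
    simp [hη.eq_zero hx, hφ.gradient_eq_zero hx]

end WeakSolution

end Forms

section Pair

variable {E : Type*} [NormedAddCommGroup E] [InnerProductSpace ℝ E] [FiniteDimensional ℝ E]
  [MeasurableSpace E] [BorelSpace E]
variable {p : ℝ} {V f F η : E → ℝ} {Ω : Set E}

theorem gradient_exp_mul (hΩ : IsOpen Ω) (hf : ContDiffOn ℝ 1 f Ω) (hη : ContDiff ℝ 1 η) (c : ℝ)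
    {x : E} (hx : x ∈ Ω) : gradient (fun x => Real.exp (c * f x) * η x) x =
      Real.exp (c * f x) • (gradient η x + (c * η x) • gradient f x) := by
  have h1 : HasDerivAt (fun t : ℝ => Real.exp (c * t)) (Real.exp (c * f x) * (c * 1)) (f x) :=
    ((hasDerivAt_id (f x)).const_mul c).exp
  rw [((HasGradientAt.comp_real h1 (hf.hasGradientAt hΩ hx)).mul' (hη.hasGradientAt' x)).gradient]
  module

theorem continuousOn_pexcess (hp : 1 < p) {g h : E → E} (hg : ContinuousOn g Ω)
    (hh : ContinuousOn h Ω) : ContinuousOn (fun x => pexcess p (g x) (h x)) Ω := by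
  have h1 := (continuous_pexcess (E := E) hp).comp_continuousOn (f := fun x => (g x, h x))
    (hg.prodMk hh)
  exact h1

theorem pair_ineq (hp : 1 < p) (hΩ : IsOpen Ω) (hV : BddPot V Ω) (hF : LogSuper p V Ω F)
    (hf : LogSub p V Ω f) (hη : TestFun Ω η) (h0 : ∀ x, 0 ≤ η x) :
    ∫ x, Real.exp (p * f x) * (pexcess p (gradient F x) (gradient f x) * η x) ≤
      ∫ x, Real.exp (p * f x) * ⟪pflux p (gradient F x) - pflux p (gradient f x), gradient η x⟫ := by
  have hexp : ContDiffOn ℝ 1 (fun x => Real.exp (p * f x)) Ω :=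
    (contDiffOn_const.mul hf.1).exp
  have hζ : TestFun Ω (fun x => Real.exp (p * f x) * η x) := hη.mul_left hΩ hexp
  have hζ0 : ∀ x, 0 ≤ Real.exp (p * f x) * η x := fun x => mul_nonneg (Real.exp_pos _).le (h0 x)
  have h1 := hF.2 _ hζ hζ0
  have h2 := hf.2 _ hζ hζ0
  have i1 := integrable_logForm hp hΩ hV hF.1 hζ
  have i2 := integrable_logForm hp hΩ hV hf.1 hζ
  have hcN : ContinuousOn (fun x => Real.exp (p * f x) *
      pexcess p (gradient F x) (gradient f x)) Ω :=
    hexp.continuousOn.mul (continuousOn_pexcess hp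
      (hF.1.continuousOn_gradient hΩ) (hf.1.continuousOn_gradient hΩ))
  have i3 := hη.integrable_mul hcN
  have h3 : 0 ≤ ∫ x, (logForm p V F (fun x => Real.exp (p * f x) * η x) x -
      logForm p V f (fun x => Real.exp (p * f x) * η x) x) := by
    rw [integral_sub i1 i2]; linarith
  have e : ∀ x, Real.exp (p * f x) * ⟪pflux p (gradient F x) - pflux p (gradient f x),
      gradient η x⟫ = (logForm p V F (fun x => Real.exp (p * f x) * η x) x -
      logForm p V f (fun x => Real.exp (p * f x) * η x) x) +
      Real.exp (p * f x) * pexcess p (gradient F x) (gradient f x) * η x := by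
    intro x
    by_cases hx : x ∈ Ω
    · simp only [logForm, gradient_exp_mul hΩ hf.1 hη.contDiff p hx,
        inner_add_right, real_inner_smul_right, inner_sub_left, pexcess, inner_pflux_self hp]
      ring
    · simp [logForm, hη.eq_zero hx, hη.gradient_eq_zero hx, hζ.gradient_eq_zero hx]
  have i12 : Integrable fun x => logForm p V F (fun x => Real.exp (p * f x) * η x) x -
      logForm p V f (fun x => Real.exp (p * f x) * η x) x := i1.sub i2
  rw [integral_congr_ae (ae_of_all _ e), integral_add i12 i3]
  have e2 : ∫ x, Real.exp (p * f x) * (pexcess p (gradient F x) (gradient f x) * η x) =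
      ∫ x, Real.exp (p * f x) * pexcess p (gradient F x) (gradient f x) * η x :=
    integral_congr_ae (ae_of_all _ fun x => (mul_assoc _ _ _).symm)
  rw [e2]
  exact le_add_of_nonneg_left h3

theorem TestFun.of_indicator {U K : Set E} {g : E → ℝ} (hU : IsOpen U) (hK : IsCompact K)
    (hKU : K ⊆ U) (hg : ContDiffOn ℝ 1 g U) (h0 : ∀ x ∈ U, x ∉ K → g x = 0) :
    TestFun U (U.indicator g) := by
  have hz : ∀ x ∉ K, U.indicator g x = 0 := by
    intro x hx
    by_cases hxU : x ∈ U
    · rw [indicator_of_mem hxU, h0 x hxU hx]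
    · exact indicator_of_notMem hxU _
  have hts : tsupport (U.indicator g) ⊆ K := by
    refine closure_minimal (fun x hx => ?_) hK.isClosed
    by_contra h; exact hx (hz x h)
  refine ⟨?_, hK.of_isClosed_subset (isClosed_tsupport _) hts, hts.trans hKU⟩
  rw [contDiff_iff_contDiffAt]
  intro x
  by_cases hx : x ∈ K
  · refine (hg.contDiffAt (hU.mem_nhds (hKU hx))).congr_of_eventuallyEq ?_
    filter_upwards [hU.mem_nhds (hKU hx)] with y hy
    exact indicator_of_mem hy _
  · refine (contDiffAt_const (c := (0:ℝ))).congr_of_eventuallyEq ?_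
    filter_upwards [hK.isClosed.isOpen_compl.mem_nhds hx] with y hy
    exact hz y hy

theorem hasDerivAt_posPart_sq (δ s : ℝ) :
    HasDerivAt (fun t : ℝ => (max (t - δ) 0) ^ 2) (2 * max (s - δ) 0) s := by
  rcases lt_trichotomy s δ with h | h | h
  · rw [max_eq_right (by linarith), mul_zero]
    refine (hasDerivAt_const s (0:ℝ)).congr_of_eventuallyEq ?_
    filter_upwards [Iio_mem_nhds h] with t ht
    rw [max_eq_right (by linarith [mem_Iio.1 ht])]; simp
  · subst h
    rw [hasDerivAt_iff_isLittleO]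
    simp only [sub_self, max_self, mul_zero, smul_zero, sub_zero]
    have h1 : (fun t : ℝ => (max (t - s) 0) ^ 2 - 0 ^ 2) =O[𝓝 s] fun t => (t - s) ^ 2 := by
      refine Asymptotics.IsBigO.of_bound 1 (Eventually.of_forall fun t => ?_)
      rw [one_mul, Real.norm_eq_abs, Real.norm_eq_abs, abs_of_nonneg (by rw [zero_pow two_ne_zero, sub_zero]; positivity), abs_of_nonneg (sq_nonneg _)]
      rcases le_total (t - s) 0 with h | h
      · rw [max_eq_right h]; simpa using sq_nonneg (t - s)
      · rw [max_eq_left h]; simp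
    refine h1.trans_isLittleO ?_
    have h2 : (fun t : ℝ => (t - s) ^ 2) = fun t => (t - s) * (t - s) := by ext; ring
    rw [h2]
    have h3 : (fun t : ℝ => t - s) =o[𝓝 s] fun _ => (1:ℝ) := by
      rw [Asymptotics.isLittleO_one_iff]
      have : Continuous fun t : ℝ => t - s := by fun_prop
      simpa using this.tendsto s
    simpa using h3.mul_isBigO (Asymptotics.isBigO_refl (fun t : ℝ => t - s) (𝓝 s))
  · have h1 : HasDerivAt (fun t : ℝ => (t - δ) ^ 2) (2 * (s - δ)) s := by
      refine HasDerivAt.congr_deriv (((hasDerivAt_id s).sub_const δ).pow 2) ?_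
      simp
    rw [max_eq_left (by linarith)]
    refine h1.congr_of_eventuallyEq ?_
    filter_upwards [Ioi_mem_nhds h] with t ht
    rw [max_eq_left (by linarith [mem_Ioi.1 ht])]

theorem contDiff_posPart_sq (δ : ℝ) : ContDiff ℝ 1 fun t : ℝ => (max (t - δ) 0) ^ 2 := by
  rw [contDiff_one_iff_deriv]
  refine ⟨fun s => (hasDerivAt_posPart_sq δ s).differentiableAt, ?_⟩
  have : deriv (fun t : ℝ => (max (t - δ) 0) ^ 2) = fun s => 2 * max (s - δ) 0 :=
    funext fun s => (hasDerivAt_posPart_sq δ s).deriv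
  rw [this]; fun_prop

/-- Weak comparison principle. -/
theorem comparison [Nontrivial E] (hp : 1 < p) (hΩ : IsOpen Ω) (hV : BddPot V Ω)
    (hF : LogSuper p V Ω F) (hf : LogSub p V Ω f) {U : Set E} (hU : IsOpen U)
    (hUc : IsCompact (closure U)) (hUΩ : closure U ⊆ Ω) (hb : ∀ x ∈ frontier U, f x ≤ F x) :
    ∀ x ∈ closure U, f x ≤ F x := by
  have hUsub : U ⊆ Ω := subset_closure.trans hUΩ
  have hfF : ContDiffOn ℝ 1 (fun x => f x - F x) Ω := hf.1.sub hF.1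
  suffices H : ∀ δ > 0, ∀ x ∈ U, f x ≤ F x + δ by
    intro x hx
    by_cases hxU : x ∈ U
    · exact le_of_forall_pos_le_add fun δ hδ => H δ hδ x hxU
    · exact hb x ⟨hx, by rwa [hU.interior_eq]⟩
  intro δ hδ
  set K := {x ∈ closure U | δ ≤ f x - F x} with hKdef
  have hK : IsCompact K := by
    have : K = closure U ∩ (fun x => f x - F x) ⁻¹' Ici δ := rfl
    rw [this]
    exact hUc.of_isClosed_subset ((hfF.continuousOn.mono hUΩ).preimage_isClosed_of_isClosed
      hUc.isClosed isClosed_Ici) inter_subset_left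
  have hKU : K ⊆ U := by
    rintro x ⟨hx, hxd⟩
    by_contra hxU
    have := hb x ⟨hx, by rwa [hU.interior_eq]⟩
    linarith
  set g : E → ℝ := fun x => (max (f x - F x - δ) 0) ^ 2 with hg
  have hgC : ContDiffOn ℝ 1 g U := (contDiff_posPart_sq δ).comp_contDiffOn (hfF.mono hUsub)
  have hη : TestFun U (U.indicator g) := by
    refine TestFun.of_indicator hU hK hKU hgC fun x hxU hxK => ?_
    have : f x - F x < δ := by
      by_contra h; exact hxK ⟨subset_closure hxU, not_lt.1 h⟩
    simp only [hg]
    rw [max_eq_right (by linarith)]; simp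
  have hη0 : ∀ x, 0 ≤ U.indicator g x := fun x => indicator_nonneg (fun y _ => by positivity) x
  have hgrad : ∀ x ∈ U, gradient (U.indicator g) x =
      (2 * max (f x - F x - δ) 0) • (gradient f x - gradient F x) := by
    intro x hx
    have h1 : U.indicator g =ᶠ[𝓝 x] g := by
      filter_upwards [hU.mem_nhds hx] with y hy
      exact indicator_of_mem hy _
    rw [h1.gradient_eq]
    exact (HasGradientAt.comp_real (f := fun x => f x - F x) (hasDerivAt_posPart_sq δ (f x - F x))
      ((hf.1.hasGradientAt hΩ (hUsub hx)).sub' (hF.1.hasGradientAt hΩ (hUsub hx)))).gradient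
  have key := pair_ineq hp hΩ hV hF hf (hη.mono hUsub) hη0
  obtain ⟨c, hc, hlow⟩ := exists_pflux_lower (E := E) hp
  have hle : ∫ x, Real.exp (p * f x) * ⟪pflux p (gradient F x) - pflux p (gradient f x),
      gradient (U.indicator g) x⟫ ≤ 0 := by
    refine integral_nonpos fun x => ?_
    by_cases hx : x ∈ U
    · have h1 := hlow (gradient F x) (gradient f x)
      have h2 : 0 ≤ ⟪pflux p (gradient F x) - pflux p (gradient f x),
          gradient F x - gradient f x⟫ := le_trans (by positivity) h1
      simp only [hgrad x hx, real_inner_smul_right, Pi.zero_apply]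
      rw [← neg_sub (gradient F x), inner_neg_right]
      have h3 : 0 ≤ 2 * max (f x - F x - δ) 0 := by positivity
      have h4 := mul_nonneg (mul_nonneg (Real.exp_pos (p * f x)).le h3) h2
      linarith
    · simp [hη.gradient_eq_zero hx]
  set N : E → ℝ := fun x => Real.exp (p * f x) *
    (pexcess p (gradient F x) (gradient f x) * U.indicator g x) with hN
  have hN0 : ∀ x, 0 ≤ N x := fun x =>
    mul_nonneg (Real.exp_pos _).le (mul_nonneg (pexcess_nonneg_and_eq hp _ _).1 (hη0 x))
  have hcN : ContinuousOn (fun x => Real.exp (p * f x) *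
      pexcess p (gradient F x) (gradient f x)) Ω :=
    (contDiffOn_const.mul hf.1).exp.continuousOn.mul (continuousOn_pexcess hp
      (hF.1.continuousOn_gradient hΩ) (hf.1.continuousOn_gradient hΩ))
  have hNi : Integrable N := by
    refine ((hη.mono hUsub).integrable_mul hcN).congr (ae_of_all _ fun x => ?_)
    simp only [hN]; ring
  have hNz : N =ᵐ[volume] 0 :=
    (integral_eq_zero_iff_of_nonneg hN0 hNi).1 (le_antisymm (key.trans hle)
      (integral_nonneg hN0))
  have hNc : ContinuousOn N U := by
    have : ContinuousOn (fun x => Real.exp (p * f x) *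
      pexcess p (gradient F x) (gradient f x) * U.indicator g x) U :=
      (hcN.mono hUsub).mul hη.contDiff.continuous.continuousOn
    refine this.congr fun x _ => ?_
    simp only [hN]; ring
  have hNzU : EqOn N 0 U :=
    Measure.eqOn_open_of_ae_eq (ae_restrict_of_ae hNz) hU hNc continuousOn_const
  have hgz : ∀ x, gradient (U.indicator g) x = 0 := by
    intro x
    by_cases hx : x ∈ U
    · rw [hgrad x hx]
      rcases le_or_gt (f x - F x - δ) 0 with h | h
      · rw [max_eq_right h]; simp
      · have h1 := hNzU hx
        simp only [hN, indicator_of_mem hx, hg, Pi.zero_apply, mul_eq_zero, Real.exp_ne_zero,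
          false_or] at h1
        rcases h1 with h1 | h1
        · rw [(pexcess_nonneg_and_eq hp _ _).2 h1]; simp
        · rw [max_eq_left h.le] at h1
          have : 0 < (f x - F x - δ) ^ 2 := by positivity
          linarith
    · exact hη.gradient_eq_zero hx
  have hconst : ∀ x y, U.indicator g x = U.indicator g y := by
    refine is_const_of_fderiv_eq_zero (𝕜 := ℝ) (hη.contDiff.differentiable (by norm_num)) ?_
    intro x
    rw [← norm_eq_zero, ← gradient_norm_eq, hgz x, norm_zero]
  intro x hx
  obtain ⟨y, hy⟩ : ∃ y, y ∉ tsupport (U.indicator g) := by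
    by_contra! h
    have : tsupport (U.indicator g) = univ := eq_univ_of_forall h
    have h2 := hη.compact.isCompact
    rw [this] at h2
    have : CompactSpace E := ⟨h2⟩
    exact not_compactSpace_iff.2 (inferInstance : NoncompactSpace E) this
  have h1 := hconst x y
  rw [image_eq_zero_of_notMem_tsupport hy, indicator_of_mem hx] at h1
  have h2 : max (f x - F x - δ) 0 = 0 := by
    simpa [hg] using h1
  have := le_max_left (f x - F x - δ) 0
  linarith

end Pair

section Invariance

variable {E : Type*} [NormedAddCommGroup E] [InnerProductSpace ℝ E] [FiniteDimensional ℝ E]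
  [MeasurableSpace E] [BorelSpace E]
variable {p : ℝ} {V f : E → ℝ} {Ω : Set E}

theorem gradient_add_const (f : E → ℝ) (c : ℝ) (x : E) :
    gradient (fun y => f y + c) x = gradient f x := by
  simp only [gradient]; rw [fderiv_add_const]

theorem LogSuper.add_const (h : LogSuper p V Ω f) (c : ℝ) :
    LogSuper p V Ω (fun x => f x + c) := by
  refine ⟨h.1.add contDiffOn_const, fun η hη h0 => ?_⟩
  have := h.2 η hη h0
  simpa only [logForm, gradient_add_const] using this

theorem LogSub.add_const (h : LogSub p V Ω f) (c : ℝ) :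
    LogSub p V Ω (fun x => f x + c) := by
  refine ⟨h.1.add contDiffOn_const, fun η hη h0 => ?_⟩
  have := h.2 η hη h0
  simpa only [logForm, gradient_add_const] using this

/-- The similarity `y ↦ x₀ + s T y`. -/
def simil (x₀ : E) (s : ℝ) (T : E ≃ₗᵢ[ℝ] E) (y : E) : E := x₀ + s • T y

theorem contDiff_simil (x₀ : E) (s : ℝ) (T : E ≃ₗᵢ[ℝ] E) : ContDiff ℝ 1 (simil x₀ s T) := by
  unfold simil
  exact contDiff_const.add (T.contDiff.const_smul s)

theorem hasGradientAt_comp_simil {x₀ : E} {s : ℝ} {T : E ≃ₗᵢ[ℝ] E} {f : E → ℝ} {y f' : E}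
    (hf : HasGradientAt f f' (simil x₀ s T y)) :
    HasGradientAt (fun y => f (simil x₀ s T y)) (s • T.symm f') y := by
  have hT : HasFDerivAt (simil x₀ s T) (s • (T.toContinuousLinearEquiv : E →L[ℝ] E)) y := by
    unfold simil
    exact ((T.toContinuousLinearEquiv : E →L[ℝ] E).hasFDerivAt.const_smul s).const_add x₀
  rw [hasGradientAt_iff_hasFDerivAt] at hf ⊢
  refine (hf.comp y hT).congr_fderiv ?_
  ext v
  have : ⟪f', T v⟫ = ⟪T.symm f', v⟫ := by
    rw [← LinearIsometryEquiv.inner_map_map T (T.symm f'), T.apply_symm_apply]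
  simp [this]

theorem logForm_transfer (hp : 1 < p) {x₀ : E} {s : ℝ} (hs : 0 < s) (T : E ≃ₗᵢ[ℝ] E)
    (hΩ : IsOpen Ω) (hf : ContDiffOn ℝ 1 f Ω) {η : E → ℝ}
    (hη : TestFun (simil x₀ s T ⁻¹' Ω) η) (h0 : ∀ x, 0 ≤ η x) :
    ∃ c : ℝ, 0 < c ∧ ∃ ζ : E → ℝ, TestFun Ω ζ ∧ (∀ x, 0 ≤ ζ x) ∧
      ∫ y, logForm p (fun y => s ^ p * V (simil x₀ s T y)) (fun y => f (simil x₀ s T y)) η y =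
        c * ∫ x, logForm p V f ζ x := by
  set B : E → E := simil (-(s⁻¹ • T.symm x₀)) s⁻¹ T.symm with hB
  have hAB : ∀ x, simil x₀ s T (B x) = x := by
    intro x; simp [simil, hB, smul_smul, hs.ne']
  have hBA : ∀ x, B (simil x₀ s T x) = x := by
    intro x; simp [simil, hB, smul_smul, hs.ne']
  have hBc : ContDiff ℝ 1 B := contDiff_simil _ _ _
  have hAc : ContDiff ℝ 1 (simil x₀ s T) := contDiff_simil _ _ _
  let Ah : E ≃ₜ E := ⟨⟨simil x₀ s T, B, hBA, hAB⟩, hAc.continuous, hBc.continuous⟩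
  have hts : tsupport (fun x => η (B x)) = B ⁻¹' tsupport η :=
    tsupport_comp_eq_preimage η Ah.symm
  have hζ : TestFun Ω (fun x => η (B x)) := by
    refine ⟨hη.contDiff.comp hBc, ?_, ?_⟩
    · exact hη.compact.comp_homeomorph Ah.symm
    · rw [hts]
      intro x hx
      have := hη.supp hx
      rwa [mem_preimage, hAB] at this
  refine ⟨s ^ p * |(s ^ Module.finrank ℝ E)⁻¹|, by positivity, _, hζ, fun x => h0 _, ?_⟩
  have hpt : ∀ y, logForm p (fun y => s ^ p * V (simil x₀ s T y))
      (fun y => f (simil x₀ s T y)) η y =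
      s ^ p * logForm p V f (fun x => η (B x)) (simil x₀ s T y) := by
    intro y
    by_cases hy : simil x₀ s T y ∈ Ω
    · have g1 := (hasGradientAt_comp_simil (hf.hasGradientAt hΩ hy)).gradient
      have g2 : gradient (fun x => η (B x)) (simil x₀ s T y) = s⁻¹ • T (gradient η y) := by
        have h1 : HasGradientAt η (gradient η y) (B (simil x₀ s T y)) := by
          rw [hBA]; exact hη.contDiff.hasGradientAt' y
        have := (hasGradientAt_comp_simil h1).gradient
        simpa using this
      simp only [logForm, g1, g2, hBA, norm_smul, Real.norm_of_nonneg hs.le,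
        LinearIsometryEquiv.norm_map]
      rw [pflux_smul hp hs.le, pflux_map, Real.mul_rpow hs.le (norm_nonneg _),
        real_inner_smul_left, real_inner_smul_right, ← LinearIsometryEquiv.inner_map_map T,
        T.apply_symm_apply]
      have : s ^ p * s⁻¹ = s ^ (p - 1) := by
        rw [Real.rpow_sub_one hs.ne']; rfl
      rw [← this]; ring
    · have h1 : y ∉ simil x₀ s T ⁻¹' Ω := hy
      simp [logForm, hη.eq_zero h1, hη.gradient_eq_zero h1, hζ.gradient_eq_zero hy, hBA]
  simp_rw [hpt]
  rw [integral_const_mul, mul_assoc]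
  congr 1
  set h := logForm p V f (fun x => η (B x))
  have s1 : ∫ y, h (simil x₀ s T y) = ∫ z, h (x₀ + s • z) :=
    T.measurePreserving.integral_comp T.toHomeomorph.measurableEmbedding (fun z => h (x₀ + s • z))
  rw [s1, Measure.integral_comp_smul volume (fun z => h (x₀ + z)) s,
    integral_add_left_eq_self h x₀, smul_eq_mul]

theorem LogSuper.comp_simil (hp : 1 < p) {x₀ : E} {s : ℝ} (hs : 0 < s) (T : E ≃ₗᵢ[ℝ] E)
    (hΩ : IsOpen Ω) (h : LogSuper p V Ω f) :
    LogSuper p (fun y => s ^ p * V (simil x₀ s T y)) (simil x₀ s T ⁻¹' Ω)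
      (fun y => f (simil x₀ s T y)) := by
  refine ⟨h.1.comp (contDiff_simil _ _ _).contDiffOn (mapsTo_preimage _ _), fun η hη h0 => ?_⟩
  obtain ⟨c, hc, ζ, hζ, hζ0, e⟩ := logForm_transfer (V := V) hp hs T hΩ h.1 hη h0
  rw [e]
  exact mul_nonneg hc.le (h.2 ζ hζ hζ0)

theorem LogSub.comp_simil (hp : 1 < p) {x₀ : E} {s : ℝ} (hs : 0 < s) (T : E ≃ₗᵢ[ℝ] E)
    (hΩ : IsOpen Ω) (h : LogSub p V Ω f) :
    LogSub p (fun y => s ^ p * V (simil x₀ s T y)) (simil x₀ s T ⁻¹' Ω)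
      (fun y => f (simil x₀ s T y)) := by
  refine ⟨h.1.comp (contDiff_simil _ _ _).contDiffOn (mapsTo_preimage _ _), fun η hη h0 => ?_⟩
  obtain ⟨c, hc, ζ, hζ, hζ0, e⟩ := logForm_transfer (V := V) hp hs T hΩ h.1 hη h0
  rw [e]
  exact mul_nonpos_of_nonneg_of_nonpos hc.le (h.2 ζ hζ hζ0)

end Invariance

section Cutoff

theorem hasDerivAt_posPart_pow (k : ℕ) (s : ℝ) :
    HasDerivAt (fun t : ℝ => (max t 0) ^ (k + 2)) ((k + 2 : ℕ) * (max s 0) ^ (k + 1)) s := by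
  have h : HasDerivAt (fun t : ℝ => (max (t - 0) 0) ^ 2) (2 * max (s - 0) 0) s :=
    hasDerivAt_posPart_sq 0 s
  simp only [sub_zero] at h
  induction k with
  | zero => simpa using h
  | succ k ih =>
    rcases lt_trichotomy s 0 with hs | hs | hs
    · rw [max_eq_right hs.le, zero_pow (by omega), mul_zero]
      refine (hasDerivAt_const s (0:ℝ)).congr_of_eventuallyEq ?_
      filter_upwards [Iio_mem_nhds hs] with t ht
      rw [max_eq_right (mem_Iio.1 ht).le, zero_pow (by omega)]
    · subst hs
      simp only [max_self] at h ih ⊢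
      rw [zero_pow (by omega), mul_zero] at ih ⊢
      have hc : Continuous fun t : ℝ => max t 0 := by fun_prop
      rw [hasDerivAt_iff_isLittleO] at ih ⊢
      simp only [max_self, sub_zero, smul_zero] at ih ⊢
      rw [zero_pow (by omega)] at ih ⊢
      have h1 : (fun t : ℝ => max t 0) =O[𝓝 (0:ℝ)] fun _ => (1:ℝ) :=
        (hc.tendsto 0).isBigO_one ℝ
      have := ih.mul_isBigO h1
      refine (this.congr (fun t => ?_) (fun t => ?_))
      · ring
      · ring
    · refine HasDerivAt.congr_of_eventuallyEq (f := fun t : ℝ => t ^ (k + 1 + 2)) ?_ ?_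
      · rw [max_eq_left hs.le]
        exact hasDerivAt_pow (k + 1 + 2) s
      · filter_upwards [Ioi_mem_nhds hs] with t ht
        rw [max_eq_left (mem_Ioi.1 ht).le]

variable {E : Type*} [NormedAddCommGroup E] [InnerProductSpace ℝ E]

/-- The cutoff `(r² - ‖x‖²)₊`. -/
def cut (r : ℝ) (x : E) : ℝ := max (r ^ 2 - ‖x‖ ^ 2) 0

theorem cut_nonneg (r : ℝ) (x : E) : 0 ≤ cut r x := le_max_right _ _

theorem cut_le_one {r : ℝ} (h0 : 0 ≤ r) (h1 : r ≤ 1) (x : E) : cut r x ≤ 1 := by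
  refine max_le ?_ zero_le_one
  nlinarith [sq_nonneg ‖x‖]

theorem cut_eq_zero {r : ℝ} (h0 : 0 ≤ r) {x : E} (hx : x ∉ ball (0 : E) r) : cut r x = 0 := by
  have : r ≤ ‖x‖ := by simpa using hx
  exact max_eq_right (by nlinarith)

theorem le_cut {r r' : ℝ} (h0 : 0 ≤ r') {x : E} (hx : x ∈ ball (0 : E) r') :
    r ^ 2 - r' ^ 2 ≤ cut r x := by
  have : ‖x‖ < r' := by simpa using hx
  refine le_trans ?_ (le_max_left _ _)
  nlinarith [norm_nonneg x]

theorem contDiff_cut_pow (r : ℝ) {m : ℕ} (hm : 2 ≤ m) :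
    ContDiff ℝ 1 fun x : E => (cut r x) ^ m := by
  obtain ⟨k, rfl⟩ := Nat.exists_eq_add_of_le' hm
  have h1 : ContDiff ℝ 1 fun t : ℝ => (max t 0) ^ (k + 2) := by
    rw [contDiff_one_iff_deriv]
    refine ⟨fun s => (hasDerivAt_posPart_pow k s).differentiableAt, ?_⟩
    have : deriv (fun t : ℝ => (max t 0) ^ (k + 2)) =
        fun s => ((k + 2 : ℕ) : ℝ) * (max s 0) ^ (k + 1) :=
      funext fun s => (hasDerivAt_posPart_pow k s).deriv
    rw [this]; fun_prop
  have h2 : ContDiff ℝ 1 fun x : E => r ^ 2 - ‖x‖ ^ 2 :=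
    contDiff_const.sub (contDiff_norm_sq ℝ)
  exact h1.comp h2

variable [CompleteSpace E]

theorem gradient_cut_pow (r : ℝ) {m : ℕ} (hm : 2 ≤ m) (x : E) :
    gradient (fun x : E => (cut r x) ^ m) x = (-(2 * m * (cut r x) ^ (m - 1))) • x := by
  obtain ⟨k, rfl⟩ := Nat.exists_eq_add_of_le' hm
  have h2 : HasGradientAt (fun x : E => r ^ 2 - ‖x‖ ^ 2) (-(2:ℝ) • x) x := by
    rw [hasGradientAt_iff_hasFDerivAt]
    refine ((hasStrictFDerivAt_norm_sq x).hasFDerivAt.const_sub (r ^ 2)).congr_fderiv ?_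
    ext v
    simp
  have := (HasGradientAt.comp_real (f := fun x : E => r ^ 2 - ‖x‖ ^ 2)
    (hasDerivAt_posPart_pow k (r ^ 2 - ‖x‖ ^ 2)) h2).gradient
  simp only [cut]
  rw [this, smul_smul]
  congr 1
  simp only [show k + 2 - 1 = k + 1 by omega]
  ring

theorem norm_gradient_cut_pow_le {r : ℝ} (h0 : 0 ≤ r) (h1 : r ≤ 1) {m : ℕ} (hm : 2 ≤ m) (x : E) :
    ‖gradient (fun x : E => (cut r x) ^ m) x‖ ≤ 2 * m * (cut r x) ^ (m - 1) := by
  rw [gradient_cut_pow r hm, norm_smul, Real.norm_eq_abs, abs_neg,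
    abs_of_nonneg (by have := cut_nonneg r x; positivity)]
  by_cases hx : x ∈ ball (0 : E) r
  · have : ‖x‖ ≤ 1 := by
      have : ‖x‖ < r := by simpa using hx
      linarith
    have h2 : 0 ≤ 2 * m * (cut r x) ^ (m - 1) := by have := cut_nonneg r x; positivity
    nlinarith
  · rw [cut_eq_zero h0 hx, zero_pow (by omega)]; simp

theorem testFun_cut_pow [FiniteDimensional ℝ E] {Ω : Set E} {r : ℝ} (h0 : 0 ≤ r)
    (hr : closedBall (0 : E) r ⊆ Ω) {m : ℕ} (hm : 2 ≤ m) :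
    TestFun Ω fun x : E => (cut r x) ^ m := by
  have hts : tsupport (fun x : E => (cut r x) ^ m) ⊆ closedBall (0 : E) r := by
    refine closure_minimal (fun x hx => ?_) isClosed_closedBall
    by_contra h
    refine hx ?_
    have : x ∉ ball (0 : E) r := fun h' => h (ball_subset_closedBall h')
    simp only [cut_eq_zero h0 this]
    exact zero_pow (by omega)
  exact ⟨contDiff_cut_pow r hm,
    (isCompact_closedBall (0 : E) r).of_isClosed_subset (isClosed_tsupport _) hts, hts.trans hr⟩

end Cutoff

section Moser

variable {E : Type*} [NormedAddCommGroup E] [InnerProductSpace ℝ E] [FiniteDimensional ℝ E]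
  [MeasurableSpace E] [BorelSpace E]

theorem gagliardo_nirenberg_sobolev (hn : 2 ≤ Module.finrank ℝ E) :
    ∃ κ : ℝ, 1 < κ ∧ κ ≤ 2 ∧ ∃ C : ℝ, 1 ≤ C ∧ ∀ g : E → ℝ, ContDiff ℝ 1 g → HasCompactSupport g →
      ∫ x, |g x| ^ κ ≤ C * (∫ x, ‖gradient g x‖) ^ κ := by
  set n : ℝ := ((Module.finrank ℝ E : ℕ) : ℝ) with hndef
  have hn2 : (2:ℝ) ≤ n := by rw [hndef]; exact_mod_cast hn
  have hconj : Real.HolderConjugate n (n / (n - 1)) :=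
    Real.HolderConjugate.conjExponent (by linarith)
  have hκ : 1 < n / (n - 1) := by rw [lt_div_iff₀ (by linarith)]; linarith
  have hκ2 : n / (n - 1) ≤ 2 := by rw [div_le_iff₀ (by linarith)]; linarith
  set κ := n / (n - 1)
  refine ⟨κ, hκ, hκ2, max 1 (lintegralPowLePowLIntegralFDerivConst (volume : Measure E) κ : ℝ),
    le_max_left _ _, ?_⟩
  intro g hg hgc
  have h := lintegral_pow_le_pow_lintegral_fderiv (volume : Measure E) hg hgc hconj
  have hκ0 : 0 ≤ κ := by linarith
  have e1 : ∫⁻ x, ‖g x‖ₑ ^ κ = ENNReal.ofReal (∫ x, |g x| ^ κ) := by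
    rw [ofReal_integral_eq_lintegral_ofReal]
    · refine lintegral_congr fun x => ?_
      rw [← ENNReal.ofReal_rpow_of_nonneg (abs_nonneg _) hκ0, Real.enorm_eq_ofReal_abs]
    · refine integrable_of_compact hgc ?_ fun x hx => ?_
      · exact (hg.continuous.abs.rpow_const fun _ => Or.inr hκ0).continuousOn
      · rw [image_eq_zero_of_notMem_tsupport hx, abs_zero, Real.zero_rpow (by linarith)]
    · exact ae_of_all _ fun x => by positivity
  have e2 : ∫⁻ x, ‖fderiv ℝ g x‖ₑ = ENNReal.ofReal (∫ x, ‖gradient g x‖) := by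
    rw [ofReal_integral_eq_lintegral_ofReal]
    · refine lintegral_congr fun x => ?_
      rw [gradient_norm_eq, ofReal_norm]
    · refine integrable_of_compact hgc hg.continuous_gradient.norm.continuousOn fun x hx => ?_
      rw [gradient_of_notMem_tsupport hx, norm_zero]
    · exact ae_of_all _ fun x => by positivity
  have hI : 0 ≤ ∫ x, ‖gradient g x‖ := integral_nonneg fun x => by positivity
  rw [e1, e2, ENNReal.ofReal_rpow_of_nonneg hI hκ0, ← ENNReal.ofReal_coe_nnreal,
    ← ENNReal.ofReal_mul (by positivity), ENNReal.ofReal_le_ofReal_iff (by positivity)] at h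
  refine h.trans ?_
  gcongr
  exact le_max_right _ _

theorem moser_step (hn : 2 ≤ Module.finrank ℝ E) : ∃ κ : ℝ, 1 < κ ∧ κ ≤ 2 ∧
    ∀ (C : ℝ) (m : ℕ), 0 ≤ C → 2 ≤ m → ∃ C₁ : ℝ, 1 ≤ C₁ ∧ ∀ (z : E → ℝ) (γ r r' : ℝ),
      ContDiffOn ℝ 1 z (ball 0 1) → (∀ x ∈ ball (0 : E) 1, 0 < z x) → 1 ≤ γ → 0 < r' → r' < r →
      r < 1 → ∫ x, (cut r x) ^ m * (‖gradient z x‖ * z x ^ (γ - 1)) ≤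
        C * ∫ x in ball (0 : E) r, z x ^ γ →
      ∫ x in ball (0 : E) r', z x ^ (γ * κ) ≤
        (C₁ * γ * ((r ^ 2 - r' ^ 2) ^ m)⁻¹ * ∫ x in ball (0 : E) r, z x ^ γ) ^ κ := by
  obtain ⟨κ, hκ, hκ2, C₀, hC₀, hgns⟩ := gagliardo_nirenberg_sobolev (E := E) hn
  refine ⟨κ, hκ, hκ2, fun C m hC hm => ⟨C₀ * (C + 2 * m + 1), ?_, ?_⟩⟩
  · have : (0:ℝ) ≤ m := by positivity
    nlinarith
  intro z γ r r' hz hpos hγ hr'0 hr' hr1 H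
  have hr0 : 0 < r := hr'0.trans hr'
  have hsub : closedBall (0 : E) r ⊆ ball 0 1 := closedBall_subset_ball hr1
  have hcut := testFun_cut_pow hr0.le hsub hm
  have hzγ : ContDiffOn ℝ 1 (fun x => z x ^ γ) (ball 0 1) :=
    hz.rpow_const_of_ne fun x hx => (hpos x hx).ne'
  have hg := hcut.mul_left isOpen_ball hzγ
  set g : E → ℝ := fun x => z x ^ γ * cut r x ^ m with hgdef
  have key := hgns g hg.contDiff hg.compact
  set I := ∫ x in ball (0 : E) r, z x ^ γ with hI
  have hzc : ∀ a : ℝ, ContinuousOn (fun x => z x ^ a) (ball (0:E) 1) := fun a =>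
    hz.continuousOn.rpow_const fun x hx => Or.inl (hpos x hx).ne'
  have hint : ∀ a : ℝ, ∀ t < 1, IntegrableOn (fun x => z x ^ a) (ball (0:E) t) := fun a t ht =>
    (((hzc a).mono (closedBall_subset_ball ht)).integrableOn_compact
      (isCompact_closedBall _ _)).mono_set ball_subset_closedBall
  have hI0 : 0 ≤ I := setIntegral_nonneg measurableSet_ball fun x hx =>
    (Real.rpow_pos_of_pos (hpos x (ball_subset_ball hr1.le hx)) _).le
  have hgradle : ∀ x, ‖gradient g x‖ ≤ γ * (cut r x ^ m * (‖gradient z x‖ * z x ^ (γ - 1))) +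
      2 * m * (ball (0:E) r).indicator (fun x => z x ^ γ) x := by
    intro x
    by_cases hx : x ∈ ball (0:E) r
    · have hx1 := ball_subset_ball hr1.le hx
      have hzx := hpos x hx1
      have g1 : gradient g x = _ := ((HasGradientAt.comp_real (h := fun t => t ^ γ)
          (Real.hasDerivAt_rpow_const (Or.inl hzx.ne')) (hz.hasGradientAt isOpen_ball hx1)).mul'
          (hcut.contDiff.hasGradientAt' x)).gradient
      rw [g1, indicator_of_mem hx, add_comm]
      refine (norm_add_le _ _).trans (add_le_add (le_of_eq ?_) ?_)
      · rw [norm_smul, norm_smul, Real.norm_of_nonneg (pow_nonneg (cut_nonneg r x) m),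
          Real.norm_of_nonneg (by positivity)]
        ring
      · rw [norm_smul, Real.norm_of_nonneg (by positivity), mul_comm]
        gcongr
        refine (norm_gradient_cut_pow_le hr0.le hr1.le hm x).trans ?_
        have := pow_le_one₀ (n := m - 1) (cut_nonneg r x) (cut_le_one hr0.le hr1.le x)
        have h2 : (0:ℝ) ≤ 2 * m := by positivity
        nlinarith
    · have h0 : g x = 0 := by simp [hgdef, cut_eq_zero hr0.le hx, show m ≠ 0 by omega]
      have h1 : gradient g x = 0 := by
        have hmin : IsLocalMin g x := by
          filter_upwards with y
          rw [h0]
          by_cases hy : y ∈ ball (0:E) r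
          · exact mul_nonneg (Real.rpow_pos_of_pos (hpos y (ball_subset_ball hr1.le hy)) _).le
              (pow_nonneg (cut_nonneg r y) m)
          · simp [hgdef, cut_eq_zero hr0.le hy, show m ≠ 0 by omega]
        rw [← norm_eq_zero, gradient_norm_eq, hmin.fderiv_eq_zero, norm_zero]
      rw [h1, indicator_of_notMem hx, cut_eq_zero hr0.le hx, zero_pow (by omega)]
      simp
  have hint1 : Integrable fun x => cut r x ^ m * (‖gradient z x‖ * z x ^ (γ - 1)) := by
    refine (hcut.integrable_mul (g := fun x => ‖gradient z x‖ * z x ^ (γ - 1)) ?_).congr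
      (ae_of_all _ fun x => mul_comm _ _)
    exact (hz.continuousOn_gradient isOpen_ball).norm.mul (hzc _)
  have hint2 : Integrable ((ball (0:E) r).indicator fun x => z x ^ γ) :=
    (hint γ r hr1).integrable_indicator measurableSet_ball
  have h2 : ∫ x, ‖gradient g x‖ ≤ (C + 2 * m + 1) * γ * I := by
    calc ∫ x, ‖gradient g x‖ ≤ ∫ x, (γ * (cut r x ^ m * (‖gradient z x‖ * z x ^ (γ - 1))) +
          2 * m * (ball (0:E) r).indicator (fun x => z x ^ γ) x) :=
          integral_mono_of_nonneg (ae_of_all _ fun x => norm_nonneg _)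
            ((hint1.const_mul γ).add (hint2.const_mul _)) (ae_of_all _ hgradle)
      _ = γ * (∫ x, cut r x ^ m * (‖gradient z x‖ * z x ^ (γ - 1))) + 2 * m * I := by
          rw [integral_add (hint1.const_mul γ) (hint2.const_mul _), integral_const_mul,
            integral_const_mul, integral_indicator measurableSet_ball]
      _ ≤ γ * (C * I) + 2 * m * I := by gcongr
      _ ≤ _ := by
          have : 0 ≤ 2 * m * I := by positivity
          nlinarith [mul_nonneg (by linarith : 0 ≤ γ) hI0]
  have hd : 0 < r ^ 2 - r' ^ 2 := by nlinarith
  have h3 : ((r ^ 2 - r' ^ 2) ^ m) ^ κ * ∫ x in ball (0:E) r', z x ^ (γ * κ) ≤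
      ∫ x, |g x| ^ κ := by
    rw [← integral_const_mul, ← integral_indicator measurableSet_ball]
    refine integral_mono_of_nonneg (ae_of_all _ fun x => ?_) ?_ (ae_of_all _ fun x => ?_)
    · refine indicator_nonneg (fun y hy => ?_) x
      have := hpos y (ball_subset_ball (hr'.trans hr1).le hy)
      positivity
    · refine integrable_of_compact hg.compact ?_ fun x hx => ?_
      · exact (hg.contDiff.continuous.abs.rpow_const fun _ => Or.inr (by linarith)).continuousOn
      · rw [image_eq_zero_of_notMem_tsupport hx, abs_zero, Real.zero_rpow (by linarith)]
    · by_cases hx : x ∈ ball (0:E) r'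
      · have hzx := hpos x (ball_subset_ball (hr'.trans hr1).le hx)
        rw [indicator_of_mem hx, hgdef]
        simp only
        rw [abs_of_nonneg (mul_nonneg (by positivity) (pow_nonneg (cut_nonneg r x) m)),
          Real.mul_rpow (by positivity) (pow_nonneg (cut_nonneg r x) m), ← Real.rpow_mul hzx.le,
          mul_comm]
        have := le_cut (r := r) hr'0.le hx
        gcongr
      · rw [indicator_of_notMem hx]; positivity
  have h4 : ∫ x in ball (0:E) r', z x ^ (γ * κ) ≤
      (((r ^ 2 - r' ^ 2) ^ m)⁻¹) ^ κ * (C₀ * ((C + 2 * m + 1) * γ * I) ^ κ) := by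
    rw [Real.inv_rpow (by positivity), ← div_eq_inv_mul, le_div_iff₀ (by positivity), mul_comm]
    refine h3.trans (key.trans ?_)
    have : 0 ≤ ∫ x, ‖gradient g x‖ := integral_nonneg fun x => norm_nonneg _
    gcongr
  refine h4.trans ?_
  have hC₀κ : C₀ ≤ C₀ ^ κ := Real.self_le_rpow_of_one_le hC₀ hκ.le
  have hb : 0 ≤ (C + 2 * m + 1) * γ * I := by positivity
  calc _ ≤ (((r ^ 2 - r' ^ 2) ^ m)⁻¹) ^ κ * (C₀ ^ κ * ((C + 2 * m + 1) * γ * I) ^ κ) := by gcongr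
    _ = _ := by
        rw [← Real.mul_rpow (by positivity) hb, ← Real.mul_rpow (by positivity) (by positivity)]
        congr 1
        ring

theorem iterate_bound {κ : ℝ} (hκ : 1 < κ) {C b : ℝ} (hC : 1 ≤ C) (hb : 1 ≤ b) :
    ∃ D : ℝ, 1 ≤ D ∧ ∀ I : ℕ → ℝ, (∀ j, 0 ≤ I j) → (∀ j, I (j + 1) ≤ (C * b ^ j * I j) ^ κ) →
      ∀ j, I j ≤ (D * I 0) ^ (κ ^ j) := by
  set α := κ / (κ - 1) with hα
  set β := α / (κ - 1) with hβ
  have hκ1 : 0 < κ - 1 := by linarith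
  have hα0 : 0 < α := by positivity
  have hβ0 : 0 < β := by positivity
  have eα : α + κ = α * κ := by rw [hα]; field_simp; ring
  have eβ : α + β = β * κ := by rw [hβ]; field_simp; ring
  have hC0 : 0 < C := by linarith
  have hb0 : 0 < b := by linarith
  refine ⟨C ^ α * b ^ β, one_le_mul_of_one_le_of_one_le (Real.one_le_rpow hC hα0.le)
    (Real.one_le_rpow hb hβ0.le), fun I hI hs => ?_⟩
  have key : ∀ j : ℕ, C ^ α * b ^ (α * j + β) * I j ≤ (C ^ α * b ^ β * I 0) ^ (κ ^ j) := by
    intro j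
    induction j with
    | zero => simp
    | succ j ih =>
      have hIj := hI j
      calc C ^ α * b ^ (α * ((j + 1 : ℕ) : ℝ) + β) * I (j + 1)
          ≤ C ^ α * b ^ (α * ((j + 1 : ℕ) : ℝ) + β) * (C * b ^ j * I j) ^ κ := by
            gcongr; exact hs j
        _ = (C ^ α * b ^ (α * j + β) * I j) ^ κ := by
            rw [Real.mul_rpow (by positivity) hIj, Real.mul_rpow (by positivity) hIj,
              Real.mul_rpow (by positivity) (by positivity),
              Real.mul_rpow (by positivity) (by positivity), ← Real.rpow_mul hC0.le,
              ← Real.rpow_mul hb0.le, ← Real.rpow_natCast, ← Real.rpow_mul hb0.le, ← eα,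
              Real.rpow_add hC0]
            have : (α * j + β) * κ = α * ((j + 1 : ℕ) : ℝ) + β + j * κ := by
              push_cast; linear_combination (-(j:ℝ)) * eα - eβ
            rw [this, Real.rpow_add hb0 (α * ((j + 1 : ℕ) : ℝ) + β)]
            ring
        _ ≤ ((C ^ α * b ^ β * I 0) ^ (κ ^ j)) ^ κ := by gcongr
        _ = _ := by
            rw [← Real.rpow_mul (mul_nonneg (by positivity) (hI 0)), pow_succ]
  intro j
  refine le_trans ?_ (key j)
  have : 1 ≤ C ^ α * b ^ (α * j + β) := one_le_mul_of_one_le_of_one_le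
    (Real.one_le_rpow hC hα0.le) (Real.one_le_rpow hb (by positivity))
  exact le_mul_of_one_le_left (hI j) this

theorem moser (hn : 2 ≤ Module.finrank ℝ E) (C γ₀ : ℝ) (m : ℕ) (hC : 0 ≤ C) (hγ₀ : 1 ≤ γ₀)
    (hm : 2 ≤ m) : ∃ D : ℝ, 0 < D ∧ ∀ z : E → ℝ, ContDiffOn ℝ 1 z (ball 0 1) →
      (∀ x ∈ ball (0 : E) 1, 0 < z x) →
      (∀ γ r : ℝ, γ₀ ≤ γ → 0 < r → r < 1 →
        ∫ x, (cut r x) ^ m * (‖gradient z x‖ * z x ^ (γ - 1)) ≤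
          C * ∫ x in ball (0 : E) r, z x ^ γ) →
      z 0 ^ γ₀ ≤ D * ∫ x in ball (0 : E) (3 / 4), z x ^ γ₀ := by
  obtain ⟨κ, hκ, hκ2, hstep⟩ := moser_step (E := E) hn
  obtain ⟨C₁, hC₁, hstep⟩ := hstep C m hC hm
  have hb : (1:ℝ) ≤ κ * 2 ^ m := one_le_mul_of_one_le_of_one_le hκ.le (one_le_pow₀ (by norm_num))
  have hC2 : 1 ≤ C₁ * γ₀ * 8 ^ m := one_le_mul_of_one_le_of_one_le
    (one_le_mul_of_one_le_of_one_le hC₁ hγ₀) (one_le_pow₀ (by norm_num))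
  obtain ⟨D, hD, hiter⟩ := iterate_bound hκ hC2 hb
  refine ⟨D, by linarith, fun z hz hpos H => ?_⟩
  set ρ : ℕ → ℝ := fun j => 1 / 2 + (1 / 2) ^ j / 4 with hρ
  have hρpow : ∀ j : ℕ, (0:ℝ) < (1 / 2) ^ j ∧ ((1:ℝ) / 2) ^ j ≤ 1 := fun j =>
    ⟨by positivity, pow_le_one₀ (by norm_num) (by norm_num)⟩
  set I : ℕ → ℝ := fun j => ∫ x in ball (0 : E) (ρ j), z x ^ (γ₀ * κ ^ j) with hI
  have hρ1 : ∀ j, ρ j < 1 := fun j => by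
    simp only [hρ]; linarith [(hρpow j).2]
  have hI0 : ∀ j, 0 ≤ I j := fun j => setIntegral_nonneg measurableSet_ball fun x hx =>
    (Real.rpow_pos_of_pos (hpos x (ball_subset_ball (hρ1 j).le hx)) _).le
  have hIs : ∀ j, I (j + 1) ≤ (C₁ * γ₀ * 8 ^ m * (κ * 2 ^ m) ^ j * I j) ^ κ := by
    intro j
    have hκj : 1 ≤ κ ^ j := one_le_pow₀ hκ.le
    have hγ : γ₀ ≤ γ₀ * κ ^ j := le_mul_of_one_le_right (by linarith) hκj
    have hlt : ρ (j + 1) < ρ j := by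
      simp only [hρ, pow_succ]; linarith [(hρpow j).1]
    have hp1 : 0 < ρ (j + 1) := by simp only [hρ]; linarith [(hρpow (j + 1)).1]
    have := hstep z (γ₀ * κ ^ j) (ρ j) (ρ (j + 1)) hz hpos (hγ₀.trans hγ) hp1 hlt (hρ1 j)
      (H _ _ hγ (hp1.trans hlt) (hρ1 j))
    have e : γ₀ * κ ^ j * κ = γ₀ * κ ^ (j + 1) := by rw [pow_succ]; ring
    rw [e] at this
    refine this.trans (Real.rpow_le_rpow ?_ ?_ (by linarith))
    · have : 0 < ρ j ^ 2 - ρ (j + 1) ^ 2 := by nlinarith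
      have := hI0 j
      positivity
    · have h1 : (1 / 2) ^ j / 8 ≤ ρ j ^ 2 - ρ (j + 1) ^ 2 := by
        simp only [hρ, pow_succ]; nlinarith [(hρpow j).1]
      have h2 : ((ρ j ^ 2 - ρ (j + 1) ^ 2) ^ m)⁻¹ ≤ (((1 / 2) ^ j / 8) ^ m)⁻¹ := by
        gcongr
      have h3 : ((((1:ℝ) / 2) ^ j / 8) ^ m)⁻¹ = 8 ^ m * (2 ^ m) ^ j := by
        rw [div_pow, div_pow, one_pow, one_div, inv_pow, inv_div, div_inv_eq_mul, ← pow_mul,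
          ← pow_mul, mul_comm j m]
      rw [h3] at h2
      have := hI0 j
      calc _ ≤ C₁ * (γ₀ * κ ^ j) * (8 ^ m * (2 ^ m) ^ j) * I j := by gcongr
        _ = _ := by rw [mul_pow κ]; ring
  have hfin := hiter I hI0 hIs
  have e0 : I 0 = ∫ x in ball (0 : E) (3 / 4), z x ^ γ₀ := by
    simp only [hI, hρ, pow_zero, mul_one]; norm_num
  rw [← e0]
  by_contra! hcon
  set Y := D * I 0
  have hY0 : 0 ≤ Y := mul_nonneg (by linarith) (hI0 0)
  have hγ0 : 0 < γ₀ := by linarith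
  obtain ⟨Y', hYY', hY'⟩ := exists_between hcon
  have hcont : ContinuousAt (fun x => z x ^ γ₀) 0 :=
    (hz.continuousOn.continuousAt (ball_mem_nhds 0 one_pos)).rpow_const (Or.inr hγ0.le)
  obtain ⟨s, hs, hsz⟩ := Metric.eventually_nhds_iff_ball.1 (hcont.eventually_const_lt hY')
  set t := min s (1 / 2)
  have ht : 0 < t := by positivity
  set v := (volume : Measure E).real (ball (0:E) t) with hv
  have hv0 : 0 < v := ENNReal.toReal_pos (measure_ball_pos _ _ ht).ne' measure_ball_lt_top.ne
  have hlow : ∀ j : ℕ, v * Y' ^ (κ ^ j) ≤ Y ^ (κ ^ j) := by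
    intro j
    refine le_trans ?_ (hfin j)
    have hsub : ball (0:E) t ⊆ ball 0 (ρ j) := ball_subset_ball (by
      simp only [hρ]; linarith [(hρpow j).1, min_le_right s (1 / 2 : ℝ)])
    have hint : IntegrableOn (fun x => z x ^ (γ₀ * κ ^ j)) (ball (0:E) (ρ j)) :=
      (((hz.continuousOn.rpow_const fun x hx => Or.inl (hpos x hx).ne').mono
        (closedBall_subset_ball (hρ1 j))).integrableOn_compact
        (isCompact_closedBall _ _)).mono_set ball_subset_closedBall
    calc v * Y' ^ (κ ^ j) = ∫ x in ball (0:E) t, Y' ^ (κ ^ j) := by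
          rw [setIntegral_const, smul_eq_mul]
      _ ≤ ∫ x in ball (0:E) t, z x ^ (γ₀ * κ ^ j) := by
          refine setIntegral_mono_on (integrableOn_const measure_ball_lt_top.ne)
            (hint.mono_set hsub) measurableSet_ball fun x hx => ?_
          have h1 := hsz x (ball_subset_ball (min_le_left _ _) hx)
          have h2 := hpos x (ball_subset_ball (hρ1 j).le (hsub hx))
          rw [Real.rpow_mul h2.le]
          exact Real.rpow_le_rpow (by linarith) h1.le (by positivity)
      _ ≤ I j := by
          refine setIntegral_mono_set hint ?_ (Eventually.of_forall hsub)
          filter_upwards [ae_restrict_mem measurableSet_ball] with x hx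
          exact (Real.rpow_pos_of_pos (hpos x (ball_subset_ball (hρ1 j).le hx)) _).le
  have hY'0 : 0 < Y' := lt_of_le_of_lt hY0 hYY'
  have hq0 : 0 ≤ Y / Y' := by positivity
  have hq1 : Y / Y' < 1 := (div_lt_one hY'0).2 hYY'
  have hlim : Tendsto (fun j : ℕ => (Y / Y') ^ (κ ^ j)) atTop (𝓝 0) :=
    (tendsto_rpow_atTop_of_base_lt_one _ (by linarith) hq1).comp
      (tendsto_pow_atTop_atTop_of_one_lt hκ)
  have hv2 : v ≤ 0 := by
    refine ge_of_tendsto' hlim fun j => ?_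
    rw [Real.div_rpow hY0 hY'0.le, le_div_iff₀ (by positivity)]
    exact hlow j
  linarith

end Moser

section Poincare

variable {E : Type*} [NormedAddCommGroup E] [InnerProductSpace ℝ E] [FiniteDimensional ℝ E]
  [MeasurableSpace E] [BorelSpace E]

theorem enorm_sub_midpoint_le {z : E → ℝ} {U : Set E} (hU : IsOpen U) (hc : Convex ℝ U)
    (hz : ContDiffOn ℝ 1 z U) {x y : E} (hx : x ∈ U) (hy : y ∈ U) :
    ‖z y - z (x + (1 / 2 : ℝ) • (y - x))‖ₑ ≤
      ∫⁻ t in Icc (1 / 2 : ℝ) 1, ‖y - x‖ₑ * U.indicator (fun w => ‖gradient z w‖ₑ) (x + t • (y - x)) := by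
  have hmem : ∀ t ∈ Icc (0:ℝ) 1, x + t • (y - x) ∈ U := fun t ht =>
    hc.add_smul_sub_mem hx hy ht
  have hsub : Icc (1 / 2 : ℝ) 1 ⊆ Icc 0 1 := Icc_subset_Icc_left (by norm_num)
  have hl : ContDiff ℝ 1 fun t : ℝ => x + t • (y - x) := by fun_prop
  have hcd : ContDiffOn ℝ 1 (fun t : ℝ => z (x + t • (y - x))) (Icc (1 / 2) 1) :=
    hz.comp hl.contDiffOn fun t ht => hmem t (hsub ht)
  have h := enorm_sub_le_lintegral_deriv_of_contDiffOn_Icc hcd (by norm_num)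
  simp only [one_smul, add_sub_cancel] at h
  refine h.trans (setLIntegral_mono' measurableSet_Icc fun t ht => ?_)
  have hgr := hz.hasGradientAt hU (hmem t (hsub ht))
  have hd : HasDerivAt (fun t : ℝ => x + t • (y - x)) (y - x) t := by
    simpa using ((hasDerivAt_id t).smul_const (y - x)).const_add x
  have hd2 := (hasGradientAt_iff_hasFDerivAt.1 hgr).comp_hasDerivAt t hd
  rw [indicator_of_mem (hmem t (hsub ht))]
  have e : deriv (fun t : ℝ => z (x + t • (y - x))) t = ⟪gradient z (x + t • (y - x)), y - x⟫ := by
    refine (hd2.deriv).trans ?_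
    simp
  rw [e, ← ofReal_norm, ← ofReal_norm, ← ofReal_norm, ← ENNReal.ofReal_mul (norm_nonneg _)]
  refine ENNReal.ofReal_le_ofReal ?_
  rw [mul_comm]
  exact norm_inner_le_norm _ _

theorem lintegral_comp_segment_le {H : E → ℝ≥0∞} (hH : Measurable H) (x : E) {t : ℝ}
    (ht : t ∈ Icc (1 / 2 : ℝ) 1) :
    ∫⁻ y, H (x + t • (y - x)) ≤ 2 ^ Module.finrank ℝ E * ∫⁻ w, H w := by
  have ht0 : 0 < t := lt_of_lt_of_le (by norm_num) ht.1
  have e1 : ∫⁻ y, H (x + t • (y - x)) = ∫⁻ y, H (t • y) := by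
    have h1 : ∀ y, H (x + t • (y - x)) = (fun w => H (t • w + (x - t • x))) y := fun y => by
      simp only [smul_sub]; congr 1; abel
    have h2 : ∀ y, H (t • y + (x - t • x)) = (fun w => H (t • w)) (y + t⁻¹ • (x - t • x)) :=
      fun y => by simp only [smul_add, smul_smul, mul_inv_cancel₀ ht0.ne', one_smul]
    simp only [h1, h2]
    exact lintegral_add_right_eq_self (fun w => H (t • w)) _
  have e2 : ∫⁻ y, H (t • y) = ENNReal.ofReal |(t ^ Module.finrank ℝ E)⁻¹| * ∫⁻ w, H w := by
    have hm : Measurable fun y : E => t • y := measurable_const_smul t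
    rw [← lintegral_map hH hm, Measure.map_addHaar_smul _ ht0.ne', lintegral_smul_measure,
      smul_eq_mul]
  rw [e1, e2]
  gcongr
  rw [abs_of_pos (by positivity), ← inv_pow, ENNReal.ofReal_pow (by positivity)]
  gcongr
  refine ENNReal.ofReal_le_of_le_toReal ?_
  simp only [ENNReal.toReal_ofNat]
  rw [inv_le_comm₀ ht0 two_pos]
  linarith [ht.1]

theorem lintegral_segment_le {H : E → ℝ≥0∞} (hH : Measurable H) (U : Set E) :
    ∫⁻ x in U, ∫⁻ y in U, ∫⁻ t in Icc (1 / 2 : ℝ) 1, H (x + t • (y - x)) ≤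
      2 ^ Module.finrank ℝ E * volume U * ∫⁻ w, H w := by
  have h1 : ∀ x, ∫⁻ y in U, ∫⁻ t in Icc (1 / 2 : ℝ) 1, H (x + t • (y - x)) ≤
      2 ^ Module.finrank ℝ E * ∫⁻ w, H w := by
    intro x
    rw [lintegral_lintegral_swap (by
      refine Measurable.aemeasurable ?_
      refine hH.comp (Continuous.measurable ?_)
      fun_prop)]
    calc ∫⁻ t in Icc (1 / 2 : ℝ) 1, ∫⁻ y in U, H (x + t • (y - x))
        ≤ ∫⁻ t in Icc (1 / 2 : ℝ) 1, 2 ^ Module.finrank ℝ E * ∫⁻ w, H w := by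
          refine setLIntegral_mono' measurableSet_Icc fun t ht => ?_
          exact (setLIntegral_le_lintegral _ _).trans (lintegral_comp_segment_le hH x ht)
      _ ≤ _ := by
          rw [setLIntegral_const]
          refine mul_le_of_le_one_right (by positivity) ?_
          rw [Real.volume_Icc]
          refine ENNReal.ofReal_le_one.2 (by norm_num)
  calc _ ≤ ∫⁻ x in U, 2 ^ Module.finrank ℝ E * ∫⁻ w, H w := lintegral_mono fun x => h1 x
    _ = _ := by rw [setLIntegral_const]; ring

theorem poincare {z : E → ℝ} {r : ℝ} (hz : ContDiffOn ℝ 1 z (ball 0 r)) :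
    ∫⁻ x in ball (0:E) r, ∫⁻ y in ball (0:E) r, ‖z y - z x‖ₑ ≤
      4 * ENNReal.ofReal r * 2 ^ Module.finrank ℝ E * volume (ball (0:E) r) *
        ∫⁻ w in ball (0:E) r, ‖gradient z w‖ₑ := by
  set U := ball (0:E) r with hU
  set H : E → ℝ≥0∞ := U.indicator fun w => ‖gradient z w‖ₑ with hH
  have hHm : Measurable H := by
    have : H = fun w => ‖U.indicator (gradient z) w‖ₑ := by
      funext w
      by_cases hw : w ∈ U <;> simp [hH, hw]
    rw [this]
    refine Measurable.enorm ?_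
    classical
    rw [← piecewise_eq_indicator]
    exact (hz.continuousOn_gradient isOpen_ball).measurable_piecewise
      continuousOn_const measurableSet_ball
  have hm1 : Measurable fun q : (E × E) × ℝ => H (q.1.1 + q.2 • (q.1.2 - q.1.1)) :=
    hHm.comp (Continuous.measurable (by fun_prop))
  set J : E → E → ℝ≥0∞ := fun x y => ∫⁻ t in Icc (1 / 2 : ℝ) 1, H (x + t • (y - x)) with hJ
  have hJm : Measurable (Function.uncurry J) := hm1.lintegral_prod_right'
  have hpt : ∀ x ∈ U, ∀ y ∈ U, ‖z y - z x‖ₑ ≤ 2 * ENNReal.ofReal r * (J x y + J y x) := by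
    intro x hx y hy
    have hb : ∀ x ∈ U, ∀ y ∈ U, ‖z y - z (x + (1 / 2 : ℝ) • (y - x))‖ₑ ≤
        2 * ENNReal.ofReal r * J x y := by
      intro x hx y hy
      refine (enorm_sub_midpoint_le isOpen_ball (convex_ball _ _) hz hx hy).trans ?_
      have hmt : Measurable fun t : ℝ => H (x + t • (y - x)) :=
        hm1.comp (measurable_prodMk_left (x := (x, y)))
      rw [hJ, ← lintegral_const_mul _ hmt]
      refine lintegral_mono fun t => ?_
      dsimp only
      gcongr
      rw [← ofReal_norm, show (2:ℝ≥0∞) = ENNReal.ofReal 2 by simp,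
        ← ENNReal.ofReal_mul (by norm_num)]
      refine ENNReal.ofReal_le_ofReal ?_
      have := norm_sub_le y x
      have h1 := mem_ball_zero_iff.1 hx
      have h2 := mem_ball_zero_iff.1 hy
      linarith
    have h1 := hb x hx y hy
    have h2 := hb y hy x hx
    have e : y + (1 / 2 : ℝ) • (x - y) = x + (1 / 2 : ℝ) • (y - x) := by module
    rw [e] at h2
    set mm := x + (1 / 2 : ℝ) • (y - x)
    calc ‖z y - z x‖ₑ = ‖(z y - z mm) - (z x - z mm)‖ₑ := by congr 1; ring
      _ ≤ ‖z y - z mm‖ₑ + ‖z x - z mm‖ₑ := enorm_sub_le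
      _ ≤ _ := by rw [mul_add]; exact add_le_add h1 h2
  have hJ2 : ∫⁻ x in U, ∫⁻ y in U, J y x = ∫⁻ x in U, ∫⁻ y in U, J x y :=
    lintegral_lintegral_swap (hJm.comp measurable_swap).aemeasurable
  have hJb := lintegral_segment_le hHm U
  calc ∫⁻ x in U, ∫⁻ y in U, ‖z y - z x‖ₑ
      ≤ ∫⁻ x in U, ∫⁻ y in U, 2 * ENNReal.ofReal r * (J x y + J y x) :=
        setLIntegral_mono' measurableSet_ball fun x hx =>
          setLIntegral_mono' measurableSet_ball fun y hy => hpt x hx y hy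
    _ = 2 * ENNReal.ofReal r * ((∫⁻ x in U, ∫⁻ y in U, J x y) + ∫⁻ x in U, ∫⁻ y in U, J y x) := by
        have hr : 2 * ENNReal.ofReal r ≠ ∞ := by finiteness
        simp_rw [lintegral_const_mul' _ _ hr]
        congr 1
        rw [← lintegral_add_left]
        · refine lintegral_congr fun x => ?_
          have hm2 : Measurable (J x) := hJm.comp measurable_prodMk_left
          rw [lintegral_add_left hm2]
        · exact hJm.lintegral_prod_right'
    _ ≤ _ := by
        rw [hJ2, ← two_mul]
        have e : ∫⁻ w, H w = ∫⁻ w in U, ‖gradient z w‖ₑ := lintegral_indicator measurableSet_ball _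
        rw [e] at hJb
        calc _ ≤ 2 * ENNReal.ofReal r * (2 * (2 ^ Module.finrank ℝ E * volume U *
              ∫⁻ w in U, ‖gradient z w‖ₑ)) := by gcongr
          _ = _ := by ring

/-- The De Giorgi type class of positive functions satisfying all weighted logarithmic
gradient bounds with decreasing weights. -/
def DeGiorgi (m : ℕ) (C : ℝ) (w : E → ℝ) : Prop :=
  ContDiffOn ℝ 1 w (ball 0 1) ∧ (∀ x ∈ ball (0 : E) 1, 0 < w x) ∧
  ∀ Θ : ℝ → ℝ, ContDiffOn ℝ 1 Θ (Ioi 0) → AntitoneOn Θ (Ioi 0) → (∀ s > 0, 0 ≤ Θ s) →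
    ∀ r : ℝ, 0 < r → r < 1 →
      ∫ x, cut r x ^ m * (‖gradient w x‖ / w x * Θ (w x)) ≤ C * ∫ x in ball (0 : E) r, Θ (w x)

theorem mul_integral_le_of_le_two {z : E → ℝ} (hz : ContDiffOn ℝ 1 z (ball 0 1))
    (hz0 : ∀ x ∈ ball (0 : E) 1, 0 ≤ z x) {r : ℝ} (hr0 : 0 < r) (hr : r < 1) {A : Set E}
    (hA : MeasurableSet A) (hAr : A ⊆ ball 0 r) (hA2 : ∀ x ∈ A, z x ≤ 2) :
    volume.real A * ∫ x in ball (0 : E) r, z x ≤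
      2 * volume.real (ball (0 : E) r) ^ 2 +
        4 * 2 ^ Module.finrank ℝ E * volume.real (ball (0 : E) r) *
          ∫ x in ball (0 : E) r, ‖gradient z x‖ := by
  set U := ball (0:E) r with hU
  have hsub : closedBall (0:E) r ⊆ ball 0 1 := closedBall_subset_ball hr
  have hi1 : IntegrableOn z U := ((hz.continuousOn.mono hsub).integrableOn_compact
    (isCompact_closedBall _ _)).mono_set ball_subset_closedBall
  have hi2 : IntegrableOn (fun x => ‖gradient z x‖) U :=
    (((hz.continuousOn_gradient isOpen_ball).norm.mono hsub).integrableOn_compact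
    (isCompact_closedBall _ _)).mono_set ball_subset_closedBall
  have hUfin : volume U ≠ ∞ := measure_ball_lt_top.ne
  have hAfin : volume A ≠ ∞ := ((measure_mono hAr).trans_lt measure_ball_lt_top).ne
  have e1 : ∫⁻ x in U, ENNReal.ofReal (z x) = ENNReal.ofReal (∫ x in U, z x) := by
    rw [ofReal_integral_eq_lintegral_ofReal hi1]
    filter_upwards [ae_restrict_mem measurableSet_ball] with x hx
    exact hz0 x (ball_subset_ball hr.le hx)
  have e2 : ∫⁻ x in U, ‖gradient z x‖ₑ = ENNReal.ofReal (∫ x in U, ‖gradient z x‖) := by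
    rw [ofReal_integral_eq_lintegral_ofReal hi2 (ae_of_all _ fun x => norm_nonneg _)]
    exact lintegral_congr fun x => (ofReal_norm _).symm
  have hP := poincare (hz.mono (ball_subset_ball hr.le))
  have h1 : volume A * ∫⁻ y in U, ENNReal.ofReal (z y) ≤
      2 * volume U * volume A + ∫⁻ x in U, ∫⁻ y in U, ‖z y - z x‖ₑ := by
    calc volume A * ∫⁻ y in U, ENNReal.ofReal (z y)
        = ∫⁻ x in A, ∫⁻ y in U, ENNReal.ofReal (z y) := by rw [setLIntegral_const, mul_comm]
      _ ≤ ∫⁻ x in A, (2 * volume U + ∫⁻ y in U, ‖z y - z x‖ₑ) := by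
          refine setLIntegral_mono' hA fun x hx => ?_
          calc _ ≤ ∫⁻ y in U, (2 + ‖z y - z x‖ₑ) := by
                refine lintegral_mono fun y => ?_
                rw [Real.enorm_eq_ofReal_abs, show (2:ℝ≥0∞) = ENNReal.ofReal 2 by simp,
                  ← ENNReal.ofReal_add (by norm_num) (abs_nonneg _)]
                refine ENNReal.ofReal_le_ofReal ?_
                linarith [le_abs_self (z y - z x), hA2 x hx]
            _ = _ := by rw [lintegral_add_left measurable_const, setLIntegral_const]
      _ = 2 * volume U * volume A + ∫⁻ x in A, ∫⁻ y in U, ‖z y - z x‖ₑ := by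
          rw [lintegral_add_left measurable_const, setLIntegral_const]
      _ ≤ _ := by gcongr
  have h2 := h1.trans (add_le_add_right hP _)
  rw [e1, e2, ← ENNReal.ofReal_toReal hUfin, ← ENNReal.ofReal_toReal hAfin] at h2
  have hI1 : 0 ≤ ∫ x in U, z x :=
    setIntegral_nonneg measurableSet_ball fun x hx => hz0 x (ball_subset_ball hr.le hx)
  have hI2 : 0 ≤ ∫ x in U, ‖gradient z x‖ := integral_nonneg fun x => norm_nonneg _
  change ENNReal.ofReal (volume.real A) * _ ≤ 2 * ENNReal.ofReal (volume.real U) *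
    ENNReal.ofReal (volume.real A) + 4 * ENNReal.ofReal r * 2 ^ Module.finrank ℝ E *
    ENNReal.ofReal (volume.real U) * _ at h2
  have hAU : volume.real A ≤ volume.real U := measureReal_mono hAr hUfin
  have hA0 : 0 ≤ volume.real A := measureReal_nonneg
  have hU0 : 0 ≤ volume.real U := measureReal_nonneg
  have c2 : (2:ℝ≥0∞) = ENNReal.ofReal 2 := by simp
  have c4 : (4:ℝ≥0∞) = ENNReal.ofReal 4 := by simp
  rw [c2, c4, ← ENNReal.ofReal_pow (by norm_num), ← ENNReal.ofReal_mul hA0,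
    ← ENNReal.ofReal_mul (by norm_num), ← ENNReal.ofReal_mul (by positivity),
    ← ENNReal.ofReal_mul (by positivity), ← ENNReal.ofReal_mul (by positivity),
    ← ENNReal.ofReal_mul (by positivity), ← ENNReal.ofReal_mul (by positivity),
    ← ENNReal.ofReal_add (by positivity) (by positivity),
    ENNReal.ofReal_le_ofReal_iff (by positivity)] at h2
  refine h2.trans (add_le_add ?_ ?_)
  · rw [pow_two, mul_assoc]; gcongr
  · have : 4 * r * 2 ^ Module.finrank ℝ E ≤ 4 * 2 ^ Module.finrank ℝ E := by
      gcongr; linarith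
    gcongr

theorem DeGiorgi.lower_bound (hn : 2 ≤ Module.finrank ℝ E) (C α : ℝ) (m : ℕ) (hC : 0 ≤ C)
    (hm : 2 ≤ m) (hα : 0 < α) : ∃ c : ℝ, 0 < c ∧ ∀ w : E → ℝ, DeGiorgi m C w → ∀ δ > 0,
      α ≤ volume.real {x ∈ ball (0 : E) (3 / 4) | δ ≤ w x} → c * δ ≤ w 0 := by
  obtain ⟨D, hD, hmoser⟩ := moser (E := E) hn C 1 m hC le_rfl hm
  set v₁ := volume.real (ball (0 : E) (3 / 4)) with hv₁
  set v₂ := volume.real (ball (0 : E) (7 / 8)) with hv₂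
  have hv₁0 : 0 ≤ v₁ := measureReal_nonneg
  have hv₂0 : 0 ≤ v₂ := measureReal_nonneg
  set K := D * (α⁻¹ * (2 * v₁ ^ 2 + 4 * 2 ^ Module.finrank ℝ E * v₁ *
    ((((7/8:ℝ)) ^ 2 - (3/4) ^ 2) ^ m)⁻¹ * (C * v₂))) with hK
  refine ⟨Real.exp (-K), Real.exp_pos _, fun w hw δ hδ hA => ?_⟩
  obtain ⟨hw1, hwpos, hwΘ⟩ := hw
  set L : ℝ → ℝ := fun s => Real.log (Real.exp 1 + δ / s) with hL
  have hL1 : ∀ s > 0, 1 ≤ L s := fun s hs => by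
    have : 0 < δ / s := by positivity
    calc (1:ℝ) = Real.log (Real.exp 1) := (Real.log_exp 1).symm
      _ ≤ _ := Real.log_le_log (Real.exp_pos 1) (by linarith)
  have hLd : ContDiffOn ℝ 1 L (Ioi 0) := by
    refine ContDiffOn.log ?_ fun s hs => ?_
    · exact contDiffOn_const.add (contDiffOn_const.div contDiffOn_id fun s hs => ne_of_gt hs)
    · have : 0 < δ / s := div_pos hδ hs
      positivity
  have hLa : AntitoneOn L (Ioi 0) := fun s hs t ht hst => by
    have hs' : 0 < s := hs
    have ht' : 0 < t := ht
    refine Real.log_le_log (by positivity) ?_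
    gcongr
  set z : E → ℝ := fun x => L (w x) with hz
  have hzd : ContDiffOn ℝ 1 z (ball 0 1) := hLd.comp hw1 fun x hx => hwpos x hx
  have hz1 : ∀ x ∈ ball (0:E) 1, 1 ≤ z x := fun x hx => hL1 _ (hwpos x hx)
  have hgz : ∀ x ∈ ball (0:E) 1, ‖gradient z x‖ ≤ ‖gradient w x‖ / w x := by
    intro x hx
    have hwx := hwpos x hx
    have hd : HasDerivAt L ((-(δ / w x ^ 2)) / (Real.exp 1 + δ / w x)) (w x) := by
      have h1 : HasDerivAt (fun s : ℝ => Real.exp 1 + δ / s) (-(δ / w x ^ 2)) (w x) := by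
        have := ((hasDerivAt_inv hwx.ne').const_mul δ).const_add (Real.exp 1)
        simpa [div_eq_mul_inv] using this
      exact h1.log (by positivity)
    have hg := HasGradientAt.comp_real hd (hw1.hasGradientAt isOpen_ball hx)
    rw [show gradient z x = _ from hg.gradient, norm_smul, div_eq_mul_inv ‖_‖, mul_comm]
    gcongr
    rw [neg_div, norm_neg, Real.norm_of_nonneg (by positivity), div_le_iff₀ (by positivity),
      mul_add]
    have : 0 < (w x)⁻¹ * Real.exp 1 := by positivity
    have e : (w x)⁻¹ * (δ / w x) = δ / w x ^ 2 := by field_simp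
    linarith
  have hzc : ContinuousOn z (ball 0 1) := hzd.continuousOn
  have hcaccio : ∀ γ r : ℝ, 1 ≤ γ → 0 < r → r < 1 →
      ∫ x, (cut r x) ^ m * (‖gradient z x‖ * z x ^ (γ - 1)) ≤
        C * ∫ x in ball (0 : E) r, z x ^ (γ - 1) := by
    intro γ r hγ hr0 hr
    have h := hwΘ (fun s => L s ^ (γ - 1))
      (hLd.rpow_const_of_ne fun s hs => (lt_of_lt_of_le one_pos (hL1 s hs)).ne')
      (fun s hs t ht hst => Real.rpow_le_rpow (zero_le_one.trans (hL1 t ht)) (hLa hs ht hst)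
        (by linarith)) (fun s hs => Real.rpow_nonneg (zero_le_one.trans (hL1 s hs)) _) r hr0 hr
    refine le_trans ?_ h
    have hcut : TestFun (ball (0:E) 1) (fun x => cut r x ^ m) :=
      testFun_cut_pow hr0.le (closedBall_subset_ball hr) hm
    have hzr : ContinuousOn (fun x => z x ^ (γ - 1)) (ball (0:E) 1) :=
      hzc.rpow_const fun x hx => Or.inr (by linarith)
    have i1 := hcut.integrable_mul (((hzd.continuousOn_gradient isOpen_ball).norm).mul hzr)
    have i2 := hcut.integrable_mul ((((hw1.continuousOn_gradient isOpen_ball).norm).div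
      hw1.continuousOn fun x hx => (hwpos x hx).ne').mul hzr)
    refine integral_mono (i1.congr (ae_of_all _ fun x => mul_comm _ _))
      (i2.congr (ae_of_all _ fun x => mul_comm _ _)) fun x => ?_
    by_cases hx : x ∈ ball (0:E) 1
    · have := hgz x hx
      have h1 := hz1 x hx
      have h0 : 0 ≤ cut r x ^ m := pow_nonneg (cut_nonneg _ _) _
      dsimp only
      gcongr
    · have := hcut.eq_zero hx
      simp [this]
  have hint : ∀ a r : ℝ, 0 ≤ a → r < 1 → IntegrableOn (fun x => z x ^ a) (ball (0:E) r) :=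
    fun a r ha hr => (((hzc.rpow_const fun x hx => Or.inr ha).mono
      (closedBall_subset_ball hr)).integrableOn_compact
        (isCompact_closedBall _ _)).mono_set ball_subset_closedBall
  have hM := hmoser z hzd (fun x hx => one_pos.trans_le (hz1 x hx)) (fun γ r hγ hr0 hr => by
    refine (hcaccio γ r hγ hr0 hr).trans ?_
    refine mul_le_mul_of_nonneg_left ?_ hC
    refine setIntegral_mono_on (hint _ _ (by linarith) hr) (hint _ _ (by linarith) hr)
      measurableSet_ball fun x hx => ?_
    exact Real.rpow_le_rpow_of_exponent_le (hz1 x (ball_subset_ball hr.le hx)) (by linarith))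
  simp only [Real.rpow_one] at hM
  set A := {x ∈ ball (0 : E) (3 / 4) | δ ≤ w x} with hAdef
  have hAm : MeasurableSet A := by
    have hc : ContinuousOn w (ball (0:E) (3/4)) :=
      hw1.continuousOn.mono (ball_subset_ball (by norm_num))
    have e : A = ball (0:E) (3/4) \ (ball (0:E) (3/4) ∩ w ⁻¹' Iio δ) := by
      ext x; simp only [hAdef, mem_setOf_eq, mem_diff, mem_inter_iff, mem_preimage, mem_Iio]
      constructor
      · rintro ⟨h1, h2⟩; exact ⟨h1, fun h => absurd h.2 (not_lt.2 h2)⟩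
      · rintro ⟨h1, h2⟩; exact ⟨h1, not_lt.1 fun h => h2 ⟨h1, h⟩⟩
    rw [e]
    exact measurableSet_ball.diff (hc.isOpen_inter_preimage isOpen_ball isOpen_Iio).measurableSet
  have hA2 : ∀ x ∈ A, z x ≤ 2 := by
    rintro x ⟨hx, hxd⟩
    have hwx := hwpos x (ball_subset_ball (by norm_num) hx)
    have h1 : δ / w x ≤ 1 := (div_le_one hwx).2 hxd
    have h0 : 0 < δ / w x := by positivity
    have he : (2:ℝ) ≤ Real.exp 1 := by linarith [Real.add_one_le_exp (1:ℝ)]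
    calc z x ≤ Real.log (Real.exp 2) := by
          refine Real.log_le_log (by positivity) ?_
          rw [show (2:ℝ) = 1 + 1 by norm_num, Real.exp_add]
          nlinarith
      _ = 2 := Real.log_exp 2
  have hP := mul_integral_le_of_le_two hzd (fun x hx => zero_le_one.trans (hz1 x hx))
    (by norm_num) (by norm_num) hAm (fun x hx => hx.1) hA2
  have hgrad : ∫ x in ball (0:E) (3/4), ‖gradient z x‖ ≤
      ((((7/8:ℝ)) ^ 2 - (3/4) ^ 2) ^ m)⁻¹ * (C * v₂) := by
    have h1 := hcaccio 1 (7/8) le_rfl (by norm_num) (by norm_num)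
    simp only [sub_self, Real.rpow_zero, mul_one, setIntegral_const, smul_eq_mul] at h1
    rw [inv_mul_eq_div, le_div_iff₀ (by norm_num)]
    refine le_trans ?_ h1
    have hcut : TestFun (ball (0:E) 1) (fun x => cut (7/8) x ^ m) :=
      testFun_cut_pow (by norm_num) (closedBall_subset_ball (by norm_num)) hm
    have i1 := hcut.integrable_mul ((hzd.continuousOn_gradient isOpen_ball).norm)
    have i1' : Integrable fun x => cut (7/8) x ^ m * ‖gradient z x‖ :=
      i1.congr (ae_of_all _ fun x => mul_comm _ _)
    have i2 : IntegrableOn (fun x => ‖gradient z x‖) (ball (0:E) (3/4)) :=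
      (((hzd.continuousOn_gradient isOpen_ball).norm.mono
        (closedBall_subset_ball (by norm_num))).integrableOn_compact
        (isCompact_closedBall _ _)).mono_set ball_subset_closedBall
    rw [mul_comm, ← integral_const_mul]
    refine le_trans (setIntegral_mono_on (i2.const_mul _) i1'.integrableOn measurableSet_ball
      fun x hx => ?_) (setIntegral_le_integral i1' (ae_of_all _ fun x =>
        mul_nonneg (pow_nonneg (cut_nonneg _ _) _) (norm_nonneg _)))
    have hx' := mem_ball_zero_iff.1 hx
    gcongr
    refine le_trans ?_ (le_max_left _ _)
    have : ‖x‖ ^ 2 ≤ (3/4) ^ 2 := by gcongr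
    norm_num at this ⊢
    linarith
  have hzi0 : 0 ≤ ∫ x in ball (0:E) (3/4), z x := setIntegral_nonneg measurableSet_ball
    fun x hx => zero_le_one.trans (hz1 x (ball_subset_ball (by norm_num) hx))
  have hzK : z 0 ≤ K := by
    refine hM.trans ?_
    rw [hK]
    refine mul_le_mul_of_nonneg_left ?_ hD.le
    rw [inv_mul_eq_div, le_div_iff₀ hα, mul_comm]
    refine (mul_le_mul_of_nonneg_right hA hzi0).trans (hP.trans ?_)
    rw [mul_assoc (4 * 2 ^ Module.finrank ℝ E * v₁)]
    gcongr
  have hw0 := hwpos 0 (mem_ball_self one_pos)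
  have h1 : Real.log (δ / w 0) ≤ K := by
    refine le_trans (Real.log_le_log (by positivity) ?_) hzK
    linarith [Real.exp_pos 1]
  rw [Real.log_le_iff_le_exp (by positivity), div_le_iff₀ hw0] at h1
  rw [Real.exp_neg, inv_mul_le_iff₀ (Real.exp_pos _)]
  exact h1

end Poincare

section Caccioppoli

variable {E : Type*} [NormedAddCommGroup E] [InnerProductSpace ℝ E] [FiniteDimensional ℝ E]
  [MeasurableSpace E] [BorelSpace E]

theorem caccioppoli_pointwise {p c : ℝ} (hp : 1 < p) (hc : 0 < c) {M : ℝ} (hM : 0 ≤ M) {m : ℕ}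
    (hm : p ≤ m) {t φ : ℝ} (ht : 0 ≤ t) (hφ : 0 ≤ φ) (hφ1 : φ ≤ 1) :
    -(c * (t ^ p * φ ^ m)) + 2 * m * (t ^ (p - 1) * φ ^ (m - 1)) + M * φ ^ m ≤
      -(c / 2 * (φ ^ m * t)) + (c / 2 + M + 2 * m * (4 * m / c) ^ (p - 1)) := by
  have hm1 : 1 ≤ m := by
    have : (1:ℝ) < m := by linarith
    exact_mod_cast this.le
  have hmpos : (0:ℝ) < m := by linarith
  have hφm0 : 0 ≤ φ ^ m := pow_nonneg hφ _
  have hφm : φ ^ m ≤ 1 := pow_le_one₀ hφ hφ1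
  have h1 : φ ^ m * t ≤ φ ^ m + t ^ p * φ ^ m := by
    have : t ≤ 1 + t ^ p := by
      rcases le_total t 1 with h | h
      · have : 0 ≤ t ^ p := by positivity
        linarith
      · have : t ^ (1:ℝ) ≤ t ^ p := Real.rpow_le_rpow_of_exponent_le h hp.le
        rw [Real.rpow_one] at this; linarith
    nlinarith
  have hΛ : 0 ≤ (4 * m / c : ℝ) ^ (p - 1) := by positivity
  have htp : t ^ p * φ ^ m = t ^ (p - 1) * φ ^ (m - 1) * (t * φ) := by
    have e1 : t ^ p = t ^ (p - 1) * t := by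
      rcases ht.eq_or_lt with h | h
      · rw [← h, Real.zero_rpow (by linarith), mul_zero]
      · rw [Real.rpow_sub_one h.ne']; field_simp
    rw [e1, ← Nat.sub_add_cancel hm1, pow_succ, Nat.add_sub_cancel]; ring
  have hX : 0 ≤ t ^ (p - 1) * φ ^ (m - 1) := by positivity
  have hT : 0 ≤ t ^ p * φ ^ m := by positivity
  rcases le_total (4 * m / c) (t * φ) with h | h
  · have h2 : 2 * m * (t ^ (p - 1) * φ ^ (m - 1)) ≤ c / 2 * (t ^ p * φ ^ m) := by
      rw [htp]
      have : t ^ (p - 1) * φ ^ (m - 1) * (4 * m / c) ≤ t ^ (p - 1) * φ ^ (m - 1) * (t * φ) :=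
        mul_le_mul_of_nonneg_left h hX
      have e : c / 2 * (t ^ (p - 1) * φ ^ (m - 1) * (4 * m / c)) =
          2 * m * (t ^ (p - 1) * φ ^ (m - 1)) := by field_simp; ring
      rw [← e]; gcongr
    have : 0 ≤ 2 * m * (4 * m / c : ℝ) ^ (p - 1) := by positivity
    nlinarith
  · have h2 : t ^ (p - 1) * φ ^ (m - 1) ≤ (4 * m / c) ^ (p - 1) := by
      calc t ^ (p - 1) * φ ^ (m - 1) ≤ t ^ (p - 1) * φ ^ (p - 1) := by
            gcongr
            rw [← Real.rpow_natCast]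
            rcases hφ.eq_or_lt with h0 | h0
            · have e1 : ((m - 1 : ℕ) : ℝ) ≠ 0 := by
                rw [Nat.cast_sub hm1]; push_cast; linarith
              have e2 : p - 1 ≠ 0 := by linarith
              rw [← h0, Real.zero_rpow e1, Real.zero_rpow e2]
            · refine Real.rpow_le_rpow_of_exponent_ge h0 hφ1 ?_
              rw [Nat.cast_sub hm1]; push_cast; linarith
        _ = (t * φ) ^ (p - 1) := (Real.mul_rpow ht hφ).symm
        _ ≤ _ := Real.rpow_le_rpow (by positivity) h (by linarith)
    have h3 : 2 * m * (t ^ (p - 1) * φ ^ (m - 1)) ≤ 2 * m * (4 * m / c) ^ (p - 1) := by gcongr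
    nlinarith

theorem caccioppoli_of_le {p c : ℝ} (hp : 1 < p) (hc : 0 < c) {M : ℝ} (hM : 0 ≤ M) {m : ℕ}
    (hm : p ≤ m) {f θ G : E → ℝ} (hf : ContDiffOn ℝ 1 f (ball 0 1))
    (hθ : ContinuousOn θ (ball 0 1)) (hθ0 : ∀ x ∈ ball (0 : E) 1, 0 ≤ θ x) {r : ℝ} (hr0 : 0 < r)
    (hr : r < 1) (hGi : Integrable G) (hG : 0 ≤ ∫ x, G x)
    (hG0 : ∀ x ∉ ball (0 : E) r, G x = 0)
    (hle : ∀ x ∈ ball (0 : E) r, G x ≤ θ x * (-(c * (‖gradient f x‖ ^ p * cut r x ^ m)) +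
      2 * m * (‖gradient f x‖ ^ (p - 1) * cut r x ^ (m - 1)) + M * cut r x ^ m)) :
    ∫ x, cut r x ^ m * (‖gradient f x‖ * θ x) ≤
      (2 / c * (c / 2 + M + 2 * m * (4 * m / c) ^ (p - 1))) * ∫ x in ball (0 : E) r, θ x := by
  set K := c / 2 + M + 2 * m * (4 * m / c) ^ (p - 1) with hK
  have hm2 : 2 ≤ m := by
    have : (1:ℝ) < m := by linarith
    exact_mod_cast this
  have hcut : TestFun (ball (0:E) 1) (fun x => cut r x ^ m) :=
    testFun_cut_pow hr0.le (closedBall_subset_ball hr) hm2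
  have i1 : Integrable fun x => cut r x ^ m * (‖gradient f x‖ * θ x) :=
    (hcut.integrable_mul (((hf.continuousOn_gradient isOpen_ball).norm).mul hθ)).congr
      (ae_of_all _ fun x => mul_comm _ _)
  have i2 : IntegrableOn θ (ball 0 r) := ((hθ.mono (closedBall_subset_ball hr)).integrableOn_compact
    (isCompact_closedBall _ _)).mono_set ball_subset_closedBall
  have i3 : Integrable ((ball (0:E) r).indicator θ) := i2.integrable_indicator measurableSet_ball
  have key : ∫ x, G x ≤ ∫ x, (K * (ball (0:E) r).indicator θ x -
      c / 2 * (cut r x ^ m * (‖gradient f x‖ * θ x))) := by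
    refine integral_mono hGi ((i3.const_mul K).sub (i1.const_mul (c / 2))) fun x => ?_
    by_cases hx : x ∈ ball (0:E) r
    · dsimp only
      rw [indicator_of_mem hx]
      refine (hle x hx).trans ?_
      have h1 := caccioppoli_pointwise hp hc hM hm (norm_nonneg (gradient f x)) (cut_nonneg r x)
        (cut_le_one hr0.le hr.le x)
      have h2 := mul_le_mul_of_nonneg_left h1 (hθ0 x (ball_subset_ball hr.le hx))
      refine h2.trans (le_of_eq ?_)
      rw [hK]; ring
    · dsimp only
      rw [indicator_of_notMem hx, hG0 x hx, cut_eq_zero hr0.le hx, zero_pow (by omega)]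
      simp
  have e : ∫ x, (K * (ball (0:E) r).indicator θ x -
      c / 2 * (cut r x ^ m * (‖gradient f x‖ * θ x))) =
      (K * ∫ x in ball (0:E) r, θ x) - c / 2 * ∫ x, cut r x ^ m * (‖gradient f x‖ * θ x) := by
    rw [integral_sub (i3.const_mul K) (i1.const_mul (c / 2)), integral_const_mul,
      integral_const_mul, integral_indicator measurableSet_ball]
  rw [e] at key
  have : c / 2 * ∫ x, cut r x ^ m * (‖gradient f x‖ * θ x) ≤ K * ∫ x in ball (0:E) r, θ x := by
    linarith
  calc _ = 2 / c * (c / 2 * ∫ x, cut r x ^ m * (‖gradient f x‖ * θ x)) := by field_simp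
    _ ≤ 2 / c * (K * ∫ x in ball (0:E) r, θ x) := by gcongr
    _ = _ := by ring

/-- The weak form tested with `θ(f) φ^m`. -/
theorem logForm_cut_eq {p : ℝ} (hp : 1 < p) {V f : E → ℝ} (hf : ContDiffOn ℝ 1 f (ball 0 1))
    {θ : ℝ → ℝ} (hθ : ContDiff ℝ 1 θ) {m : ℕ} (hm : 2 ≤ m) {r : ℝ}
    {x : E} (hx : x ∈ ball (0 : E) 1) :
    logForm p V f (fun x => θ (f x) * cut r x ^ m) x =
      θ (f x) * ⟪pflux p (gradient f x), gradient (fun x => cut r x ^ m) x⟫ +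
      deriv θ (f x) * (cut r x ^ m * ‖gradient f x‖ ^ p) +
      (V x - (p - 1) * ‖gradient f x‖ ^ p) * (θ (f x) * cut r x ^ m) := by
  have h1 := HasGradientAt.comp_real ((hθ.differentiable (by norm_num)) (f x)).hasDerivAt
    (hf.hasGradientAt isOpen_ball hx)
  have h2 := (contDiff_cut_pow (E := E) r hm).hasGradientAt' x
  rw [logForm, (h1.mul' h2).gradient, inner_add_right, real_inner_smul_right,
    real_inner_smul_right, real_inner_smul_right, inner_pflux_self hp]
  ring

theorem abs_inner_pflux_cut_le {p : ℝ} (hp : 1 < p) (f : E → ℝ) {m : ℕ} (hm : 2 ≤ m) {r : ℝ}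
    (hr0 : 0 < r) (hr : r < 1) (x : E) :
    |⟪pflux p (gradient f x), gradient (fun x => cut r x ^ m) x⟫| ≤
      2 * m * (‖gradient f x‖ ^ (p - 1) * cut r x ^ (m - 1)) := by
  refine (abs_real_inner_le_norm _ _).trans ?_
  rw [norm_pflux hp]
  have := norm_gradient_cut_pow_le (E := E) hr0.le hr.le hm x
  calc _ ≤ ‖gradient f x‖ ^ (p - 1) * (2 * m * cut r x ^ (m - 1)) := by gcongr
    _ = _ := by ring

/-- Constant in the Caccioppoli inequality. -/
def caccConst (p M c : ℝ) (m : ℕ) : ℝ := 2 / c * (c / 2 + M + 2 * m * (4 * m / c) ^ (p - 1))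

theorem caccConst_nonneg {p M c : ℝ} {m : ℕ} (hM : 0 ≤ M) (hc : 0 < c) :
    0 ≤ caccConst p M c m := by unfold caccConst; positivity

theorem LogSuper.caccioppoli {p : ℝ} (hp : 1 < p) {V f : E → ℝ} {M : ℝ} (hV : Measurable V)
    (hM : ∀ x ∈ ball (0 : E) 1, |V x| ≤ M) (hM0 : 0 ≤ M) (hf : LogSuper p V (ball 0 1) f)
    {m : ℕ} (hm : p ≤ m) {θ : ℝ → ℝ} (hθ : ContDiff ℝ 1 θ) (hθ0 : ∀ s, 0 ≤ θ s)
    (hθ' : ∀ s, deriv θ s ≤ 0) {r : ℝ} (hr0 : 0 < r) (hr : r < 1) :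
    ∫ x, cut r x ^ m * (‖gradient f x‖ * θ (f x)) ≤
      caccConst p M (p - 1) m * ∫ x in ball (0 : E) r, θ (f x) := by
  have hm2 : 2 ≤ m := by
    have : (1:ℝ) < m := by linarith
    exact_mod_cast this
  have hcut : TestFun (ball (0:E) 1) (fun x => cut r x ^ m) :=
    testFun_cut_pow hr0.le (closedBall_subset_ball hr) hm2
  have hη := hcut.mul_left isOpen_ball (hθ.comp_contDiffOn hf.1)
  have hη0 : ∀ x, 0 ≤ θ (f x) * cut r x ^ m := fun x =>
    mul_nonneg (hθ0 _) (pow_nonneg (cut_nonneg _ _) _)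
  have hηr : TestFun (ball (0:E) 1) (fun x => θ (f x) * cut r x ^ m) := hη
  refine caccioppoli_of_le hp (by linarith) hM0 hm hf.1
    (hθ.continuous.comp_continuousOn hf.1.continuousOn) (fun x _ => hθ0 _) hr0 hr
    (integrable_logForm hp isOpen_ball ⟨hV, M, hM⟩ hf.1 hηr) (hf.2 _ hηr hη0) ?_ ?_
  · intro x hx
    by_cases hx1 : x ∈ ball (0:E) 1
    · rw [logForm_cut_eq hp hf.1 hθ hm2 hx1, cut_eq_zero hr0.le hx, zero_pow (by omega)]
      have := abs_inner_pflux_cut_le hp f hm2 hr0 hr x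
      rw [cut_eq_zero hr0.le hx, zero_pow (by omega), mul_zero, mul_zero] at this
      rw [abs_nonpos_iff.1 this]; ring
    · rw [logForm, hηr.gradient_eq_zero hx1, hηr.eq_zero hx1, inner_zero_right]; ring
  · intro x hx
    have hx1 := ball_subset_ball hr.le hx
    rw [logForm_cut_eq hp hf.1 hθ hm2 hx1]
    have h1 := (le_abs_self _).trans (abs_inner_pflux_cut_le hp f hm2 hr0 hr x)
    have h2 := mul_le_mul_of_nonneg_left h1 (hθ0 (f x))
    have hc0 : 0 ≤ cut r x ^ m := pow_nonneg (cut_nonneg _ _) _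
    have h3 : deriv θ (f x) * (cut r x ^ m * ‖gradient f x‖ ^ p) ≤ 0 :=
      mul_nonpos_of_nonpos_of_nonneg (hθ' _) (by positivity)
    have h4 : V x * (θ (f x) * cut r x ^ m) ≤ M * (θ (f x) * cut r x ^ m) :=
      mul_le_mul_of_nonneg_right ((le_abs_self _).trans (hM x hx1)) (hη0 x)
    simp only [Function.comp_apply]
    linarith

theorem LogSub.caccioppoli {p : ℝ} (hp : 1 < p) {V f : E → ℝ} {M : ℝ} (hV : Measurable V)
    (hM : ∀ x ∈ ball (0 : E) 1, |V x| ≤ M) (hM0 : 0 ≤ M) (hf : LogSub p V (ball 0 1) f)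
    {m : ℕ} (hm : p ≤ m) {θ : ℝ → ℝ} (hθ : ContDiff ℝ 1 θ) (hθ0 : ∀ s, 0 ≤ θ s)
    (hθ' : ∀ s, p * θ s ≤ deriv θ s) {r : ℝ} (hr0 : 0 < r) (hr : r < 1) :
    ∫ x, cut r x ^ m * (‖gradient f x‖ * θ (f x)) ≤
      caccConst p M 1 m * ∫ x in ball (0 : E) r, θ (f x) := by
  have hm2 : 2 ≤ m := by
    have : (1:ℝ) < m := by linarith
    exact_mod_cast this
  have hcut : TestFun (ball (0:E) 1) (fun x => cut r x ^ m) :=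
    testFun_cut_pow hr0.le (closedBall_subset_ball hr) hm2
  have hη := hcut.mul_left isOpen_ball (hθ.comp_contDiffOn hf.1)
  have hη0 : ∀ x, 0 ≤ θ (f x) * cut r x ^ m := fun x =>
    mul_nonneg (hθ0 _) (pow_nonneg (cut_nonneg _ _) _)
  have hηr : TestFun (ball (0:E) 1) (fun x => θ (f x) * cut r x ^ m) := hη
  have hint := integrable_logForm hp isOpen_ball ⟨hV, M, hM⟩ hf.1 hηr
  refine caccioppoli_of_le (G := fun x => -logForm p V f (fun x => θ (f x) * cut r x ^ m) x)
    hp one_pos hM0 hm hf.1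
    (hθ.continuous.comp_continuousOn hf.1.continuousOn) (fun x _ => hθ0 _) hr0 hr
    hint.neg ?_ ?_ ?_
  · rw [integral_neg]; linarith [hf.2 _ hηr hη0]
  · intro x hx
    by_cases hx1 : x ∈ ball (0:E) 1
    · rw [logForm_cut_eq hp hf.1 hθ hm2 hx1, cut_eq_zero hr0.le hx, zero_pow (by omega)]
      have := abs_inner_pflux_cut_le hp f hm2 hr0 hr x
      rw [cut_eq_zero hr0.le hx, zero_pow (by omega), mul_zero, mul_zero] at this
      rw [abs_nonpos_iff.1 this]; ring
    · rw [logForm, hηr.gradient_eq_zero hx1, hηr.eq_zero hx1, inner_zero_right]; ring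
  · intro x hx
    have hx1 := ball_subset_ball hr.le hx
    rw [logForm_cut_eq hp hf.1 hθ hm2 hx1]
    have h1 := (neg_abs_le _).trans' (neg_le_neg (abs_inner_pflux_cut_le hp f hm2 hr0 hr x))
    have h2 := mul_le_mul_of_nonneg_left h1 (hθ0 (f x))
    have hc0 : 0 ≤ cut r x ^ m := pow_nonneg (cut_nonneg _ _) _
    have h3 : p * θ (f x) * (cut r x ^ m * ‖gradient f x‖ ^ p) ≤
        deriv θ (f x) * (cut r x ^ m * ‖gradient f x‖ ^ p) :=
      mul_le_mul_of_nonneg_right (hθ' _) (by positivity)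
    have h4 : -M * (θ (f x) * cut r x ^ m) ≤ V x * (θ (f x) * cut r x ^ m) :=
      mul_le_mul_of_nonneg_right ((abs_le.1 (hM x hx1)).1) (hη0 x)
    simp only [Function.comp_apply]
    linarith

theorem LogSuper.deGiorgi {p : ℝ} (hp : 1 < p) {V f : E → ℝ} {M : ℝ} (hV : Measurable V)
    (hM : ∀ x ∈ ball (0 : E) 1, |V x| ≤ M) (hM0 : 0 ≤ M) (hf : LogSuper p V (ball 0 1) f)
    {m : ℕ} (hm : p ≤ m) : DeGiorgi m (caccConst p M (p - 1) m) fun x => Real.exp (f x) := by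
  refine ⟨hf.1.exp, fun x _ => Real.exp_pos _, fun Θ hΘ hΘa hΘ0 r hr0 hr => ?_⟩
  have hθ : ContDiff ℝ 1 fun s => Θ (Real.exp s) := by
    rw [← contDiffOn_univ]
    exact hΘ.comp Real.contDiff_exp.contDiffOn fun s _ => Real.exp_pos s
  have hanti : Antitone fun s => Θ (Real.exp s) := fun s t hst =>
    hΘa (Real.exp_pos s) (Real.exp_pos t) (Real.exp_le_exp.2 hst)
  have h := hf.caccioppoli hp hV hM hM0 hm hθ (fun s => hΘ0 _ (Real.exp_pos s))
    (fun s => hanti.deriv_nonpos) hr0 hr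
  refine le_trans (le_of_eq (integral_congr_ae (ae_of_all _ fun x => ?_))) h
  dsimp only
  by_cases hx : x ∈ ball (0:E) 1
  · have hg := HasGradientAt.comp_real (Real.hasDerivAt_exp (f x))
      (hf.1.hasGradientAt isOpen_ball hx)
    rw [hg.gradient, norm_smul, Real.norm_of_nonneg (Real.exp_pos _).le,
      mul_div_cancel_left₀ _ (Real.exp_pos _).ne']
  · have hm0 : m ≠ 0 := by
      rintro rfl
      norm_num at hm; linarith
    have : x ∉ ball (0:E) r := fun h' => hx (ball_subset_ball hr.le h')
    rw [cut_eq_zero hr0.le this, zero_pow hm0, zero_mul, zero_mul]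

end Caccioppoli

section Density

variable {E : Type*} [NormedAddCommGroup E] [InnerProductSpace ℝ E] [FiniteDimensional ℝ E]
  [MeasurableSpace E] [BorelSpace E]

theorem simil_refl_apply (x₀ : E) (s : ℝ) (y : E) :
    simil x₀ s (LinearIsometryEquiv.refl ℝ E) y = x₀ + s • y := rfl

theorem simil_mem_ball {x₀ : E} {s : ℝ} (hs : 0 < s) (T : E ≃ₗᵢ[ℝ] E) {y : E} {r : ℝ} :
    simil x₀ s T y ∈ ball x₀ (s * r) ↔ y ∈ ball (0 : E) r := by
  rw [mem_ball_zero_iff, mem_ball, dist_eq_norm, simil, add_sub_cancel_left, norm_smul,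
    Real.norm_of_nonneg hs.le, T.norm_map, mul_lt_mul_iff_right₀ hs]

theorem volume_real_preimage_simil (x₀ : E) {s : ℝ} (hs : 0 < s) (A : Set E) :
    volume.real A = s ^ Module.finrank ℝ E *
      volume.real (simil x₀ s (LinearIsometryEquiv.refl ℝ E) ⁻¹' A) := by
  have e : simil x₀ s (LinearIsometryEquiv.refl ℝ E) ⁻¹' A =
      (fun y => s • y) ⁻¹' ((fun y => x₀ + y) ⁻¹' A) := rfl
  rw [e, measureReal_def, measureReal_def, Measure.addHaar_preimage_smul _ hs.ne',
    measure_preimage_add, ENNReal.toReal_mul, ENNReal.toReal_ofReal (abs_nonneg _),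
    abs_of_pos (by positivity), ← mul_assoc, mul_inv_cancel₀ (by positivity), one_mul]

theorem exists_nat_exponent (p : ℝ) : ∃ m : ℕ, p ≤ m ∧ 2 ≤ m :=
  ⟨⌈p⌉₊ + 2, by push_cast; linarith [Nat.le_ceil p], by omega⟩

theorem LogSub.density_unit {p : ℝ} (hp : 1 < p) (hn : 2 ≤ Module.finrank ℝ E) (M Λ : ℝ)
    (hM0 : 0 ≤ M) : ∃ lam α : ℝ, 0 ≤ lam ∧ 0 < α ∧ ∀ V f : E → ℝ, Measurable V →
      (∀ x ∈ ball (0 : E) 1, |V x| ≤ M) → LogSub p V (ball 0 1) f →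
      (∀ x ∈ ball (0 : E) 1, f x ≤ f 0 + Λ) →
      α ≤ volume.real {x ∈ ball (0 : E) (3 / 4) | f 0 - lam ≤ f x} := by
  obtain ⟨m, hpm, hm2⟩ := exists_nat_exponent p
  obtain ⟨D, hD, hmoser⟩ := moser (E := E) hn (caccConst p M 1 m) p m
    (caccConst_nonneg hM0 one_pos) hp.le hm2
  set b := volume.real (ball (0 : E) (3 / 4)) with hb
  have hb0 : 0 ≤ b := measureReal_nonneg
  set lam := max 0 (Real.log (2 * D * b + 1) / p) with hlam
  have hlam1 : D * b * Real.exp (-(p * lam)) ≤ 1 / 2 := by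
    have h1 : Real.log (2 * D * b + 1) ≤ p * lam := by
      have := le_max_right 0 (Real.log (2 * D * b + 1) / p)
      rw [div_le_iff₀ (by linarith)] at this
      linarith
    have h2 : 2 * D * b + 1 ≤ Real.exp (p * lam) := by
      rw [← Real.exp_log (show 0 < 2 * D * b + 1 by positivity)]
      exact Real.exp_le_exp.2 h1
    rw [Real.exp_neg, ← div_eq_mul_inv, div_le_iff₀ (Real.exp_pos _)]
    linarith
  refine ⟨lam, 1 / (2 * D * Real.exp (p * Λ)), le_max_left _ _, by positivity,
    fun V f hV hM hf hΛ => ?_⟩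
  set g : E → ℝ := fun x => f x - f 0 with hg
  have hgs : LogSub p V (ball 0 1) g := by
    have := hf.add_const (-f 0)
    simpa only [← sub_eq_add_neg] using this
  have hgc := hgs.1
  have key := hmoser (fun x => Real.exp (g x)) hgc.exp (fun x _ => Real.exp_pos _) ?_
  · have e0 : g 0 = 0 := sub_self _
    simp only [e0, Real.exp_zero, Real.one_rpow] at key
    set A := {x ∈ ball (0 : E) (3 / 4) | f 0 - lam ≤ f x} with hA
    have hsub : ball (0:E) (3/4) ⊆ ball 0 1 := ball_subset_ball (by norm_num)
    have hsub' : closedBall (0:E) (3/4) ⊆ ball 0 1 := closedBall_subset_ball (by norm_num)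
    have hcont : ContinuousOn (fun x => Real.exp (g x) ^ p) (ball (0:E) 1) :=
      (Real.continuous_exp.comp_continuousOn hgc.continuousOn).rpow_const
        fun x _ => Or.inr (by linarith)
    have hi : IntegrableOn (fun x => Real.exp (g x) ^ p) (ball (0:E) (3/4)) :=
      ((hcont.mono hsub').integrableOn_compact (isCompact_closedBall _ _)).mono_set
        ball_subset_closedBall
    have hAm : MeasurableSet A := by
      have h1 : MeasurableSet ((ball (0:E) (3/4)).indicator f ⁻¹' Ici (f 0 - lam)) := by
        classical
        have : Measurable ((ball (0:E) (3/4)).indicator f) := by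
          rw [← piecewise_eq_indicator]
          exact (hf.1.continuousOn.mono hsub).measurable_piecewise continuousOn_const
            measurableSet_ball
        exact this measurableSet_Ici
      have : A = ball (0:E) (3/4) ∩ ((ball (0:E) (3/4)).indicator f ⁻¹' Ici (f 0 - lam)) := by
        ext x
        simp only [hA, Set.mem_ofPred_eq, mem_inter_iff, mem_preimage, mem_Ici]
        refine and_congr_right fun hx => ?_
        rw [indicator_of_mem hx]
      rw [this]
      exact measurableSet_ball.inter h1
    have hfin : volume (ball (0:E) (3/4)) < ⊤ := measure_ball_lt_top
    have hi1 : Integrable (A.indicator fun _ => Real.exp (p * Λ))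
        (volume.restrict (ball (0:E) (3/4))) := by
      have : IntegrableOn (fun _ : E => Real.exp (p * Λ)) (ball (0:E) (3/4)) :=
        integrableOn_const hfin.ne
      exact this.indicator hAm
    have hi2 : Integrable (fun _ : E => Real.exp (-(p * lam)))
        (volume.restrict (ball (0:E) (3/4))) := integrableOn_const hfin.ne
    have hle : ∫ x in ball (0:E) (3/4), Real.exp (g x) ^ p ≤
        ∫ x in ball (0:E) (3/4), (A.indicator (fun _ => Real.exp (p * Λ)) x +
          Real.exp (-(p * lam))) := by
      refine setIntegral_mono_on hi ?_ measurableSet_ball fun x hx => ?_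
      · exact hi1.add hi2
      · rw [← Real.exp_mul]
        by_cases hxA : x ∈ A
        · rw [indicator_of_mem hxA]
          have : Real.exp (g x * p) ≤ Real.exp (p * Λ) := by
            refine Real.exp_le_exp.2 ?_
            have := hΛ x (hsub hx)
            have : g x ≤ Λ := by simp only [hg]; linarith
            nlinarith
          linarith [Real.exp_pos (-(p * lam))]
        · rw [indicator_of_notMem hxA, zero_add]
          refine Real.exp_le_exp.2 ?_
          have : ¬ f 0 - lam ≤ f x := fun h => hxA ⟨hx, h⟩
          have : g x ≤ -lam := by simp only [hg]; linarith
          nlinarith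
    have hcomp : ∫ x in ball (0:E) (3/4), (A.indicator (fun _ => Real.exp (p * Λ)) x +
          Real.exp (-(p * lam))) = Real.exp (p * Λ) * volume.real A + b * Real.exp (-(p * lam)) := by
      have hAs : A ⊆ ball (0:E) (3/4) := fun x hx => hx.1
      rw [integral_add hi1 hi2, setIntegral_indicator hAm,
        inter_eq_right.2 hAs, setIntegral_const, setIntegral_const, smul_eq_mul, smul_eq_mul,
        mul_comm (volume.real A)]
    have h3 : 1 ≤ D * (Real.exp (p * Λ) * volume.real A + b * Real.exp (-(p * lam))) :=
      key.trans (by rw [← hcomp]; gcongr)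
    rw [div_le_iff₀ (by positivity)]
    linarith
  · intro γ r hγ hr0 hr
    have hθ : ContDiff ℝ 1 fun s : ℝ => Real.exp (γ * s) :=
      Real.contDiff_exp.comp (contDiff_const.mul contDiff_id)
    have h := hgs.caccioppoli hp hV hM hM0 hpm hθ (fun s => (Real.exp_pos _).le) (fun s => ?_)
      hr0 hr
    · have e1 : ∀ x, Real.exp (g x) ^ γ = Real.exp (γ * g x) := fun x => by
        rw [← Real.exp_mul, mul_comm]
      simp only [e1]
      refine le_trans (le_of_eq (integral_congr_ae (ae_of_all _ fun x => ?_))) h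
      dsimp only
      by_cases hx : x ∈ ball (0:E) 1
      · have hg' := HasGradientAt.comp_real (Real.hasDerivAt_exp (g x))
          (hgc.hasGradientAt isOpen_ball hx)
        rw [hg'.gradient, norm_smul, Real.norm_of_nonneg (Real.exp_pos _).le,
          ← Real.exp_mul, mul_right_comm, ← Real.exp_add, mul_comm (Real.exp _)]
        congr 3; ring
      · have : x ∉ ball (0:E) r := fun h' => hx (ball_subset_ball hr.le h')
        rw [cut_eq_zero hr0.le this, zero_pow (by omega), zero_mul, zero_mul]
    · have hd : HasDerivAt (fun s : ℝ => Real.exp (γ * s)) (Real.exp (γ * s) * γ) s := by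
        simpa using ((hasDerivAt_id s).const_mul γ).exp
      rw [hd.deriv, mul_comm]
      gcongr

theorem rescaled_potential_bound {p M s : ℝ} {V : E → ℝ} {y : E} (hs : 0 < s)
    (hM : ∀ x ∈ ball y s, s ^ p * |V x| ≤ M) (T : E ≃ₗᵢ[ℝ] E) :
    ∀ x ∈ ball (0 : E) 1, |s ^ p * V (simil y s T x)| ≤ M := fun x hx => by
  rw [abs_mul, abs_of_pos (Real.rpow_pos_of_pos hs p)]
  refine hM _ ?_
  have := (simil_mem_ball (x₀ := y) hs T (r := 1)).2 hx
  rwa [mul_one] at this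

theorem ball_subset_preimage_simil {Ω : Set E} {y : E} {s : ℝ} (hs : 0 < s) (hΩ : ball y s ⊆ Ω)
    (T : E ≃ₗᵢ[ℝ] E) : ball (0 : E) 1 ⊆ simil y s T ⁻¹' Ω := fun x hx => by
  have := (simil_mem_ball (x₀ := y) hs T (r := 1)).2 hx
  rw [mul_one] at this
  exact hΩ this

theorem measurable_rescaled {V : E → ℝ} (hV : Measurable V) (p : ℝ) (y : E) (s : ℝ)
    (T : E ≃ₗᵢ[ℝ] E) : Measurable fun x => s ^ p * V (simil y s T x) :=
  (hV.comp (contDiff_simil y s T).continuous.measurable).const_mul _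

theorem LogSub.density {p : ℝ} (hp : 1 < p) (hn : 2 ≤ Module.finrank ℝ E) (M Λ : ℝ)
    (hM0 : 0 ≤ M) : ∃ lam α : ℝ, 0 ≤ lam ∧ 0 < α ∧ ∀ (V f : E → ℝ) (Ω : Set E) (y : E) (s : ℝ),
      IsOpen Ω → Measurable V → 0 < s → ball y s ⊆ Ω → (∀ x ∈ ball y s, s ^ p * |V x| ≤ M) →
      LogSub p V Ω f → (∀ x ∈ ball y s, f x ≤ f y + Λ) →
      α * s ^ Module.finrank ℝ E ≤
        volume.real {x ∈ ball y (3 / 4 * s) | f y - lam ≤ f x} := by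
  obtain ⟨lam, α, hl, hα, H⟩ := LogSub.density_unit (E := E) hp hn M Λ hM0
  refine ⟨lam, α, hl, hα, fun V f Ω y s hΩ hV hs hsub hM hf hΛ => ?_⟩
  set T := LinearIsometryEquiv.refl ℝ E
  have e0 : simil y s T 0 = y := by simp [simil]
  have h := H _ _ (measurable_rescaled hV p y s T) (rescaled_potential_bound hs hM T)
    ((hf.comp_simil hp hs T hΩ).mono (ball_subset_preimage_simil hs hsub T)) (fun x hx => by
      rw [e0]
      refine hΛ _ ?_
      have := (simil_mem_ball (x₀ := y) hs T (r := 1)).2 hx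
      rwa [mul_one] at this)
  rw [volume_real_preimage_simil y hs, mul_comm α]
  refine mul_le_mul_of_nonneg_left (h.trans (le_of_eq ?_)) (by positivity)
  congr 1
  ext x
  rw [e0, mul_comm (3/4) s]
  simp only [Set.mem_ofPred_eq, mem_preimage]
  rw [simil_mem_ball hs T]

theorem LogSuper.lower_bound {p : ℝ} (hp : 1 < p) (hn : 2 ≤ Module.finrank ℝ E) (M α : ℝ)
    (hM0 : 0 ≤ M) (hα : 0 < α) : ∃ c₀ : ℝ, 0 ≤ c₀ ∧ ∀ (V f : E → ℝ) (Ω : Set E) (y : E) (s : ℝ),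
      IsOpen Ω → Measurable V → 0 < s → ball y s ⊆ Ω → (∀ x ∈ ball y s, s ^ p * |V x| ≤ M) →
      LogSuper p V Ω f → ∀ (h : ℝ) (A : Set E), A ⊆ ball y (3 / 4 * s) → (∀ x ∈ A, h ≤ f x) →
      α * s ^ Module.finrank ℝ E ≤ volume.real A → h - c₀ ≤ f y := by
  obtain ⟨m, hpm, hm2⟩ := exists_nat_exponent p
  obtain ⟨c, hc, H⟩ := DeGiorgi.lower_bound (E := E) hn (caccConst p M (p - 1) m) α m
    (caccConst_nonneg hM0 (by linarith)) hm2 hα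
  refine ⟨max 0 (-Real.log c), le_max_left _ _,
    fun V f Ω y s hΩ hV hs hsub hM hf h A hA hAh hvol => ?_⟩
  set T := LinearIsometryEquiv.refl ℝ E
  have e0 : simil y s T 0 = y := by simp [simil]
  have hDG := LogSuper.deGiorgi hp (measurable_rescaled hV p y s T)
    (rescaled_potential_bound hs hM T) hM0
    ((hf.comp_simil hp hs T hΩ).mono (ball_subset_preimage_simil hs hsub T)) hpm
  have := H _ hDG (Real.exp h) (Real.exp_pos h) ?_
  · rw [e0] at this
    have h2 : Real.log c + h ≤ f y := by
      rw [← Real.exp_le_exp, Real.exp_add, Real.exp_log hc]; exact this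
    linarith [le_max_right 0 (-Real.log c)]
  · rw [volume_real_preimage_simil y hs, mul_comm α] at hvol
    have h3 := le_of_mul_le_mul_left hvol (by positivity)
    refine h3.trans (measureReal_mono ?_ ?_)
    · intro x hx
      refine ⟨?_, Real.exp_le_exp.2 (hAh _ hx)⟩
      rw [← simil_mem_ball hs T, mul_comm s]
      exact hA hx
    · exact ((measure_mono fun x hx => hx.1).trans_lt
        (measure_ball_lt_top (x := (0:E)) (r := 3/4))).ne

end Density

section Harnack

variable {E : Type*} [NormedAddCommGroup E] [InnerProductSpace ℝ E] [FiniteDimensional ℝ E]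
  [MeasurableSpace E] [BorelSpace E]

/-- `f = log u` for a positive solution `u`. -/
def LogSol (p : ℝ) (V : E → ℝ) (Ω : Set E) (f : E → ℝ) : Prop :=
  LogSuper p V Ω f ∧ LogSub p V Ω f

theorem volume_real_ball (x : E) {s : ℝ} (hs : 0 < s) :
    volume.real (ball x s) = s ^ Module.finrank ℝ E * volume.real (ball (0 : E) 1) := by
  rw [volume_real_preimage_simil x hs]
  congr 2
  ext y
  have := simil_mem_ball (x₀ := x) hs (LinearIsometryEquiv.refl ℝ E) (y := y) (r := 1)
  rw [mul_one] at this
  exact this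

theorem volume_real_ball_pos (x : E) {s : ℝ} (hs : 0 < s) : 0 < volume.real (ball x s) :=
  ENNReal.toReal_pos (measure_ball_pos _ _ hs).ne' measure_ball_lt_top.ne

theorem LogSuper.doubling {p : ℝ} (hp : 1 < p) (hn : 2 ≤ Module.finrank ℝ E) (M : ℝ)
    (hM0 : 0 ≤ M) : ∃ c₀ : ℝ, 0 ≤ c₀ ∧ ∀ (V f : E → ℝ), Measurable V →
      (∀ x ∈ ball (0 : E) 16, |V x| ≤ M) → LogSuper p V (ball 0 16) f → ∀ (x₁ : E) (s h : ℝ),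
      ‖x₁‖ ≤ 1 / 2 → 0 < s → s ≤ 1 → (∀ x ∈ ball x₁ s, h ≤ f x) →
      ∀ y ∈ ball x₁ (2 * s), h - c₀ ≤ f y := by
  have hv := volume_real_ball_pos (0 : E) one_pos
  obtain ⟨c₀, hc₀, H⟩ := LogSuper.lower_bound (E := E) hp hn (4 ^ p * M)
    (volume.real (ball (0 : E) 1) / 4 ^ Module.finrank ℝ E) (by positivity) (by positivity)
  refine ⟨c₀, hc₀, fun V f hV hVM hf x₁ s h hx₁ hs hs1 hh y hy => ?_⟩
  rw [mem_ball, dist_eq_norm] at hy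
  have hsub : ball y (4 * s) ⊆ ball (0 : E) 16 := by
    intro z hz
    rw [mem_ball, dist_eq_norm] at hz
    rw [mem_ball_zero_iff]
    have : ‖z‖ ≤ ‖z - y‖ + ‖y - x₁‖ + ‖x₁‖ := by
      calc ‖z‖ = ‖(z - y) + (y - x₁) + x₁‖ := by congr 1; abel
        _ ≤ _ := norm_add₃_le
    linarith
  refine H V f _ y (4 * s) isOpen_ball hV (by linarith) hsub (fun x hx => ?_) hf h (ball x₁ s)
    (fun x hx => ?_) hh ?_
  · have h1 : (4 * s) ^ p ≤ 4 ^ p :=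
      Real.rpow_le_rpow (by positivity) (by linarith) (by linarith)
    exact mul_le_mul h1 (hVM x (hsub hx)) (abs_nonneg _) (by positivity)
  · rw [mem_ball] at hx ⊢
    have := dist_triangle_right x y x₁
    rw [dist_eq_norm y x₁] at this
    linarith
  · rw [volume_real_ball x₁ hs, mul_pow, div_mul_eq_mul_div, div_le_iff₀ (by positivity)]
    exact le_of_eq (by ring)

theorem exists_weighted_max {f : E → ℝ} (hf : ContinuousOn f (closedBall 0 (1 / 2))) {N : ℝ}
    (hN : 0 < N) : ∃ x₁ : E, ‖x₁‖ < 1 / 2 ∧ ∀ x : E, ‖x‖ < 1 / 2 →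
      f x + N * Real.log (1 / 2 - ‖x‖) ≤ f x₁ + N * Real.log (1 / 2 - ‖x₁‖) := by
  have hc : ContinuousOn (fun x => (1 / 2 - ‖x‖) ^ N * Real.exp (f x))
      (closedBall (0 : E) (1 / 2)) := by
    refine ContinuousOn.mul ?_ (Real.continuous_exp.comp_continuousOn hf)
    exact ((continuous_const.sub continuous_norm).rpow_const fun x => Or.inr hN.le).continuousOn
  obtain ⟨x₁, hx₁, hmax⟩ := (isCompact_closedBall (0 : E) (1 / 2)).exists_isMaxOn
    ⟨0, mem_closedBall_self (by norm_num)⟩ hc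
  rw [mem_closedBall_zero_iff] at hx₁
  have hlog : ∀ x : E, ‖x‖ < 1 / 2 → (1 / 2 - ‖x‖) ^ N * Real.exp (f x) =
      Real.exp (f x + N * Real.log (1 / 2 - ‖x‖)) := fun x hx => by
    rw [Real.rpow_def_of_pos (by linarith), ← Real.exp_add]; congr 1; ring
  have hle : ∀ x : E, ‖x‖ < 1 / 2 → (1 / 2 - ‖x‖) ^ N * Real.exp (f x) ≤
      (1 / 2 - ‖x₁‖) ^ N * Real.exp (f x₁) := fun x hx =>
    hmax (show x ∈ closedBall (0:E) (1/2) by rw [mem_closedBall_zero_iff]; exact hx.le)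
  have hlt : ‖x₁‖ < 1 / 2 := by
    refine lt_of_le_of_ne hx₁ fun h => ?_
    have h0 := hle 0 (by norm_num)
    rw [h, sub_self, Real.zero_rpow hN.ne', zero_mul, hlog 0 (by norm_num)] at h0
    exact absurd h0 (not_le.2 (Real.exp_pos _))
  refine ⟨x₁, hlt, fun x hx => ?_⟩
  have := hle x hx
  rwa [hlog x hx, hlog x₁ hlt, Real.exp_le_exp] at this

theorem LogSol.harnack_unit {p : ℝ} (hp : 1 < p) (hn : 2 ≤ Module.finrank ℝ E) (M : ℝ)
    (hM0 : 0 ≤ M) : ∃ C : ℝ, 0 ≤ C ∧ ∀ V f : E → ℝ, Measurable V →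
      (∀ x ∈ ball (0 : E) 16, |V x| ≤ M) → LogSol p V (ball 0 16) f →
      ∀ x ∈ ball (0 : E) (1 / 4), ∀ y ∈ ball (0 : E) (1 / 4), f y - f x ≤ C := by
  obtain ⟨c₀, hc₀, Hd⟩ := LogSuper.doubling (E := E) hp hn M hM0
  have hl2 : 0 < Real.log 2 := Real.log_pos (by norm_num)
  set N := (c₀ + 1) / Real.log 2 with hN
  have hN0 : 0 < N := by positivity
  obtain ⟨lam, α, hlam, hα, Hs⟩ := LogSub.density (E := E) hp hn M (N * Real.log 2) hM0
  obtain ⟨c₁, hc₁, He⟩ := LogSuper.lower_bound (E := E) hp hn M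
    (α / 4 ^ Module.finrank ℝ E) hM0 (by positivity)
  have hl8 : 0 ≤ Real.log 8 := Real.log_nonneg (by norm_num)
  refine ⟨N * Real.log 8 + lam + c₁ + c₀, by positivity,
    fun V f hV hVM hf x hx y hy => ?_⟩
  have hcf : ContinuousOn f (closedBall 0 (1/2)) :=
    hf.1.1.continuousOn.mono (closedBall_subset_ball (by norm_num))
  obtain ⟨x₁, hx₁, hmax⟩ := exists_weighted_max hcf hN0
  set l := (1 / 2 - ‖x₁‖) / 2 with hl
  have hl0 : 0 < l := by rw [hl]; linarith
  have hl1 : l ≤ 1 / 4 := by rw [hl]; linarith [norm_nonneg x₁]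
  have hnorm : ∀ (a z : E) (r : ℝ), z ∈ ball a r → ‖z‖ < ‖a‖ + r := fun a z r hz => by
    rw [mem_ball, dist_eq_norm] at hz
    calc ‖z‖ = ‖a + (z - a)‖ := by congr 1; abel
      _ ≤ ‖a‖ + ‖z - a‖ := norm_add_le _ _
      _ < _ := by linarith
  have hΛ : ∀ z ∈ ball x₁ l, f z ≤ f x₁ + N * Real.log 2 := fun z hz => by
    have h1 := hnorm _ _ _ hz
    have h2 := hmax z (by linarith)
    have h3 : Real.log l ≤ Real.log (1 / 2 - ‖z‖) := Real.log_le_log hl0 (by linarith)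
    have h4 : Real.log (1 / 2 - ‖x₁‖) = Real.log 2 + Real.log l := by
      rw [← Real.log_mul (by norm_num) hl0.ne']; congr 1; linarith
    rw [h4] at h2
    nlinarith
  have hsub : ∀ (a : E) (r : ℝ), ‖a‖ + r ≤ 16 → ball a r ⊆ ball (0 : E) 16 := fun a r h z hz => by
    rw [mem_ball_zero_iff]; exact (hnorm a z r hz).trans_le h
  have hpot : ∀ (a : E) (r : ℝ), 0 ≤ r → r ≤ 1 → ‖a‖ + r ≤ 16 →
      ∀ z ∈ ball a r, r ^ p * |V z| ≤ M := fun a r h0 h1 h z hz => by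
    have e1 : r ^ p ≤ 1 := Real.rpow_le_one h0 h1 (by linarith)
    have := hVM z (hsub a r h hz)
    nlinarith [abs_nonneg (V z)]
  have hA := Hs V f _ x₁ l isOpen_ball hV hl0 (hsub _ _ (by linarith))
    (hpot _ _ hl0.le (by linarith) (by linarith)) hf.2 hΛ
  have hB : ∀ z ∈ ball x₁ (2 ^ 0 * l), f x₁ - lam - c₁ - (0 : ℕ) * c₀ ≤ f z := fun z hz => by
    rw [pow_zero, one_mul] at hz
    have h1 := hnorm _ _ _ hz
    have := He V f _ z (4 * l) isOpen_ball hV (by linarith) (hsub _ _ (by linarith))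
      (hpot _ _ (by linarith) (by linarith) (by linarith)) hf.1 (f x₁ - lam)
      {x ∈ ball x₁ (3 / 4 * l) | f x₁ - lam ≤ f x} (fun w hw => ?_) (fun w hw => hw.2) ?_
    · simpa using this
    · have h2 : dist w x₁ < 3 / 4 * l := hw.1
      have h3 : dist z x₁ < l := hz
      rw [mem_ball]
      have := dist_triangle_right w z x₁
      linarith
    · refine le_trans (le_of_eq ?_) hA
      rw [mul_pow]; field_simp
  obtain ⟨n, hn1, hn2⟩ := exists_nat_pow_near (show 1 ≤ 1 / l by
    rw [le_div_iff₀ hl0]; linarith) (show (1:ℝ) < 2 by norm_num)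
  rw [le_div_iff₀ hl0] at hn1
  rw [div_lt_iff₀ hl0] at hn2
  have hind : ∀ k : ℕ, k ≤ n + 1 → ∀ z ∈ ball x₁ (2 ^ k * l),
      f x₁ - lam - c₁ - k * c₀ ≤ f z := by
    intro k
    induction k with
    | zero => exact fun _ => hB
    | succ k ih =>
      intro hk z hz
      have h1 : (2:ℝ) ^ k ≤ 2 ^ n := pow_le_pow_right₀ (by norm_num) (by omega)
      have := Hd V f hV hVM hf.1 x₁ (2 ^ k * l) _ hx₁.le (by positivity) (by nlinarith)
        (ih (by omega)) z (by rwa [← mul_assoc, ← pow_succ'])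
      push_cast
      linarith
  have hx' : f x₁ - lam - c₁ - (n + 1 : ℕ) * c₀ ≤ f x := hind (n + 1) le_rfl x (by
    rw [mem_ball_zero_iff] at hx
    rw [mem_ball, dist_eq_norm]
    have := norm_sub_le x x₁
    linarith)
  have hy' := hmax y (by rw [mem_ball_zero_iff] at hy; linarith)
  have h5 : Real.log (1 / 4) ≤ Real.log (1 / 2 - ‖y‖) := by
    rw [mem_ball_zero_iff] at hy
    exact Real.log_le_log (by norm_num) (by linarith)
  have h6 : Real.log (1 / 2 - ‖x₁‖) = Real.log (1 / 4) + Real.log 8 + Real.log l := by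
    rw [← Real.log_mul (by norm_num) (by norm_num), ← Real.log_mul (by norm_num) hl0.ne']
    congr 1; rw [hl]; ring
  rw [h6] at hy'
  have h7 : N * Real.log (1 / 4) ≤ N * Real.log (1 / 2 - ‖y‖) := by gcongr
  have h8 : n * Real.log 2 + Real.log l ≤ 0 := by
    rw [← Real.log_pow, ← Real.log_mul (by positivity) hl0.ne']
    exact Real.log_nonpos (by positivity) hn1
  have h9 : N * Real.log 2 = c₀ + 1 := by rw [hN]; field_simp
  have h10 : N * (n * Real.log 2 + Real.log l) ≤ 0 := mul_nonpos_of_nonneg_of_nonpos hN0.le h8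
  have h11 : N * (n * Real.log 2 + Real.log l) = n * (c₀ + 1) + N * Real.log l := by
    rw [← h9]; ring
  push_cast at hx'
  have h12 : (0:ℝ) ≤ n := Nat.cast_nonneg n
  nlinarith

theorem LogSol.mono {p : ℝ} {V f : E → ℝ} {Ω Ω' : Set E} (h : LogSol p V Ω f) (hs : Ω' ⊆ Ω) :
    LogSol p V Ω' f := ⟨h.1.mono hs, h.2.mono hs⟩

theorem LogSol.comp_simil {p : ℝ} (hp : 1 < p) {V f : E → ℝ} {Ω : Set E} {x₀ : E} {s : ℝ}
    (hs : 0 < s) (T : E ≃ₗᵢ[ℝ] E) (hΩ : IsOpen Ω) (h : LogSol p V Ω f) :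
    LogSol p (fun y => s ^ p * V (simil x₀ s T y)) (simil x₀ s T ⁻¹' Ω)
      (fun y => f (simil x₀ s T y)) := ⟨h.1.comp_simil hp hs T hΩ, h.2.comp_simil hp hs T hΩ⟩

theorem LogSol.harnack {p : ℝ} (hp : 1 < p) (hn : 2 ≤ Module.finrank ℝ E) (M : ℝ)
    (hM0 : 0 ≤ M) : ∃ C : ℝ, 0 ≤ C ∧ ∀ (V f : E → ℝ) (Ω : Set E) (a : E) (s : ℝ),
      IsOpen Ω → Measurable V → 0 < s → ball a s ⊆ Ω → (∀ x ∈ ball a s, s ^ p * |V x| ≤ M) →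
      LogSol p V Ω f → ∀ x ∈ ball a (s / 64), ∀ y ∈ ball a (s / 64), f y - f x ≤ C := by
  obtain ⟨C, hC, H⟩ := LogSol.harnack_unit (E := E) hp hn M hM0
  refine ⟨C, hC, fun V f Ω a s hΩ hV hs hsub hM hf x hx y hy => ?_⟩
  set T := LinearIsometryEquiv.refl ℝ E
  have hs' : 0 < s / 16 := by positivity
  have hb : ∀ z ∈ ball (0:E) 16, simil a (s / 16) T z ∈ ball a s := fun z hz => by
    have := (simil_mem_ball (x₀ := a) hs' T).2 hz
    rwa [div_mul_cancel₀ _ (by norm_num)] at this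
  have key := H _ _ (measurable_rescaled hV p a (s / 16) T) (fun z hz => ?_)
    ((hf.comp_simil hp hs' T hΩ).mono fun z hz => hsub (hb z hz))
  · have hinv : ∀ z ∈ ball a (s / 64), ∃ w ∈ ball (0:E) (1/4), simil a (s / 16) T w = z := by
      intro z hz
      have e : simil a (s / 16) T ((s / 16)⁻¹ • (z - a)) = z := by
        rw [simil_refl_apply, smul_inv_smul₀ hs'.ne']; abel
      refine ⟨(s / 16)⁻¹ • (z - a), ?_, e⟩
      rw [← simil_mem_ball hs' T, e]
      convert hz using 2; ring
    obtain ⟨x', hx', rfl⟩ := hinv x hx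
    obtain ⟨y', hy', rfl⟩ := hinv y hy
    exact key x' hx' y' hy'
  · rw [abs_mul, abs_of_pos (Real.rpow_pos_of_pos hs' p)]
    refine le_trans ?_ (hM _ (hb z hz))
    gcongr
    linarith

end Harnack

section Spheres

variable {E : Type*} [NormedAddCommGroup E] [InnerProductSpace ℝ E] [FiniteDimensional ℝ E]
  [MeasurableSpace E] [BorelSpace E]

theorem exists_isometry_map {x y : E} (h : ‖x‖ = ‖y‖) : ∃ T : E ≃ₗᵢ[ℝ] E, T x = y :=
  ⟨_, Submodule.reflection_sub h⟩

/-- The maximum of `g` over the sphere of radius `r`. -/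
def sphMax (g : E → ℝ) (r : ℝ) : ℝ := sSup (g '' sphere (0 : E) r)

/-- The minimum of `g` over the sphere of radius `r`. -/
def sphMin (g : E → ℝ) (r : ℝ) : ℝ := -sphMax (fun x => -g x) r

theorem le_sphMax {g : E → ℝ} {r : ℝ} (hg : ContinuousOn g (sphere 0 r)) {x : E}
    (hx : ‖x‖ = r) : g x ≤ sphMax g r :=
  le_csSup ((isCompact_sphere _ _).image_of_continuousOn hg).bddAbove
    ⟨x, mem_sphere_zero_iff_norm.2 hx, rfl⟩

theorem sphMin_le {g : E → ℝ} {r : ℝ} (hg : ContinuousOn g (sphere 0 r)) {x : E}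
    (hx : ‖x‖ = r) : sphMin g r ≤ g x := by
  have : -g x ≤ sphMax (fun x => -g x) r := le_sphMax hg.neg hx
  unfold sphMin
  linarith

theorem exists_eq_sphMax [Nontrivial E] {g : E → ℝ} {r : ℝ} (hr : 0 ≤ r)
    (hg : ContinuousOn g (sphere 0 r)) : ∃ x, ‖x‖ = r ∧ g x = sphMax g r := by
  have hne : (sphere (0:E) r).Nonempty := NormedSpace.sphere_nonempty.2 hr
  obtain ⟨x, hx, e⟩ := ((isCompact_sphere _ _).image_of_continuousOn hg).sSup_mem (hne.image g)
  exact ⟨x, mem_sphere_zero_iff_norm.1 hx, e⟩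

theorem exists_eq_sphMin [Nontrivial E] {g : E → ℝ} {r : ℝ} (hr : 0 ≤ r)
    (hg : ContinuousOn g (sphere 0 r)) : ∃ x, ‖x‖ = r ∧ g x = sphMin g r := by
  obtain ⟨x, hx, e⟩ := exists_eq_sphMax hr (show ContinuousOn (fun x => -g x) _ from hg.neg)
  exact ⟨x, hx, by rw [sphMin, ← e, neg_neg]⟩

theorem exists_sphere_midpoint (hn : 2 ≤ Module.finrank ℝ E) {r : ℝ} {x y : E}
    (hx : ‖x‖ = r) (hy : ‖y‖ = r) : ∃ m : E, ‖m‖ = r ∧ √2 * ‖x - m‖ ≤ ‖x - y‖ ∧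
      √2 * ‖m - y‖ ≤ ‖x - y‖ := by
  have hr : 0 ≤ r := hx ▸ norm_nonneg x
  have hexp : ∀ a b : E, ‖a‖ = r → ‖b‖ = r → ‖a - b‖ ^ 2 = 2 * r ^ 2 - 2 * ⟪a, b⟫ :=
    fun a b ha hb => by rw [norm_sub_sq_real, ha, hb]; ring
  have hfin : ∀ m : E, ‖m‖ = r → ⟪x, m⟫ = ⟪m, y⟫ → ⟪x, y⟫ + r ^ 2 ≤ 2 * ⟪x, m⟫ →
      √2 * ‖x - m‖ ≤ ‖x - y‖ ∧ √2 * ‖m - y‖ ≤ ‖x - y‖ := by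
    intro m hm h1 h2
    have e1 := hexp x m hx hm
    have e2 := hexp m y hm hy
    have e3 := hexp x y hx hy
    have hs : √2 ^ 2 = (2:ℝ) := Real.sq_sqrt (by norm_num)
    constructor
    · refine abs_le_of_sq_le_sq' ?_ (norm_nonneg _) |>.2
      rw [mul_pow, hs, e1, e3]; linarith
    · refine abs_le_of_sq_le_sq' ?_ (norm_nonneg _) |>.2
      rw [mul_pow, hs, e2, e3]; linarith
  by_cases hxy : x + y = 0
  · have hyx : y = -x := by rw [eq_neg_iff_add_eq_zero, add_comm]; exact hxy
    obtain ⟨w, hw0, hw⟩ : ∃ w : E, w ≠ 0 ∧ ⟪x, w⟫ = 0 := by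
      have h1 : (ℝ ∙ x)ᗮ ≠ ⊥ := by
        intro h
        have h2 : (ℝ ∙ x) = ⊤ := (Submodule.orthogonal_eq_bot_iff).1 h
        have h3 := finrank_span_le_card (R := ℝ) ({x} : Set E)
        rw [h2, finrank_top] at h3
        simp at h3
        omega
      obtain ⟨w, hw, hw0⟩ := Submodule.exists_mem_ne_zero_of_ne_bot h1
      exact ⟨w, hw0, Submodule.mem_orthogonal_singleton_iff_inner_right.1 hw⟩
    have hnw : ‖w‖ ≠ 0 := norm_ne_zero_iff.2 hw0
    refine ⟨(r / ‖w‖) • w, ?_, ?_⟩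
    · rw [norm_smul, Real.norm_of_nonneg (by positivity), div_mul_cancel₀ _ hnw]
    · refine hfin _ ?_ ?_ ?_
      · rw [norm_smul, Real.norm_of_nonneg (by positivity), div_mul_cancel₀ _ hnw]
      · rw [hyx, inner_neg_right, real_inner_smul_left, real_inner_smul_right,
          real_inner_comm x w, hw]; simp
      · rw [hyx, inner_neg_right, real_inner_smul_right, hw, real_inner_self_eq_norm_sq, hx]
        simp
  · have hσ : 0 < ‖x + y‖ := norm_pos_iff.2 hxy
    have hσ2 : ‖x + y‖ ^ 2 = 2 * r ^ 2 + 2 * ⟪x, y⟫ := by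
      rw [norm_add_sq_real, hx, hy]; ring
    have hm : ‖(r / ‖x + y‖) • (x + y)‖ = r := by
      rw [norm_smul, Real.norm_of_nonneg (by positivity), div_mul_cancel₀ _ hσ.ne']
    refine ⟨_, hm, hfin _ hm ?_ ?_⟩
    · rw [real_inner_smul_left, real_inner_smul_right, inner_add_left, inner_add_right,
        real_inner_self_eq_norm_sq, real_inner_self_eq_norm_sq, hx, hy]; ring
    · rw [real_inner_smul_right, inner_add_right, real_inner_self_eq_norm_sq, hx]
      have h1 : ‖x + y‖ ≤ 2 * r := (norm_add_le _ _).trans (by rw [hx, hy]; linarith)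
      have h2 : r ^ 2 + ⟪x, y⟫ = ‖x + y‖ ^ 2 / 2 := by linarith
      rw [add_comm, h2]
      have h3 : 2 * (r / ‖x + y‖ * (‖x + y‖ ^ 2 / 2)) = r * ‖x + y‖ := by field_simp
      rw [h3]; nlinarith

/-- Dyadic chaining along a sphere. -/
theorem sphere_chain (hn : 2 ≤ Module.finrank ℝ E) {r s : ℝ} (R : ℕ → E → E → Prop)
    (h0 : ∀ x y : E, ‖x‖ = r → ‖y‖ = r → ‖x - y‖ < s → R 0 x y)
    (hs : ∀ j x m y, ‖x‖ = r → ‖m‖ = r → ‖y‖ = r → R j x m → R j m y → R (j + 1) x y) :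
    ∀ j (x y : E), ‖x‖ = r → ‖y‖ = r → ‖x - y‖ < √2 ^ j * s → R j x y := by
  intro j
  induction j with
  | zero => intro x y hx hy h; exact h0 x y hx hy (by simpa using h)
  | succ j ih =>
    intro x y hx hy h
    obtain ⟨m, hm, h1, h2⟩ := exists_sphere_midpoint hn hx hy
    have hs2 : (0:ℝ) < √2 := by positivity
    have hh : ∀ a : ℝ, √2 * a ≤ ‖x - y‖ → a < √2 ^ j * s := fun a ha => by
      rw [pow_succ'] at h
      refine lt_of_mul_lt_mul_left ?_ hs2.le
      calc √2 * a ≤ ‖x - y‖ := ha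
        _ < _ := h
        _ = _ := by ring
    exact hs j x m y hx hm hy (ih x m hx hm (hh _ h1)) (ih m y hm hy (hh _ h2))

end Spheres

section QuasiConvex

theorem quasiconvex_tendsto {φ : ℝ → ℝ} {r₀ : ℝ} (hr₀ : 0 < r₀)
    (hφ : ∀ r₁ r r₂, 0 < r₁ → r₁ < r → r < r₂ → r₂ < r₀ → φ r ≤ max (φ r₁) (φ r₂)) :
    ∃ l : EReal, Tendsto (fun r => (φ r : EReal)) (𝓝[>] 0) (𝓝 l) := by
  by_cases h : ∃ a b, 0 < a ∧ a < b ∧ b < r₀ ∧ φ b < φ a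
  · obtain ⟨a, b, ha, hab, hb, hlt⟩ := h
    have hbig : ∀ r, 0 < r → r < a → φ b < φ r := fun r h0 h1 => by
      have := hφ r a b h0 h1 hab hb
      rcases le_max_iff.1 this with h | h <;> linarith
    have hanti : AntitoneOn (fun r => (φ r : EReal)) (Ioo 0 a) := by
      intro x hx y hy hxy
      rcases hxy.eq_or_lt with rfl | hxy
      · exact le_rfl
      have := hφ x y b hx.1 hxy (hy.2.trans hab) hb
      rcases le_max_iff.1 this with h | h
      · exact EReal.coe_le_coe_iff.2 h
      · exact absurd (hbig y hy.1 hy.2) (not_lt.2 h)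
    exact ⟨_, hanti.tendsto_nhdsWithin_Ioo_right (nonempty_Ioo.2 ha) (OrderTop.bddAbove _)⟩
  · push Not at h
    have hmono : MonotoneOn (fun r => (φ r : EReal)) (Ioo 0 r₀) := by
      intro x hx y hy hxy
      rcases hxy.eq_or_lt with rfl | hxy
      · exact le_rfl
      exact EReal.coe_le_coe_iff.2 (h x y hx.1 hxy hy.2)
    exact ⟨_, hmono.tendsto_nhdsWithin_Ioo_right (nonempty_Ioo.2 hr₀) (OrderBot.bddBelow _)⟩

end QuasiConvex

section Punctured

variable {E : Type*} [NormedAddCommGroup E] [InnerProductSpace ℝ E] [FiniteDimensional ℝ E]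
  [MeasurableSpace E] [BorelSpace E]

/-- The open annulus. -/
def ann (r₁ r₂ : ℝ) : Set E := {x | r₁ < ‖x‖ ∧ ‖x‖ < r₂}

theorem isOpen_ann (r₁ r₂ : ℝ) : IsOpen (ann r₁ r₂ : Set E) :=
  (isOpen_lt continuous_const continuous_norm).inter (isOpen_lt continuous_norm continuous_const)

theorem ann_mono {a b c d : ℝ} (h : c ≤ a) (h' : b ≤ d) : (ann a b : Set E) ⊆ ann c d :=
  fun _ hx => ⟨h.trans_lt hx.1, hx.2.trans_le h'⟩

theorem closure_ann_subset (r₁ r₂ : ℝ) :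
    closure (ann r₁ r₂ : Set E) ⊆ {x | r₁ ≤ ‖x‖ ∧ ‖x‖ ≤ r₂} :=
  closure_minimal (fun _ hx => ⟨hx.1.le, hx.2.le⟩)
    ((isClosed_le continuous_const continuous_norm).inter
      (isClosed_le continuous_norm continuous_const))

/-- A radial potential with a Fuchsian singularity at the origin. -/
structure FuchsPot (p C₀ : ℝ) (V : E → ℝ) : Prop where
  meas : Measurable V
  bound : ∀ x, ‖x‖ ^ p * |V x| ≤ C₀
  radial : ∀ x y, ‖x‖ = ‖y‖ → V x = V y

theorem FuchsPot.nonneg {p C₀ : ℝ} {V : E → ℝ} (h : FuchsPot p C₀ V) : 0 ≤ C₀ :=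
  (mul_nonneg (Real.rpow_nonneg (norm_nonneg _) _) (abs_nonneg _)).trans (h.bound 0)

theorem FuchsPot.bddPot {p C₀ : ℝ} (hp : 0 < p) {V : E → ℝ} (h : FuchsPot p C₀ V) {r : ℝ}
    (hr : 0 < r) (R : ℝ) : BddPot V (ann r R) := by
  refine ⟨h.meas, C₀ / r ^ p, fun x hx => ?_⟩
  rw [le_div_iff₀ (by positivity), mul_comm]
  refine le_trans ?_ (h.bound x)
  gcongr
  exact hx.1.le

theorem comparison_ann [Nontrivial E] {p C₀ : ℝ} (hp : 1 < p) {V F f : E → ℝ}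
    (hV : FuchsPot p C₀ V) {a b r₁ r₂ : ℝ} (ha : 0 < a) (h1 : a < r₁) (h2 : r₂ < b)
    (hF : LogSuper p V (ann a b) F) (hf : LogSub p V (ann a b) f)
    (hb1 : ∀ x : E, ‖x‖ = r₁ → f x ≤ F x) (hb2 : ∀ x : E, ‖x‖ = r₂ → f x ≤ F x) :
    ∀ x : E, r₁ ≤ ‖x‖ → ‖x‖ ≤ r₂ → f x ≤ F x := by
  have hcl := closure_ann_subset (E := E) r₁ r₂
  have hcp : IsCompact (closure (ann r₁ r₂ : Set E)) :=
    (isCompact_closedBall (0:E) r₂).of_isClosed_subset isClosed_closure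
      fun x hx => mem_closedBall_zero_iff.2 (hcl hx).2
  have key := comparison hp (isOpen_ann a b) (hV.bddPot (by linarith) ha b) hF hf
    (isOpen_ann r₁ r₂) hcp (fun x hx => ⟨h1.trans_le (hcl hx).1, (hcl hx).2.trans_lt h2⟩) ?_
  · intro x hx1 hx2
    rcases hx1.eq_or_lt with h | h
    · exact hb1 x h.symm
    rcases hx2.eq_or_lt with h' | h'
    · exact hb2 x h'
    exact key x (subset_closure ⟨h, h'⟩)
  · intro x hx
    have hx1 := hcl hx.1
    have hx2 : x ∉ ann r₁ r₂ := by
      have := hx.2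
      rwa [(isOpen_ann r₁ r₂).interior_eq] at this
    rcases hx1.1.eq_or_lt with h | h
    · exact hb1 x h.symm
    rcases hx1.2.eq_or_lt with h' | h'
    · exact hb2 x h'
    exact absurd ⟨h, h'⟩ hx2

theorem sphere_subset_ann {a b r : ℝ} (h1 : a < r) (h2 : r < b) :
    sphere (0 : E) r ⊆ ann a b := fun x hx => by
  rw [mem_sphere_zero_iff_norm] at hx
  exact ⟨hx ▸ h1, hx ▸ h2⟩

theorem sphMax_sub_quasiconvex [Nontrivial E] {p C₀ : ℝ} (hp : 1 < p) {V F f : E → ℝ}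
    (hV : FuchsPot p C₀ V) {ρ : ℝ}
    (hF : LogSuper p V (ann 0 ρ) F) (hf : LogSub p V (ann 0 ρ) f) :
    ∀ r₁ r r₂, 0 < r₁ → r₁ < r → r < r₂ → r₂ < ρ →
      sphMax (fun x => f x - F x) r ≤
        max (sphMax (fun x => f x - F x) r₁) (sphMax (fun x => f x - F x) r₂) := by
  intro r₁ r r₂ h0 h1 h2 h3
  have hc : ∀ s, 0 < s → s < ρ → ContinuousOn (fun x => f x - F x) (sphere (0:E) s) :=
    fun s hs hs' => (hf.1.continuousOn.sub hF.1.continuousOn).mono (sphere_subset_ann hs hs')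
  set K := max (sphMax (fun x => f x - F x) r₁) (sphMax (fun x => f x - F x) r₂) with hK
  have hsub : (ann (r₁ / 2) ρ : Set E) ⊆ ann 0 ρ := ann_mono (by linarith) le_rfl
  have key := comparison_ann hp hV (half_pos h0) (half_lt_self h0) h3
    ((hF.mono hsub).add_const K) (hf.mono hsub)
    (fun x hx => by
      have := le_sphMax (hc r₁ h0 (by linarith)) hx
      have := le_max_left (sphMax (fun x => f x - F x) r₁) (sphMax (fun x => f x - F x) r₂)
      linarith)
    (fun x hx => by
      have := le_sphMax (hc r₂ (by linarith) h3) hx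
      have := le_max_right (sphMax (fun x => f x - F x) r₁) (sphMax (fun x => f x - F x) r₂)
      linarith)
  obtain ⟨x, hx, e⟩ := exists_eq_sphMax (by linarith) (hc r (by linarith) (by linarith))
  rw [← e]
  have := key x (by linarith) (by linarith)
  linarith

theorem LogSuper.comp_isometry {p C₀ : ℝ} (hp : 1 < p) {V F : E → ℝ} (hV : FuchsPot p C₀ V)
    {a b : ℝ} (T : E ≃ₗᵢ[ℝ] E) (hF : LogSuper p V (ann a b) F) :
    LogSuper p V (ann a b) (fun x => F (T x)) := by
  have h := hF.comp_simil hp (x₀ := 0) one_pos T (isOpen_ann a b)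
  have e1 : ∀ y, simil (0:E) 1 T y = T y := fun y => by simp [simil]
  have e2 : (fun y => (1:ℝ) ^ p * V (simil 0 1 T y)) = V := by
    funext y
    rw [Real.one_rpow, one_mul, e1]
    exact hV.radial _ _ (T.norm_map y)
  have e3 : simil (0:E) 1 T ⁻¹' ann a b = ann a b := by
    ext y
    rw [mem_preimage, e1]
    simp only [ann, Set.mem_ofPred_eq, T.norm_map]
  rw [e2, e3] at h
  simpa only [e1] using h

/-- The oscillation of `f` on the sphere of radius `r`. -/
def sphOsc (f : E → ℝ) (r : ℝ) : ℝ := sphMax f r - sphMin f r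

theorem sphOsc_nonneg [Nontrivial E] {f : E → ℝ} {r : ℝ} (hr : 0 ≤ r)
    (hf : ContinuousOn f (sphere 0 r)) : 0 ≤ sphOsc f r := by
  obtain ⟨x, hx, e⟩ := exists_eq_sphMin hr hf
  have := le_sphMax hf hx
  unfold sphOsc
  linarith

theorem sub_le_sphOsc {f : E → ℝ} {r : ℝ} (hf : ContinuousOn f (sphere 0 r)) {x y : E}
    (hx : ‖x‖ = r) (hy : ‖y‖ = r) : f y - f x ≤ sphOsc f r := by
  have := le_sphMax hf hy
  have := sphMin_le hf hx
  unfold sphOsc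
  linarith

theorem sphOsc_quasiconvex [Nontrivial E] {p C₀ : ℝ} (hp : 1 < p) {V f : E → ℝ}
    (hV : FuchsPot p C₀ V) {ρ : ℝ} (hf : LogSol p V (ann 0 ρ) f) :
    ∀ r₁ r r₂, 0 < r₁ → r₁ < r → r < r₂ → r₂ < ρ →
      sphOsc f r ≤ max (sphOsc f r₁) (sphOsc f r₂) := by
  intro r₁ r r₂ h0 h1 h2 h3
  have hc : ∀ s, 0 < s → s < ρ → ContinuousOn f (sphere (0:E) s) :=
    fun s hs hs' => hf.1.1.continuousOn.mono (sphere_subset_ann hs hs')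
  set K := max (sphOsc f r₁) (sphOsc f r₂) with hK
  obtain ⟨x, hx, ex⟩ := exists_eq_sphMin (by linarith) (hc r (by linarith) (by linarith))
  obtain ⟨y, hy, ey⟩ := exists_eq_sphMax (by linarith) (hc r (by linarith) (by linarith))
  obtain ⟨T, hT⟩ := exists_isometry_map (hy.trans hx.symm)
  have hsub : (ann (r₁ / 2) ρ : Set E) ⊆ ann 0 ρ := ann_mono (by linarith) le_rfl
  have key := comparison_ann hp hV (half_pos h0) (half_lt_self h0) h3
    (((hf.1.comp_isometry hp hV T).mono hsub).add_const K) (hf.2.mono hsub)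
    (fun z hz => by
      have := sub_le_sphOsc (hc r₁ h0 (by linarith)) ((T.norm_map z).trans hz) hz
      have := le_max_left (sphOsc f r₁) (sphOsc f r₂)
      linarith)
    (fun z hz => by
      have := sub_le_sphOsc (hc r₂ (by linarith) h3) ((T.norm_map z).trans hz) hz
      have := le_max_right (sphOsc f r₁) (sphOsc f r₂)
      linarith)
  have := key y (by linarith) (by linarith)
  rw [hT] at this
  unfold sphOsc
  linarith

theorem FuchsPot.bound_ball {p C₀ : ℝ} (hp : 0 < p) {V : E → ℝ} (hV : FuchsPot p C₀ V) (x : E) :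
    ∀ z ∈ ball x (‖x‖ / 2), (‖x‖ / 2) ^ p * |V z| ≤ C₀ := fun z hz => by
  refine le_trans ?_ (hV.bound z)
  gcongr
  rw [mem_ball, dist_comm, dist_eq_norm] at hz
  have := norm_sub_norm_le x z
  linarith

theorem ball_half_subset_ann {ρ : ℝ} {x : E} (h : 3 / 2 * ‖x‖ ≤ ρ) :
    ball x (‖x‖ / 2) ⊆ ann 0 ρ := fun z hz => by
  have h2 := hz
  rw [mem_ball, dist_comm, dist_eq_norm] at hz
  rw [mem_ball, dist_eq_norm] at h2
  have h3 := norm_sub_norm_le x z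
  have h4 := norm_sub_norm_le z x
  have h5 : 0 ≤ ‖x - z‖ := norm_nonneg _
  exact ⟨by linarith, by linarith⟩

theorem LogSol.local_harnack {p : ℝ} (hp : 1 < p) (hn : 2 ≤ Module.finrank ℝ E) (C₀ : ℝ)
    (hC₀ : 0 ≤ C₀) : ∃ C : ℝ, 0 ≤ C ∧ ∀ (V f : E → ℝ) (ρ : ℝ), FuchsPot p C₀ V →
      LogSol p V (ann 0 ρ) f → ∀ x y : E, x ≠ 0 → 3 / 2 * ‖x‖ ≤ ρ → ‖x - y‖ < ‖x‖ / 128 →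
      |f x - f y| ≤ C := by
  obtain ⟨C, hC, H⟩ := LogSol.harnack (E := E) hp hn C₀ hC₀
  refine ⟨C, hC, fun V f ρ hV hf x y hx hxρ hxy => ?_⟩
  have hx0 : 0 < ‖x‖ := norm_pos_iff.2 hx
  have key := H V f _ x (‖x‖ / 2) (isOpen_ann 0 ρ) hV.meas (by linarith)
    (ball_half_subset_ann hxρ) (hV.bound_ball (by linarith) x) hf
  have hy : y ∈ ball x (‖x‖ / 2 / 64) := by
    rw [mem_ball, dist_comm, dist_eq_norm]; linarith
  have hx' : x ∈ ball x (‖x‖ / 2 / 64) := mem_ball_self (by positivity)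
  exact abs_sub_le_iff.2 ⟨key y hy x hx', key x hx' y hy⟩

theorem LogSol.sphere_osc_bound {p : ℝ} (hp : 1 < p) (hn : 2 ≤ Module.finrank ℝ E) (C₀ : ℝ)
    (hC₀ : 0 ≤ C₀) : ∃ C : ℝ, 0 ≤ C ∧ ∀ (V f : E → ℝ) (ρ : ℝ), FuchsPot p C₀ V →
      LogSol p V (ann 0 ρ) f → ∀ x y : E, x ≠ 0 → 3 / 2 * ‖x‖ ≤ ρ → ‖y‖ = ‖x‖ →
      |f x - f y| ≤ C := by
  obtain ⟨C, hC, H⟩ := LogSol.local_harnack (E := E) hp hn C₀ hC₀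
  refine ⟨2 ^ 17 * C, by positivity, fun V f ρ hV hf x y hx hxρ hxy => ?_⟩
  have hx0 : 0 < ‖x‖ := norm_pos_iff.2 hx
  refine sphere_chain hn (r := ‖x‖) (s := ‖x‖ / 128) (fun j x y => |f x - f y| ≤ 2 ^ j * C)
    (fun a b ha hb hab => ?_) (fun j a m b _ _ _ h1 h2 => ?_) 17 x y rfl hxy ?_
  · rw [pow_zero, one_mul]
    exact H V f ρ hV hf a b (norm_pos_iff.1 (ha ▸ hx0)) (ha ▸ hxρ) (ha ▸ hab)
  · rw [pow_succ]
    have := abs_sub_le (f a) (f m) (f b)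
    linarith
  · have h1 : (√2:ℝ) ^ 17 = 256 * √2 := by
      have : (√2:ℝ) ^ 2 = 2 := Real.sq_sqrt (by norm_num)
      calc (√2:ℝ) ^ 17 = (√2 ^ 2) ^ 8 * √2 := by ring
        _ = _ := by rw [this]; norm_num
    have h2 : (1:ℝ) < √2 := by
      rw [Real.lt_sqrt (by norm_num)]; norm_num
    have h3 := norm_sub_le x y
    rw [hxy] at h3
    rw [h1]
    nlinarith

end Punctured

section RadialFunctions

variable {E : Type*} [NormedAddCommGroup E] [InnerProductSpace ℝ E] [FiniteDimensional ℝ E]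
  [MeasurableSpace E] [BorelSpace E]

theorem ae_norm_of_ae [Nontrivial E] {q : ℝ → Prop} (h : ∀ᵐ r : ℝ, q r) :
    ∀ᵐ x : E, q ‖x‖ := by
  obtain ⟨N, hN, hNm, hN0⟩ := exists_measurable_superset_of_null (ae_iff.1 h)
  have hz : ∀ᵐ r : ℝ, N.indicator (fun _ => (1:ℝ)) r = 0 := by
    filter_upwards [measure_eq_zero_iff_ae_notMem.1 hN0] with r hr
    simp [hr]
  have hz2 : (fun r : ℝ => r ^ (Module.finrank ℝ E - 1) • N.indicator (fun _ => (1:ℝ)) r)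
      =ᵐ[volume.restrict (Ioi 0)] 0 := by
    filter_upwards [ae_restrict_of_ae hz] with r hr
    simp [hr]
  have hint : Integrable (fun x : E => N.indicator (fun _ => (1:ℝ)) ‖x‖) := by
    refine (integrable_fun_norm_addHaar (E := E) (volume : Measure E)
      (f := N.indicator (fun _ => (1:ℝ)))).2 ?_
    exact (integrable_zero _ _ _).congr hz2.symm
  have h0 : ∫ x : E, N.indicator (fun _ => (1:ℝ)) ‖x‖ = 0 := by
    rw [integral_fun_norm_addHaar (volume : Measure E) (N.indicator (fun _ => (1:ℝ))),
      integral_congr_ae hz2]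
    simp
  have h1 := (integral_eq_zero_iff_of_nonneg
    (fun x : E => indicator_nonneg (fun _ _ => zero_le_one) ‖x‖) hint).1 h0
  filter_upwards [h1] with x hx
  by_contra hq
  have : ‖x‖ ∈ N := hN hq
  simp [this] at hx

theorem ae_log_norm_of_ae [Nontrivial E] {q : ℝ → Prop} (h : ∀ᵐ t : ℝ, q t) :
    ∀ᵐ x : E, x ≠ 0 → q (Real.log ‖x‖) := by
  have h1 : ∀ᵐ r : ℝ, 0 < r → q (Real.log r) := by
    rw [ae_iff] at h ⊢
    refine measure_mono_null (t := Real.exp '' {t | ¬ q t}) (fun r hr => ?_)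
      (addHaar_image_eq_zero_of_differentiableOn_of_addHaar_eq_zero volume
        Real.differentiable_exp.differentiableOn h)
    simp only [Set.mem_ofPred_eq, Classical.not_imp] at hr
    exact ⟨Real.log r, hr.2, Real.exp_log hr.1⟩
  filter_upwards [ae_norm_of_ae (E := E) h1] with x hx h0
  exact hx (norm_pos_iff.2 h0)

theorem lipschitzWith_log_max {r : ℝ} (hr : 0 < r) :
    LipschitzWith (Real.toNNReal r⁻¹) fun x : E => Real.log (max ‖x‖ r) := by
  refine LipschitzWith.of_dist_le_mul fun x y => ?_
  rw [Real.coe_toNNReal _ (by positivity)]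
  have h : LipschitzOnWith (Real.toNNReal r⁻¹) Real.log (Ici r) := by
    refine (convex_Ici r).lipschitzOnWith_of_nnnorm_deriv_le
      (fun s hs => Real.differentiableAt_log (hr.trans_le hs).ne') fun s hs => ?_
    rw [← NNReal.coe_le_coe, coe_nnnorm, Real.deriv_log, Real.norm_eq_abs,
      abs_of_pos (inv_pos.2 (hr.trans_le hs)), Real.coe_toNNReal _ (by positivity)]
    exact inv_anti₀ hr hs
  have h2 := h.dist_le_mul (max ‖x‖ r) (mem_Ici.2 (le_max_right _ _)) (max ‖y‖ r)
    (mem_Ici.2 (le_max_right _ _))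
  rw [Real.coe_toNNReal _ (by positivity)] at h2
  refine h2.trans (mul_le_mul_of_nonneg_left ?_ (by positivity))
  rw [Real.dist_eq, dist_eq_norm]
  refine (abs_max_sub_max_le_abs _ _ _).trans ?_
  exact abs_norm_sub_norm_le x y

theorem hasGradientAt_log_norm {x : E} (hx : x ≠ 0) :
    HasGradientAt (fun y : E => Real.log ‖y‖) ((‖x‖ ^ 2)⁻¹ • x) x := by
  have hn : ‖x‖ ≠ 0 := norm_ne_zero_iff.2 hx
  have h2 : HasGradientAt (fun y : E => ‖y‖ ^ 2) ((2:ℝ) • x) x := by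
    rw [hasGradientAt_iff_hasFDerivAt]
    refine (hasStrictFDerivAt_norm_sq x).hasFDerivAt.congr_fderiv ?_
    ext v; simp
  have h3 := HasGradientAt.comp_real (h := fun s => Real.log s / 2) (x := x)
    ((Real.hasDerivAt_log (pow_ne_zero 2 hn)).div_const 2) h2
  have h4 := h3.congr_of_eventuallyEq (f₁ := fun y : E => Real.log ‖y‖)
    (Eventually.of_forall fun y => by simp [Real.log_pow])
  have e : ((‖x‖ ^ 2)⁻¹ / 2) • (2:ℝ) • x = (‖x‖ ^ 2)⁻¹ • x := by
    rw [smul_smul]; congr 1; field_simp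
  rwa [e] at h4

theorem hasGradientAt_norm_rpow_neg {x : E} (hx : x ≠ 0) (p : ℝ) :
    HasGradientAt (fun y : E => ‖y‖ ^ (-p)) ((-p * ‖x‖ ^ (-p) * (‖x‖ ^ 2)⁻¹) • x) x := by
  have hn : 0 < ‖x‖ := norm_pos_iff.2 hx
  have h1 := HasGradientAt.comp_real (h := fun s => Real.exp (s * (-p))) (x := x)
    (f := fun z : E => Real.log ‖z‖)
    ((((hasDerivAt_id (Real.log ‖x‖)).mul_const (-p)).exp)) (hasGradientAt_log_norm hx)
  have h4 := h1.congr_of_eventuallyEq (f₁ := fun y : E => ‖y‖ ^ (-p)) (by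
    filter_upwards [isOpen_ne.mem_nhds hx] with y hy
    rw [Real.rpow_def_of_pos (norm_pos_iff.2 hy)])
  have e : (Real.exp (id (Real.log ‖x‖) * -p) * (1 * -p)) • (‖x‖ ^ 2)⁻¹ • x =
      (-p * ‖x‖ ^ (-p) * (‖x‖ ^ 2)⁻¹) • x := by
    rw [smul_smul, Real.rpow_def_of_pos hn]; congr 1; simp only [id]; ring
  rwa [e] at h4

theorem HasGradientAt.lineDeriv_eq {f : E → ℝ} {g x : E} (h : HasGradientAt f g x) (v : E) :
    lineDeriv ℝ f x v = ⟪g, v⟫ := by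
  rw [hasGradientAt_iff_hasFDerivAt] at h
  rw [(h.hasLineDerivAt v).lineDeriv]; simp

theorem contDiffOn_norm_rpow (q : ℝ) {a b : ℝ} (ha : 0 ≤ a) :
    ContDiffOn ℝ 1 (fun x : E => ‖x‖ ^ q) (ann a b) := by
  intro x hx
  have hx0 : x ≠ 0 := norm_pos_iff.1 (ha.trans_lt hx.1)
  exact ((contDiffAt_norm ℝ hx0).rpow_const_of_ne (norm_ne_zero_iff.2 hx0)).contDiffWithinAt

theorem radial_integral_by_parts [Nontrivial E] {r₁ r₂ : ℝ} (hr : 0 < r₁) {y h : ℝ → ℝ}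
    {L : NNReal} (hy : LipschitzWith L y)
    (hh : ∀ᵐ t : ℝ, t ∈ Ioo (Real.log r₁) (Real.log r₂) → HasDerivAt y (h t) t) (p : ℝ)
    {η : E → ℝ} (hη : TestFun (ann r₁ r₂) η) :
    Integrable (fun x : E => ‖x‖ ^ (-p) * (h (Real.log ‖x‖) +
        (Module.finrank ℝ E - p) * y (Real.log ‖x‖)) * η x) ∧
    ∫ x, y (Real.log ‖x‖) * (‖x‖ ^ (-p) * ⟪x, gradient η x⟫) =
      -∫ x : E, ‖x‖ ^ (-p) * (h (Real.log ‖x‖) +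
        (Module.finrank ℝ E - p) * y (Real.log ‖x‖)) * η x := by
  set f : E → ℝ := fun x => y (Real.log (max ‖x‖ r₁)) with hf
  have hfL := hy.comp (lipschitzWith_log_max (E := E) hr)
  change LipschitzWith _ f at hfL
  have hfeq : ∀ x ∈ (ann r₁ r₂ : Set E), f x = y (Real.log ‖x‖) := fun x hx => by
    simp only [hf, max_eq_left hx.1.le]
  set b := stdOrthonormalBasis ℝ E
  set ψ : Fin (Module.finrank ℝ E) → E → ℝ := fun i x => (‖x‖ ^ (-p) * ⟪b i, x⟫) * η x with hψ
  have hψT : ∀ i, TestFun (ann r₁ r₂) (ψ i) := fun i =>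
    hη.mul_left (isOpen_ann r₁ r₂) ((contDiffOn_norm_rpow (-p) hr.le).mul
      (contDiff_const.inner ℝ contDiff_id).contDiffOn)
  have hI : ∀ i, ∫ x, lineDeriv ℝ f x (b i) * ψ i x =
      ∫ x, lineDeriv ℝ (ψ i) x (-(b i)) * f x := fun i => by
    obtain ⟨D, hD⟩ := ContDiff.lipschitzWith_of_hasCompactSupport (hψT i).compact
      (hψT i).contDiff one_ne_zero
    exact LipschitzWith.integral_lineDeriv_mul_eq hfL hD (hψT i).compact (b i)
  have hgψ : ∀ i x, gradient (ψ i) x = (‖x‖ ^ (-p) * ⟪b i, x⟫) • gradient η x +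
      (η x * ‖x‖ ^ (-p)) • (b i - (p * ⟪b i, x⟫ * (‖x‖ ^ 2)⁻¹) • x) := fun i x => by
    by_cases hx : x ∈ (ann r₁ r₂ : Set E)
    · have hx0 : x ≠ 0 := norm_pos_iff.1 (hr.trans hx.1)
      have h1 : HasGradientAt (fun x : E => ⟪b i, x⟫) (b i) x := by
        rw [hasGradientAt_iff_hasFDerivAt]
        exact (InnerProductSpace.toDual ℝ E (b i)).hasFDerivAt
      have h2 := ((hasGradientAt_norm_rpow_neg hx0 p).mul' h1).mul'
        (hη.contDiff.hasGradientAt' x)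
      rw [h2.gradient]
      module
    · rw [(hψT i).gradient_eq_zero hx, hη.gradient_eq_zero hx, hη.eq_zero hx]; simp
  have hL1 : ∀ i x, lineDeriv ℝ (ψ i) x (-(b i)) = -⟪gradient (ψ i) x, b i⟫ := fun i x => by
    rw [((hψT i).contDiff.hasGradientAt' x).lineDeriv_eq, inner_neg_right]
  have hint2 : ∀ i, Integrable fun x => lineDeriv ℝ (ψ i) x (-(b i)) * f x := fun i => by
    have e : (fun x => lineDeriv ℝ (ψ i) x (-(b i)) * f x) =
        fun x => f x * -⟪gradient (ψ i) x, b i⟫ := by funext x; rw [hL1]; ring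
    rw [e]
    refine Continuous.integrable_of_hasCompactSupport ?_ ?_
    · exact hfL.continuous.mul
        (((hψT i).contDiff.continuous_gradient).inner continuous_const).neg
    · refine HasCompactSupport.intro (hψT i).compact fun x hx => ?_
      rw [gradient_of_notMem_tsupport hx]; simp
  have hint1 : ∀ i, Integrable fun x => lineDeriv ℝ f x (b i) * ψ i x := fun i => by
    refine Integrable.bdd_mul (c := _) ?_ (aestronglyMeasurable_lineDeriv hfL.continuous volume)
      (ae_of_all _ fun x => norm_lineDeriv_le_of_lipschitz ℝ hfL)
    exact (hψT i).contDiff.continuous.integrable_of_hasCompactSupport (hψT i).compact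
  have hsum := Finset.sum_congr (rfl : (Finset.univ : Finset (Fin (Module.finrank ℝ E))) = _)
    fun i _ => hI i
  rw [← integral_finsetSum _ fun i _ => hint1 i, ← integral_finsetSum _ fun i _ => hint2 i]
    at hsum
  have hA : (fun x => ∑ i, lineDeriv ℝ f x (b i) * ψ i x) =ᵐ[volume]
      fun x : E => ‖x‖ ^ (-p) * h (Real.log ‖x‖) * η x := by
    filter_upwards [ae_log_norm_of_ae (E := E) hh] with x hx
    by_cases hxa : x ∈ (ann r₁ r₂ : Set E)
    · have hx0 : x ≠ 0 := norm_pos_iff.1 (hr.trans hxa.1)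
      have hn : ‖x‖ ≠ 0 := norm_ne_zero_iff.2 hx0
      have hd := hx hx0 ⟨Real.log_lt_log hr hxa.1, Real.log_lt_log (hr.trans hxa.1) hxa.2⟩
      have hg := HasGradientAt.comp_real (f := fun z : E => Real.log ‖z‖) hd (hasGradientAt_log_norm hx0)
      have hg' := hg.congr_of_eventuallyEq (f₁ := f) (by
        filter_upwards [(isOpen_ann r₁ r₂).mem_nhds hxa] with z hz using hfeq z hz)
      have e : ∀ i, lineDeriv ℝ f x (b i) * ψ i x =
          (‖x‖ ^ (-p) * h (Real.log ‖x‖) * η x * (‖x‖ ^ 2)⁻¹) * (⟪x, b i⟫ * ⟪b i, x⟫) :=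
        fun i => by
          rw [hg'.lineDeriv_eq, real_inner_smul_left, real_inner_smul_left]
          simp only [hψ]; ring
      simp only [e]
      rw [← Finset.mul_sum, b.sum_inner_mul_inner, real_inner_self_eq_norm_sq]
      field_simp
    · have : ∀ i, ψ i x = 0 := fun i => (hψT i).eq_zero hxa
      simp [this, hη.eq_zero hxa]
  have hB : ∀ x, ∑ i, lineDeriv ℝ (ψ i) x (-(b i)) * f x =
      -(y (Real.log ‖x‖) * (‖x‖ ^ (-p) * ⟪x, gradient η x⟫)) -
      ‖x‖ ^ (-p) * ((Module.finrank ℝ E - p) * y (Real.log ‖x‖)) * η x := fun x => by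
    by_cases hxa : x ∈ (ann r₁ r₂ : Set E)
    · have hx0 : x ≠ 0 := norm_pos_iff.1 (hr.trans hxa.1)
      have hn : ‖x‖ ≠ 0 := norm_ne_zero_iff.2 hx0
      have e : ∀ i, lineDeriv ℝ (ψ i) x (-(b i)) * f x =
          -(y (Real.log ‖x‖) * ‖x‖ ^ (-p)) * (⟪gradient η x, b i⟫ * ⟪b i, x⟫) -
          (y (Real.log ‖x‖) * ‖x‖ ^ (-p) * η x) *
            (1 - p * (‖x‖ ^ 2)⁻¹ * (⟪x, b i⟫ * ⟪b i, x⟫)) := fun i => by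
        rw [hL1, hgψ, hfeq x hxa, inner_add_left, real_inner_smul_left, real_inner_smul_left,
          inner_sub_left, real_inner_smul_left, real_inner_self_eq_norm_sq, b.norm_eq_one]
        ring
      simp only [e]
      rw [Finset.sum_sub_distrib, ← Finset.mul_sum, ← Finset.mul_sum, Finset.sum_sub_distrib,
        ← Finset.mul_sum, b.sum_inner_mul_inner, b.sum_inner_mul_inner,
        real_inner_self_eq_norm_sq, real_inner_comm x]
      simp only [Finset.sum_const, Finset.card_univ, Fintype.card_fin, nsmul_eq_mul, mul_one]
      field_simp
    · have : ∀ i, gradient (ψ i) x = 0 := fun i => (hψT i).gradient_eq_zero hxa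
      simp [hL1, this, hη.eq_zero hxa, hη.gradient_eq_zero hxa]
  have hcont : ContinuousOn (fun x : E => y (Real.log ‖x‖)) (ann r₁ r₂) :=
    hfL.continuous.continuousOn.congr fun x hx => (hfeq x hx).symm
  have hcp := (contDiffOn_norm_rpow (E := E) (-p) (b := r₂) hr.le).continuousOn
  have i1 : Integrable fun x : E =>
      y (Real.log ‖x‖) * (‖x‖ ^ (-p) * ⟪x, gradient η x⟫) := by
    refine (hη.integrable_inner
      (g := fun x : E => (y (Real.log ‖x‖) * ‖x‖ ^ (-p)) • x)
      ((hcont.mul hcp).smul continuousOn_id)).congr (ae_of_all _ fun x => ?_)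
    simp only [real_inner_smul_left, mul_assoc]
  have i2 : Integrable fun x : E =>
      ‖x‖ ^ (-p) * ((Module.finrank ℝ E - p) * y (Real.log ‖x‖)) * η x :=
    hη.integrable_mul (hcp.mul (continuousOn_const.mul hcont))
  have i3 := (integrable_finsetSum Finset.univ fun i _ => hint1 i).congr hA
  rw [integral_congr_ae hA, integral_congr_ae (ae_of_all _ hB),
    integral_sub (f := fun x => -(y (Real.log ‖x‖) * (‖x‖ ^ (-p) * ⟪x, gradient η x⟫)))
      i1.neg i2, integral_neg] at hsum
  have e : ∀ x : E, ‖x‖ ^ (-p) * (h (Real.log ‖x‖) +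
        (Module.finrank ℝ E - p) * y (Real.log ‖x‖)) * η x =
      ‖x‖ ^ (-p) * h (Real.log ‖x‖) * η x +
      ‖x‖ ^ (-p) * ((Module.finrank ℝ E - p) * y (Real.log ‖x‖)) * η x := fun x => by ring
  refine ⟨(i3.add i2).congr (ae_of_all _ fun x => (e x).symm), ?_⟩
  rw [integral_congr_ae (ae_of_all _ e), integral_add i3 i2]
  linarith

theorem integral_logForm_radial [Nontrivial E] {p : ℝ} (hp : 1 < p) {r₁ r₂ : ℝ} (hr : 0 < r₁)
    {V : E → ℝ} (hV : BddPot V (ann r₁ r₂)) {Γ g h : ℝ → ℝ} {L : NNReal}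
    (hΓ : ∀ t, HasDerivAt Γ (g t) t) (hg : Continuous g)
    (hy : LipschitzWith L fun t => pflux p (g t))
    (hh : ∀ᵐ t : ℝ, t ∈ Ioo (Real.log r₁) (Real.log r₂) →
      HasDerivAt (fun t => pflux p (g t)) (h t) t)
    {η : E → ℝ} (hη : TestFun (ann r₁ r₂) η) :
    ∫ x, logForm p V (fun x => Γ (Real.log ‖x‖)) η x =
      ∫ x : E, ‖x‖ ^ (-p) * (‖x‖ ^ p * V x - (h (Real.log ‖x‖) +
        (Module.finrank ℝ E - p) * pflux p (g (Real.log ‖x‖)) +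
          (p - 1) * |g (Real.log ‖x‖)| ^ p)) * η x := by
  obtain ⟨j1, j2⟩ := radial_integral_by_parts (E := E) hr hy hh p hη
  have hcl : ContinuousOn (fun x : E => Real.log ‖x‖) (ann r₁ r₂) :=
    continuous_norm.continuousOn.log fun x hx => (hr.trans hx.1).ne'
  have hcg := hg.comp_continuousOn hcl
  have hcp := (contDiffOn_norm_rpow (E := E) (-p) (b := r₂) hr.le).continuousOn
  have i1 : Integrable fun x : E =>
      pflux p (g (Real.log ‖x‖)) * (‖x‖ ^ (-p) * ⟪x, gradient η x⟫) := by
    refine (hη.integrable_inner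
      (g := fun x : E => (pflux p (g (Real.log ‖x‖)) * ‖x‖ ^ (-p)) • x)
      (((hy.continuous.comp_continuousOn hcl).mul hcp).smul continuousOn_id)).congr
        (ae_of_all _ fun x => ?_)
    simp only [real_inner_smul_left, mul_assoc]
  have i2 : Integrable fun x : E => V x * (1 * η x) := hη.integrable_pot hV continuousOn_const
  have i3 : Integrable fun x : E => (p - 1) * (|g (Real.log ‖x‖)| ^ p * ‖x‖ ^ (-p)) * η x :=
    hη.integrable_mul (continuousOn_const.mul (((hcg.abs).rpow_const
      fun x _ => Or.inr (by linarith)).mul hcp))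
  have e1 : ∀ x, logForm p V (fun x => Γ (Real.log ‖x‖)) η x =
      (pflux p (g (Real.log ‖x‖)) * (‖x‖ ^ (-p) * ⟪x, gradient η x⟫)) +
        (V x * (1 * η x) - (p - 1) * (|g (Real.log ‖x‖)| ^ p * ‖x‖ ^ (-p)) * η x) := fun x => by
    by_cases hx : x ∈ (ann r₁ r₂ : Set E)
    · have hn : 0 < ‖x‖ := hr.trans hx.1
      have hx0 : x ≠ 0 := norm_pos_iff.1 hn
      have hG := (HasGradientAt.comp_real (f := fun z : E => Real.log ‖z‖)
        (hΓ (Real.log ‖x‖)) (hasGradientAt_log_norm hx0)).gradient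
      have hN : ‖g (Real.log ‖x‖) • (‖x‖ ^ 2)⁻¹ • x‖ = |g (Real.log ‖x‖)| * ‖x‖⁻¹ := by
        rw [norm_smul, norm_smul, norm_inv, norm_pow, norm_norm, Real.norm_eq_abs]
        field_simp
      have hq1 : ‖x‖⁻¹ ^ p = ‖x‖ ^ (-p) := by
        rw [Real.inv_rpow hn.le, Real.rpow_neg hn.le]
      have hq2 : ‖x‖⁻¹ ^ (p - 2) * (‖x‖ ^ 2)⁻¹ = ‖x‖ ^ (-p) := by
        rw [← hq1, Real.rpow_sub (by positivity), Real.rpow_two]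
        field_simp
      have hflux : pflux p (g (Real.log ‖x‖) • (‖x‖ ^ 2)⁻¹ • x) =
          (pflux p (g (Real.log ‖x‖)) * ‖x‖ ^ (-p)) • x := by
        rw [pflux, hN, Real.mul_rpow (abs_nonneg _) (by positivity), smul_smul, smul_smul,
          pflux, ← hq2, Real.norm_eq_abs, smul_eq_mul]
        congr 1; ring
      rw [logForm, hG, hflux, hN, Real.mul_rpow (abs_nonneg _) (by positivity), hq1,
        real_inner_smul_left]
      ring
    · rw [logForm, hη.eq_zero hx, hη.gradient_eq_zero hx]; simp
  have e2 : ∀ x : E, ‖x‖ ^ (-p) * (‖x‖ ^ p * V x - (h (Real.log ‖x‖) +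
        (Module.finrank ℝ E - p) * pflux p (g (Real.log ‖x‖)) +
          (p - 1) * |g (Real.log ‖x‖)| ^ p)) * η x =
      (V x * (1 * η x) - (p - 1) * (|g (Real.log ‖x‖)| ^ p * ‖x‖ ^ (-p)) * η x) -
      ‖x‖ ^ (-p) * (h (Real.log ‖x‖) +
        (Module.finrank ℝ E - p) * pflux p (g (Real.log ‖x‖))) * η x := fun x => by
    by_cases hx : x ∈ (ann r₁ r₂ : Set E)
    · have hn : 0 < ‖x‖ := hr.trans hx.1
      have : ‖x‖ ^ (-p) * ‖x‖ ^ p = 1 := by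
        rw [← Real.rpow_add hn]; simp
      linear_combination V x * η x * this
    · rw [hη.eq_zero hx]; simp
  have i4 : Integrable fun x : E => V x * (1 * η x) -
      (p - 1) * (|g (Real.log ‖x‖)| ^ p * ‖x‖ ^ (-p)) * η x := i2.sub i3
  rw [integral_congr_ae (ae_of_all _ e1), integral_add i1 i4, j2,
    integral_congr_ae (ae_of_all _ e2), integral_sub i4 j1]
  ring

theorem contDiffOn_radial {r₁ r₂ : ℝ} (hr : 0 < r₁) {Γ g : ℝ → ℝ}
    (hΓ : ∀ t, HasDerivAt Γ (g t) t) (hg : Continuous g) :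
    ContDiffOn ℝ 1 (fun x : E => Γ (Real.log ‖x‖)) (ann r₁ r₂) := by
  have h1 : ContDiff ℝ 1 Γ := by
    rw [contDiff_one_iff_deriv]
    refine ⟨fun t => (hΓ t).differentiableAt, ?_⟩
    have : deriv Γ = g := funext fun t => (hΓ t).deriv
    rwa [this]
  refine h1.comp_contDiffOn fun x hx => ?_
  have hx0 : x ≠ 0 := norm_pos_iff.1 (hr.trans hx.1)
  exact ((contDiffAt_norm ℝ hx0).log (norm_ne_zero_iff.2 hx0)).contDiffWithinAt

theorem logSub_radial [Nontrivial E] {p : ℝ} (hp : 1 < p) {r₁ r₂ : ℝ} (hr : 0 < r₁)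
    {V : E → ℝ} (hV : BddPot V (ann r₁ r₂)) {Γ g h : ℝ → ℝ} {L : NNReal}
    (hΓ : ∀ t, HasDerivAt Γ (g t) t) (hg : Continuous g)
    (hy : LipschitzWith L fun t => pflux p (g t))
    (hh : ∀ᵐ t : ℝ, t ∈ Ioo (Real.log r₁) (Real.log r₂) →
      HasDerivAt (fun t => pflux p (g t)) (h t) t)
    (hle : ∀ x ∈ (ann r₁ r₂ : Set E), ‖x‖ ^ p * V x ≤ h (Real.log ‖x‖) +
        (Module.finrank ℝ E - p) * pflux p (g (Real.log ‖x‖)) +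
          (p - 1) * |g (Real.log ‖x‖)| ^ p) :
    LogSub p V (ann r₁ r₂) (fun x => Γ (Real.log ‖x‖)) := by
  refine ⟨contDiffOn_radial hr hΓ hg, fun η hη h0 => ?_⟩
  rw [integral_logForm_radial hp hr hV hΓ hg hy hh hη]
  refine integral_nonpos fun x => ?_
  by_cases hx : x ∈ (ann r₁ r₂ : Set E)
  · exact mul_nonpos_of_nonpos_of_nonneg (mul_nonpos_of_nonneg_of_nonpos
      (Real.rpow_nonneg (norm_nonneg _) _) (sub_nonpos.2 (hle x hx))) (h0 x)
  · simp [hη.eq_zero hx]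

theorem logSol_radial [Nontrivial E] {p : ℝ} (hp : 1 < p) {r₁ r₂ : ℝ} (hr : 0 < r₁)
    {V : E → ℝ} (hV : BddPot V (ann r₁ r₂)) {Γ g h : ℝ → ℝ} {L : NNReal}
    (hΓ : ∀ t, HasDerivAt Γ (g t) t) (hg : Continuous g)
    (hy : LipschitzWith L fun t => pflux p (g t))
    (hh : ∀ᵐ t : ℝ, t ∈ Ioo (Real.log r₁) (Real.log r₂) →
      HasDerivAt (fun t => pflux p (g t)) (h t) t)
    (heq : ∀ x ∈ (ann r₁ r₂ : Set E), ‖x‖ ^ p * V x = h (Real.log ‖x‖) +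
        (Module.finrank ℝ E - p) * pflux p (g (Real.log ‖x‖)) +
          (p - 1) * |g (Real.log ‖x‖)| ^ p) :
    LogSol p V (ann r₁ r₂) (fun x => Γ (Real.log ‖x‖)) := by
  refine ⟨⟨contDiffOn_radial hr hΓ hg, fun η hη h0 => ?_⟩,
    logSub_radial hp hr hV hΓ hg hy hh fun x hx => (heq x hx).le⟩
  rw [integral_logForm_radial hp hr hV hΓ hg hy hh hη]
  refine integral_nonneg fun x => ?_
  by_cases hx : x ∈ (ann r₁ r₂ : Set E)
  · simp [heq x hx]
  · simp [hη.eq_zero hx]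

end RadialFunctions

section Barrier

variable {E : Type*} [NormedAddCommGroup E] [InnerProductSpace ℝ E] [FiniteDimensional ℝ E]
  [MeasurableSpace E] [BorelSpace E]

theorem exp_lt_two {u : ℝ} (hu : u ≤ 1 / 2) : Real.exp u < 2 := by
  have h1 := Real.exp_le_exp.2 hu
  have h2 : Real.exp (1 / 2) * Real.exp (1 / 2) = Real.exp 1 := by
    rw [← Real.exp_add]; norm_num
  have := Real.exp_one_lt_d9
  nlinarith [Real.exp_pos (1 / 2)]

theorem logSub_linear_log [Nontrivial E] {p C₀ : ℝ} (hp : 1 < p) {V : E → ℝ}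
    (hV : FuchsPot p C₀ V) {r₁ r₂ : ℝ} (hr : 0 < r₁) {μ : ℝ} (h1 : 1 ≤ |μ|)
    (hμ : C₀ + |Module.finrank ℝ E - p| ≤ (p - 1) * |μ|) (c : ℝ) :
    LogSub p V (ann r₁ r₂) (fun x => c + μ * Real.log ‖x‖) := by
  have hΓ : ∀ t, HasDerivAt (fun t => c + μ * t) μ t := fun t => by
    simpa using ((hasDerivAt_id t).const_mul μ).const_add c
  refine logSub_radial hp hr (hV.bddPot (by linarith) hr r₂) (Γ := fun t => c + μ * t)
    (g := fun _ => μ) (h := fun _ => 0) (L := 0) hΓ continuous_const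
    (LipschitzWith.const _) (ae_of_all _ fun t _ => hasDerivAt_const _ _) fun x _ => ?_
  have hb : ‖x‖ ^ p * V x ≤ C₀ :=
    (mul_le_mul_of_nonneg_left (le_abs_self _) (Real.rpow_nonneg (norm_nonneg _) _)).trans
      (hV.bound x)
  have hq : 1 ≤ |μ| ^ (p - 1) := Real.one_le_rpow h1 (by linarith)
  have h2 : |(Module.finrank ℝ E - p) * pflux p μ| ≤
      |Module.finrank ℝ E - p| * |μ| ^ (p - 1) := by
    rw [abs_mul, ← Real.norm_eq_abs (pflux p μ), norm_pflux hp, Real.norm_eq_abs]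
  have h3 : |μ| ^ p = |μ| ^ (p - 1) * |μ| := by
    rw [← Real.rpow_add_one (by positivity)]; congr 1; ring
  have h4 := neg_abs_le ((Module.finrank ℝ E - p) * pflux p μ)
  have h5 := mul_le_mul_of_nonneg_right hμ (by positivity : 0 ≤ |μ| ^ (p - 1))
  have h6 := mul_le_mul_of_nonneg_left hq hV.nonneg
  rw [h3]
  nlinarith

theorem LogSol.sphMin_lipschitz {p : ℝ} (hp : 1 < p) (hn : 2 ≤ Module.finrank ℝ E) (C₀ : ℝ)
    (hC₀ : 0 ≤ C₀) : ∃ μ : ℝ, 1 ≤ μ ∧ ∀ V f : E → ℝ, FuchsPot p C₀ V →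
      LogSol p V (ann 0 4) f → ∀ s t : ℝ, |s| ≤ 1 / 4 → |s - t| ≤ 1 / 512 →
      sphMin f (Real.exp s) - μ * |s - t| ≤ sphMin f (Real.exp t) := by
  have : Nontrivial E := Module.nontrivial_of_finrank_pos (R := ℝ) (by omega)
  obtain ⟨C, hC, H⟩ := LogSol.local_harnack (E := E) hp hn C₀ hC₀
  set μ : ℝ := 1 + 512 * C + (C₀ + |Module.finrank ℝ E - p|) / (p - 1) with hμ
  have hp1 : 0 < p - 1 := by linarith
  have hq0 : 0 ≤ (C₀ + |Module.finrank ℝ E - p|) / (p - 1) := by positivity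
  refine ⟨μ, by linarith, fun V f hV hf s t hs hst => ?_⟩
  have hμ1 : 1 ≤ μ := by linarith
  have hμ2 : C₀ + |Module.finrank ℝ E - p| ≤ (p - 1) * μ := by
    have : (p - 1) * ((C₀ + |Module.finrank ℝ E - p|) / (p - 1)) =
        C₀ + |Module.finrank ℝ E - p| := by field_simp
    nlinarith
  have hexp2 := fun u hu => exp_lt_two (u := u) hu
  have hcont : ContinuousOn f (ann 0 4) := hf.1.1.continuousOn
  have hsph : ∀ u : ℝ, u ≤ 1 / 2 → ContinuousOn f (sphere (0:E) (Real.exp u)) := fun u hu =>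
    hcont.mono (sphere_subset_ann (Real.exp_pos u) (by linarith [hexp2 u hu]))
  rw [abs_le] at hs hst
  have hnear : ∀ x : E, x ≠ 0 → |Real.log ‖x‖ - s| ≤ 1 / 512 →
      sphMin f (Real.exp s) - C ≤ f x := fun x hx hxs => by
    have hn0 : 0 < ‖x‖ := norm_pos_iff.2 hx
    set q := s - Real.log ‖x‖ with hq
    have hqa : |q| ≤ 1 / 512 := by rwa [hq, abs_sub_comm]
    have hxn : ‖x‖ = Real.exp (Real.log ‖x‖) := (Real.exp_log hn0).symm
    have hy : ‖Real.exp q • x‖ = Real.exp s := by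
      rw [norm_smul, Real.norm_of_nonneg (Real.exp_pos q).le, hxn, ← Real.exp_add]
      congr 1; simp [hq]
    have h1 := sphMin_le (hsph s (by linarith)) hy
    have h2 : ‖x - Real.exp q • x‖ < ‖x‖ / 128 := by
      have : x - Real.exp q • x = (-(Real.exp q - 1)) • x := by module
      rw [this, norm_smul, norm_neg, Real.norm_eq_abs]
      have := Real.abs_exp_sub_one_le (x := q) (by linarith)
      nlinarith
    have hlx : Real.log ‖x‖ ≤ 1 / 2 := by
      have := (abs_le.1 hxs).2; linarith
    have h3 := H V f 4 hV hf x _ hx (by rw [hxn]; linarith [hexp2 _ hlx]) h2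
    have := (abs_le.1 h3).1
    linarith
  have main : ∀ σ : ℝ, |σ| = 1 → ∀ r₁ r₂ : ℝ, r₁ < r₂ → r₂ ≤ 1 / 2 →
      (∀ u, u = r₁ ∨ u = r₂ → u = s ∨ (u - s) * σ = 1 / 512 ∧ |u - s| ≤ 1 / 512) →
      ∀ x : E, x ≠ 0 → r₁ ≤ Real.log ‖x‖ → Real.log ‖x‖ ≤ r₂ →
        sphMin f (Real.exp s) - μ * (σ * (Real.log ‖x‖ - s)) ≤ f x := by
    intro σ hσ r₁ r₂ h12 hr2 hend x hx hx1 hx2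
    have hsub := logSub_linear_log (E := E) hp hV (r₁ := Real.exp (r₁ - 1)) (r₂ := 4)
      (Real.exp_pos _) (μ := -(μ * σ)) (by rw [abs_neg, abs_mul, hσ, mul_one]; exact hμ1.trans (le_abs_self _))
      (by rw [abs_neg, abs_mul, hσ, mul_one, abs_of_nonneg (by linarith : 0 ≤ μ)]; exact hμ2)
      (sphMin f (Real.exp s) + μ * σ * s)
    have hb : ∀ u, u = r₁ ∨ u = r₂ → ∀ x : E, ‖x‖ = Real.exp u →
        sphMin f (Real.exp s) + μ * σ * s + -(μ * σ) * Real.log ‖x‖ ≤ f x := by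
      intro u hu x hxu
      have hx0 : x ≠ 0 := norm_pos_iff.1 (hxu ▸ Real.exp_pos u)
      have hl : Real.log ‖x‖ = u := by rw [hxu, Real.log_exp]
      rcases hend u hu with h | ⟨h, h'⟩
      · have := sphMin_le (hsph s (by linarith)) (h ▸ hxu)
        rw [hl, h]; linarith
      · have := hnear x hx0 (by rwa [hl])
        rw [hl]
        nlinarith
    have hpos := norm_pos_iff.2 hx
    have key := comparison_ann hp hV (Real.exp_pos (r₁ - 1)) (Real.exp_lt_exp.2 (by linarith))
      (show Real.exp r₂ < 4 by linarith [hexp2 r₂ hr2])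
      (hf.1.mono (ann_mono (Real.exp_pos _).le le_rfl)) hsub
      (hb r₁ (Or.inl rfl)) (hb r₂ (Or.inr rfl)) x
      ((Real.le_log_iff_exp_le hpos).1 hx1) ((Real.log_le_iff_le_exp hpos).1 hx2)
    linarith
  obtain ⟨x, hx, hfx⟩ := exists_eq_sphMin (Real.exp_pos t).le (hsph t (by linarith))
  have hx0 : x ≠ 0 := norm_pos_iff.1 (hx ▸ Real.exp_pos t)
  have hl : Real.log ‖x‖ = t := by rw [hx, Real.log_exp]
  rw [← hfx]
  rcases le_total s t with h | h
  · have := main 1 (by simp) s (s + 1 / 512) (by linarith) (by linarith)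
      (fun u hu => by rcases hu with rfl | rfl <;> [left; right] <;> norm_num) x hx0
      (by linarith) (by linarith)
    rw [hl] at this
    rw [abs_of_nonpos (by linarith)]; linarith
  · have := main (-1) (by simp) (s - 1 / 512) s (by linarith) (by linarith)
      (fun u hu => by rcases hu with rfl | rfl <;> [right; left] <;> norm_num) x hx0
      (by linarith) (by linarith)
    rw [hl] at this
    rw [abs_of_nonneg (by linarith)]; linarith

end Barrier

theorem exists_slope_of_increment {Φ γ U : ℝ → ℝ} {K : NNReal} {N C₀ τ τ' Y μ Δ : ℝ}
    (hΦ : LipschitzWith K Φ) (hN : ∀ y, |Φ y| ≤ N) (hU : Measurable U) (hUb : ∀ t, |U t| ≤ C₀)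
    (hτ' : 0 < τ') (hττ : τ' ≤ τ) (hY : (N + C₀) * τ ≤ Y / 2) (hγ : Continuous γ)
    (hγ1 : ∀ y, Y / 2 ≤ y → μ ≤ γ y) (hγ2 : ∀ y, y ≤ -(Y / 2) → γ y ≤ -μ)
    (hΔ : |Δ| ≤ 2 * μ * τ') :
    ∃ y : ℝ → ℝ, LipschitzWith (N + C₀).toNNReal y ∧ (∀ t, |y t| ≤ 3 / 2 * Y) ∧
      (∀ᵐ t, t ∈ Ioo (-τ) τ → HasDerivAt y (U t - Φ (y t)) t) ∧
      ∫ t in (-τ')..τ', γ (y t) = Δ := by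
  have hτ : 0 < τ := hτ'.trans_le hττ
  have hN0 : 0 ≤ N := (abs_nonneg _).trans (hN 0)
  have hC0 : 0 ≤ C₀ := (abs_nonneg _).trans (hUb 0)
  have hY0 : 0 ≤ Y := by nlinarith [mul_nonneg (add_nonneg hN0 hC0) hτ.le]
  have hle : -τ ≤ τ := by linarith
  have hle' : -τ' ≤ τ' := by linarith
  have hleY : -Y ≤ Y := by linarith
  have hUi : ∀ a b, IntervalIntegrable U volume a b := fun a b =>
    (intervalIntegrable_const (c := C₀)).mono_fun hU.aestronglyMeasurable
      (ae_of_all _ fun t => by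
        show ‖U t‖ ≤ ‖C₀‖; rw [Real.norm_of_nonneg hC0]; exact hUb t)
  set W : ℝ → ℝ := fun t => ∫ s in (0:ℝ)..t, U s with hW
  have hWL : ∀ s t, |W s - W t| ≤ C₀ * |s - t| := fun s t => by
    have h1 : W s - W t = ∫ u in t..s, U u := by
      rw [hW]; exact intervalIntegral.integral_interval_sub_left (hUi _ _) (hUi _ _)
    rw [h1, ← Real.norm_eq_abs]
    exact intervalIntegral.norm_integral_le_of_norm_le_const fun u _ => hUb u
  have hWc : Continuous W := (LipschitzWith.of_dist_le_mul (K := C₀.toNNReal) fun s t => by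
    rw [Real.coe_toNNReal _ hC0]; exact hWL s t).continuous
  have hW0 : W 0 = 0 := by simp [hW]
  have hPL : IsPicardLindelof (fun t z => -Φ (z + W t)) (tmin := -τ) (tmax := τ)
      ⟨0, by constructor <;> linarith⟩ (0:ℝ) (2 * Y.toNNReal) Y.toNNReal N.toNNReal K := by
    refine ⟨fun t _ => ?_, fun z _ => ?_, fun t _ z _ => ?_, ?_⟩
    · refine LipschitzWith.lipschitzOnWith (LipschitzWith.of_dist_le_mul fun a b => ?_)
      have := hΦ.dist_le_mul (a + W t) (b + W t)
      rw [dist_neg_neg]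
      simpa using this
    · exact (hΦ.continuous.comp (continuous_const.add hWc)).neg.continuousOn
    · rw [norm_neg, Real.coe_toNNReal _ hN0]; exact hN _
    · push_cast
      rw [Real.coe_toNNReal _ hN0, Real.coe_toNNReal _ hY0]
      simp only [sub_zero, zero_sub, neg_neg, max_self]
      nlinarith [mul_nonneg hC0 hτ.le]
  obtain ⟨α, hα, hαc⟩ := hPL.exists_forall_mem_closedBall_eq_hasDerivWithinAt_continuousOn
  have hball : ∀ s ∈ Icc (-Y) Y, s ∈ closedBall (0:ℝ) Y.toNNReal := fun s hs => by
    rw [mem_closedBall_zero_iff, Real.coe_toNNReal _ hY0, Real.norm_eq_abs]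
    exact abs_le.2 hs
  set pt : ℝ → ℝ := fun t => projIcc (-τ) τ hle t with hpt
  set ps : ℝ → ℝ := fun t => projIcc (-Y) Y hleY t with hps
  have hptm : ∀ t, pt t ∈ Icc (-τ) τ := fun t => (projIcc (-τ) τ hle t).2
  have hpsm : ∀ t, ps t ∈ Icc (-Y) Y := fun t => (projIcc (-Y) Y hleY t).2
  have hptc : Continuous pt := continuous_subtype_val.comp continuous_projIcc
  have hpsc : Continuous ps := continuous_subtype_val.comp continuous_projIcc
  have hpte : ∀ t ∈ Icc (-τ) τ, pt t = t := fun t ht => by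
    simp only [hpt, projIcc_of_mem hle ht]
  have hpse : ∀ t ∈ Icc (-Y) Y, ps t = t := fun t ht => by
    simp only [hps, projIcc_of_mem hleY ht]
  have hptL : ∀ a b, |pt a - pt b| ≤ |a - b| := fun a b => by
    have := (LipschitzWith.projIcc hle).dist_le_mul a b
    simpa [Subtype.dist_eq, Real.dist_eq] using this
  have hαL : ∀ s ∈ Icc (-Y) Y, ∀ a ∈ Icc (-τ) τ, ∀ b ∈ Icc (-τ) τ,
      |α (s, a) - α (s, b)| ≤ N * |a - b| := fun s hs a ha b hb => by
    have := (convex_Icc (-τ) τ).norm_image_sub_le_of_norm_hasDerivWithin_le (C := N)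
      (fun t ht => (hα s (hball s hs)).2 t ht) (fun t _ => by
        rw [norm_neg]; exact hN _) hb ha
    simpa [Real.norm_eq_abs] using this
  set y : ℝ → ℝ → ℝ := fun s t => α (ps s, pt t) + W (pt t) with hy
  have hyc : Continuous (Function.uncurry y) := by
    refine Continuous.add ?_ (hWc.comp (hptc.comp continuous_snd))
    exact hαc.comp_continuous ((hpsc.comp continuous_fst).prodMk (hptc.comp continuous_snd))
      fun x => ⟨hball _ (hpsm _), hptm _⟩
  have h0m : (0:ℝ) ∈ Icc (-τ) τ := ⟨by linarith, hτ.le⟩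
  have hyL : ∀ s a b, |y s a - y s b| ≤ (N + C₀) * |a - b| := fun s a b => by
    have h1 := hαL _ (hpsm s) _ (hptm a) _ (hptm b)
    have h2 := hWL (pt a) (pt b)
    have h3 := hptL a b
    have h4 : y s a - y s b = (α (ps s, pt a) - α (ps s, pt b)) + (W (pt a) - W (pt b)) := by
      simp only [hy]; ring
    rw [h4]
    refine (abs_add_le _ _).trans ?_
    nlinarith [mul_le_mul_of_nonneg_left h3 (add_nonneg hN0 hC0)]
  have hy0 : ∀ s, y s 0 = ps s := fun s => by
    simp only [hy, hpte 0 h0m, hW0, add_zero]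
    exact (hα _ (hball _ (hpsm s))).1
  have hyd : ∀ s t, |y s t - ps s| ≤ Y / 2 := fun s t => by
    have h1 : y s t = y s (pt t) := by simp only [hy, hpte _ (hptm t)]
    rw [h1, ← hy0 s]
    refine (hyL s _ _).trans ?_
    have : |pt t - 0| ≤ τ := by rw [sub_zero]; exact abs_le.2 (hptm t)
    nlinarith [mul_le_mul_of_nonneg_left this (add_nonneg hN0 hC0)]
  have hJ : Continuous fun s => ∫ t in (-τ')..τ', γ (y s t) :=
    intervalIntegral.continuous_parametric_intervalIntegral_of_continuous'
      (show Continuous (Function.uncurry fun s t => γ (y s t)) from hγ.comp hyc) _ _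
  have hyct : ∀ s, Continuous fun t => γ (y s t) := fun s =>
    hγ.comp (hyc.comp (Continuous.prodMk_right s))
  rw [abs_le] at hΔ
  have hJ1 : ∫ t in (-τ')..τ', γ (y (-Y) t) ≤ Δ := by
    have h1 : ∫ t in (-τ')..τ', γ (y (-Y) t) ≤ ∫ t in (-τ')..τ', -μ := by
      refine intervalIntegral.integral_mono_on hle' ((hyct _).intervalIntegrable _ _)
        intervalIntegrable_const fun t _ => hγ2 _ ?_
      have := (abs_le.1 (hyd (-Y) t)).2
      rw [hpse (-Y) ⟨le_rfl, hleY⟩] at this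
      linarith
    rw [intervalIntegral.integral_const, smul_eq_mul] at h1
    linarith
  have hJ2 : Δ ≤ ∫ t in (-τ')..τ', γ (y Y t) := by
    have h1 : ∫ t in (-τ')..τ', μ ≤ ∫ t in (-τ')..τ', γ (y Y t) := by
      refine intervalIntegral.integral_mono_on hle' intervalIntegrable_const
        ((hyct _).intervalIntegrable _ _) fun t _ => hγ1 _ ?_
      have := (abs_le.1 (hyd Y t)).1
      rw [hpse Y ⟨hleY, le_rfl⟩] at this
      linarith
    rw [intervalIntegral.integral_const, smul_eq_mul] at h1
    linarith
  obtain ⟨s, hs⟩ := mem_range_of_exists_le_of_exists_ge hJ ⟨-Y, hJ1⟩ ⟨Y, hJ2⟩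
  refine ⟨y s, LipschitzWith.of_dist_le_mul fun a b => ?_, fun t => ?_, ?_, hs⟩
  · rw [Real.coe_toNNReal _ (add_nonneg hN0 hC0)]; exact hyL s a b
  · have h1 := abs_le.1 (hyd s t)
    have h2 := hpsm s
    rw [abs_le]; constructor <;> linarith [h1.1, h1.2, h2.1, h2.2]
  · filter_upwards [(hUi (-τ) τ).ae_hasDerivAt_integral] with t ht htm
    have hnh : Icc (-τ) τ ∈ 𝓝 t := Icc_mem_nhds htm.1 htm.2
    have h1 := ht (by rw [uIcc_of_le hle]; exact Ioo_subset_Icc_self htm) 0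
      (by rw [uIcc_of_le hle]; exact h0m)
    have h2 := ((hα _ (hball _ (hpsm s))).2 t (Ioo_subset_Icc_self htm)).hasDerivAt hnh
    have h3 := (h2.add h1).congr_of_eventuallyEq (f₁ := y s) (by
      filter_upwards [hnh] with u hu
      simp only [hy, hpte u hu, Pi.add_apply, hW])
    refine h3.congr_deriv ?_
    simp only [hy, hpte t (Ioo_subset_Icc_self htm)]
    ring

theorem rpow_mul_ge_of_bounds {p b A : ℝ} (hp : 1 < p) (hb : 0 < b) (hA : 0 < A) {τ σ : ℝ}
    (hτ : 1 ≤ τ) (h1 : b ≤ σ) (h2 : σ ≤ 2 * A * τ) :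
    min (b ^ (p - 2)) ((2 * A) ^ (p - 2)) ≤ σ ^ (p - 2) * τ := by
  have hσ : 0 < σ := hb.trans_le h1
  rcases le_total 2 p with h | h
  · refine (min_le_left _ _).trans ?_
    have := Real.rpow_le_rpow hb.le h1 (by linarith : 0 ≤ p - 2)
    have h0 : 0 ≤ σ ^ (p - 2) := by positivity
    nlinarith
  · refine (min_le_right _ _).trans ?_
    have h3 := Real.rpow_le_rpow_of_nonpos hσ h2 (by linarith : p - 2 ≤ 0)
    have hτ0 : 0 < τ := by linarith
    rw [Real.mul_rpow (by positivity) hτ0.le] at h3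
    have h4 : τ ^ (p - 2) * τ = τ ^ (p - 1) := by
      rw [← Real.rpow_add_one hτ0.ne']; congr 1; ring
    have h5 : 1 ≤ τ ^ (p - 1) := Real.one_le_rpow hτ (by linarith)
    have h6 : 0 ≤ (2 * A) ^ (p - 2) := by positivity
    calc (2 * A) ^ (p - 2) ≤ (2 * A) ^ (p - 2) * (τ ^ (p - 2) * τ) := by rw [h4]; nlinarith
      _ = (2 * A) ^ (p - 2) * τ ^ (p - 2) * τ := by ring
      _ ≤ _ := by gcongr

theorem pow_mul_rpow_le_of_bounds {p b A Λ : ℝ} (hp : 1 < p) (hb : 0 < b) (hA : 0 < A)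
    (hΛ : 0 ≤ Λ) {m : ℕ} (hm : p ≤ m) (hm2 : 2 ≤ m) {φ τ σ : ℝ} (hφ : 0 ≤ φ) (hφ1 : φ ≤ 1)
    (hτ : 0 ≤ τ) (hσ : 0 ≤ σ) (h1 : b * min 1 τ ≤ σ) (h2 : σ ≤ A * (1 + τ)) (h3 : φ * τ ≤ Λ) :
    φ ^ (m - 1) * (σ ^ (p - 2) * τ) ≤
      max (Λ * (A * (1 + Λ)) ^ (p - 2)) (b ^ (p - 2) * (Λ + 1)) := by
  obtain ⟨k, rfl⟩ := Nat.exists_eq_add_of_le' hm2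
  have e1 : k + 2 - 1 = k + 1 := rfl
  rw [e1]
  push_cast at hm
  have hφk : φ ^ (k + 1) ≤ φ := by
    rw [pow_succ]
    have := pow_le_one₀ hφ hφ1 (n := k)
    nlinarith
  rcases le_total 2 p with h | h
  · refine le_trans ?_ (le_max_left _ _)
    have h4 : φ ^ k * σ ^ (p - 2) ≤ (A * (1 + Λ)) ^ (p - 2) := by
      calc φ ^ k * σ ^ (p - 2) ≤ φ ^ (p - 2) * σ ^ (p - 2) := by
            gcongr
            rw [← Real.rpow_natCast]
            rcases hφ.eq_or_lt with h0 | h0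
            · rw [← h0]
              rcases h.eq_or_lt with h' | h'
              · rw [← h', sub_self, Real.rpow_zero]
                rcases Nat.eq_zero_or_pos k with hk | hk
                · simp [hk]
                · rw [Real.zero_rpow (by positivity)]; norm_num
              · rw [Real.zero_rpow (by linarith)]; positivity
            · exact Real.rpow_le_rpow_of_exponent_ge h0 hφ1 (by linarith)
        _ = (φ * σ) ^ (p - 2) := (Real.mul_rpow hφ hσ).symm
        _ ≤ _ := by
            refine Real.rpow_le_rpow (by positivity) ?_ (by linarith)
            calc φ * σ ≤ φ * (A * (1 + τ)) := by gcongr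
              _ = A * (φ + φ * τ) := by ring
              _ ≤ _ := by gcongr
    calc φ ^ (k + 1) * (σ ^ (p - 2) * τ) = (φ * τ) * (φ ^ k * σ ^ (p - 2)) := by ring
      _ ≤ _ := by gcongr
  · refine le_trans ?_ (le_max_right _ _)
    have hbp : 0 < b ^ (p - 2) := by positivity
    have hφk0 : 0 ≤ φ ^ (k + 1) := by positivity
    rcases hτ.eq_or_lt with h0 | h0
    · rw [← h0]; simp only [mul_zero]; positivity
    have hmin : 0 < b * min 1 τ := by positivity
    have h4 := Real.rpow_le_rpow_of_nonpos hmin h1 (by linarith : p - 2 ≤ 0)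
    rw [Real.mul_rpow hb.le (by positivity)] at h4
    have h5 : σ ^ (p - 2) * τ ≤ b ^ (p - 2) * ((min 1 τ) ^ (p - 2) * τ) := by
      rw [← mul_assoc]; gcongr
    have h6 : (min 1 τ) ^ (p - 2) * τ ≤ τ + 1 := by
      rcases le_total 1 τ with h' | h'
      · rw [min_eq_left h', Real.one_rpow]; linarith
      · rw [min_eq_right h', ← Real.rpow_add_one h0.ne']
        have := Real.rpow_le_one hτ h' (by linarith : 0 ≤ p - 2 + 1)
        linarith
    calc φ ^ (k + 1) * (σ ^ (p - 2) * τ) ≤ φ ^ (k + 1) * (b ^ (p - 2) * (τ + 1)) :=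
          mul_le_mul_of_nonneg_left (h5.trans (mul_le_mul_of_nonneg_left h6 hbp.le)) hφk0
      _ ≤ φ * (b ^ (p - 2) * (τ + 1)) := by gcongr
      _ = b ^ (p - 2) * (φ * τ + φ) := by ring
      _ ≤ _ := by gcongr

theorem exists_absorption {p b A a₁ a₂ : ℝ} (hp : 1 < p) (hb : 0 < b) (hA : 0 < A)
    (ha₁ : 0 < a₁) (ha₂ : 0 ≤ a₂) {m : ℕ} (hm : p ≤ m) (hm2 : 2 ≤ m) :
    ∃ A' B : ℝ, 0 ≤ A' ∧ 0 ≤ B ∧ ∀ φ τ σ : ℝ, 0 ≤ φ → φ ≤ 1 → 0 ≤ τ → 0 ≤ σ →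
      b * min 1 τ ≤ σ → σ ≤ A * (1 + τ) →
      φ ^ m * τ ≤ A' * (a₁ * (φ ^ m * (σ ^ (p - 2) * τ ^ 2)) -
        a₂ * (φ ^ (m - 1) * (σ ^ (p - 2) * τ))) + B := by
  set Λ := max 1 (2 * a₂ / a₁) with hΛ
  have hΛ1 : 1 ≤ Λ := le_max_left _ _
  set N := max (Λ * (A * (1 + Λ)) ^ (p - 2)) (b ^ (p - 2) * (Λ + 1)) with hN
  have hN0 : 0 ≤ N := le_trans (by positivity) (le_max_left _ _)
  set k₀ := min (b ^ (p - 2)) ((2 * A) ^ (p - 2)) with hk₀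
  have hk0 : 0 < k₀ := lt_min (by positivity) (by positivity)
  refine ⟨2 / (a₁ * k₀), Λ + 2 / (a₁ * k₀) * (a₂ * N), by positivity, by positivity,
    fun φ τ σ hφ hφ1 hτ hσ h1 h2 => ?_⟩
  obtain ⟨k, rfl⟩ := Nat.exists_eq_add_of_le' hm2
  have e1 : k + 2 - 1 = k + 1 := rfl
  have hQ : 0 ≤ σ ^ (p - 2) * τ := by positivity
  rcases le_total Λ (φ * τ) with h | h
  · have hτ1 : 1 ≤ τ := by nlinarith
    rw [min_eq_left hτ1, mul_one] at h1
    have h3 := rpow_mul_ge_of_bounds hp hb hA hτ1 h1 (by nlinarith)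
    have h4 : 2 * a₂ ≤ a₁ * (φ * τ) := by
      have h5 := (le_max_right 1 (2 * a₂ / a₁)).trans h
      rw [div_le_iff₀ ha₁] at h5
      linarith
    have hX : 0 ≤ φ ^ (k + 1) * (σ ^ (p - 2) * τ) := by positivity
    have h5 : a₁ / 2 * (φ ^ (k + 2) * (σ ^ (p - 2) * τ ^ 2)) ≤
        a₁ * (φ ^ (k + 2) * (σ ^ (p - 2) * τ ^ 2)) -
        a₂ * (φ ^ (k + 1) * (σ ^ (p - 2) * τ)) := by
      have e : φ ^ (k + 2) * (σ ^ (p - 2) * τ ^ 2) =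
          φ ^ (k + 1) * (σ ^ (p - 2) * τ) * (φ * τ) := by ring
      rw [e]
      nlinarith
    have h6 : φ ^ (k + 2) * τ ≤
        2 / (a₁ * k₀) * (a₁ / 2 * (φ ^ (k + 2) * (σ ^ (p - 2) * τ ^ 2))) := by
      have e : 2 / (a₁ * k₀) * (a₁ / 2 * (φ ^ (k + 2) * (σ ^ (p - 2) * τ ^ 2))) =
          φ ^ (k + 2) * τ * (σ ^ (p - 2) * τ) / k₀ := by field_simp
      rw [e, le_div_iff₀ hk0]
      exact mul_le_mul_of_nonneg_left h3 (by positivity)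
    rw [e1]
    have h7 : 2 / (a₁ * k₀) * (a₁ / 2 * (φ ^ (k + 2) * (σ ^ (p - 2) * τ ^ 2))) ≤ _ :=
      mul_le_mul_of_nonneg_left h5 (by positivity)
    have h8 : 0 ≤ 2 / (a₁ * k₀) * (a₂ * N) := by positivity
    linarith
  · have h3 := pow_mul_rpow_le_of_bounds hp hb hA (by linarith : 0 ≤ Λ) hm hm2 hφ hφ1 hτ hσ h1 h2 h
    have h4 : φ ^ (k + 2) * τ ≤ φ * τ := by
      have : φ ^ (k + 2) ≤ φ := by
        rw [pow_succ]
        have := pow_le_one₀ hφ hφ1 (n := k + 1)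
        nlinarith
      gcongr
    have h5 : 0 ≤ a₁ * (φ ^ (k + 2) * (σ ^ (p - 2) * τ ^ 2)) := by positivity
    have h6 : -(a₂ * N) ≤ a₁ * (φ ^ (k + 2) * (σ ^ (p - 2) * τ ^ 2)) -
        a₂ * (φ ^ (k + 2 - 1) * (σ ^ (p - 2) * τ)) := by
      have := mul_le_mul_of_nonneg_left h3 ha₂
      linarith
    have h7 := mul_le_mul_of_nonneg_left h6 (by positivity : 0 ≤ 2 / (a₁ * k₀))
    linarith

theorem flux_identity {w : ℝ} (hw : w ≠ 0) (Θ q c₀ C₁ m a b W S t : ℝ) :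
    -(Θ * (q * c₀ * (a * (W * w * S * (t / w) ^ 2)) -
      C₁ * (2 * m) * (b * (W * w * S * (t / w))))) =
    Θ * W * (C₁ * (S * t) * (2 * m * b)) + a * (-(Θ * (q * (W / w))) * (c₀ * (S * t ^ 2))) := by
  field_simp
  ring

section DifferenceDeGiorgi

variable {E : Type*} [NormedAddCommGroup E] [InnerProductSpace ℝ E] [FiniteDimensional ℝ E]
  [MeasurableSpace E] [BorelSpace E]

set_option maxHeartbeats 1000000 in
/-- Caccioppoli inequality for the difference of a super- and a subsolution. -/
theorem LogSuper.deGiorgi_sub {p q b A : ℝ} (hp : 1 < p) (hq : 0 < q) (hb : 0 < b) (hA : 0 < A)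
    {m : ℕ} (hm : p ≤ m) (hm2 : 2 ≤ m) (M : ℝ) :
    ∃ C : ℝ, 0 < C ∧ ∀ (V F f : E → ℝ) (k : ℝ) (σ : E → ℝ), BddPot V (ball 0 1) →
      LogSuper p V (ball 0 1) F → LogSub p V (ball 0 1) f →
      (∀ x ∈ ball (0 : E) 1, |f x - f 0| ≤ M) → (∀ x ∈ ball (0 : E) 1, 0 < F x - f x + k) →
      (∀ x ∈ ball (0 : E) 1, 0 ≤ σ x ∧
        (F x - f x + k) ^ (1 - q) * (‖gradient F x‖ + ‖gradient f x‖) ^ (p - 2) = σ x ^ (p - 2) ∧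
        b * min 1 (‖gradient F x - gradient f x‖ / (F x - f x + k)) ≤ σ x ∧
        σ x ≤ A * (1 + ‖gradient F x - gradient f x‖ / (F x - f x + k))) →
      DeGiorgi m C fun x => F x - f x + k := by
  obtain ⟨C₁, hC₁, hup⟩ := exists_pflux_upper (E := E) hp
  obtain ⟨c₀, hc₀, hlo⟩ := exists_pflux_lower (E := E) hp
  obtain ⟨A', B, hA', hB, habs⟩ := exists_absorption hp hb hA (mul_pos hq hc₀)
    (by positivity : 0 ≤ C₁ * (2 * m)) hm hm2
  refine ⟨B * Real.exp (2 * (p * M)) + 1, by positivity,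
    fun V F f k σ hV hF hf hM hw hσ => ?_⟩
  set w : E → ℝ := fun x => F x - f x + k with hwdef
  have hwC : ContDiffOn ℝ 1 w (ball 0 1) := (hF.1.sub hf.1).add contDiffOn_const
  have hgw : ∀ x ∈ ball (0 : E) 1, HasGradientAt w (gradient F x - gradient f x) x :=
    fun x hx => by
      have h := ((hF.1.hasGradientAt isOpen_ball hx).sub'
        (hf.1.hasGradientAt isOpen_ball hx)).add' (hasGradientAt_const x k)
      simpa using h
  refine ⟨hwC, hw, fun Θ hΘ hΘa hΘ0 r hr0 hr => ?_⟩
  set Ψ : ℝ → ℝ := fun s => Θ s * s ^ (-q) with hΨ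
  have hrC : ContDiffOn ℝ 1 (fun s : ℝ => s ^ (-q)) (Ioi 0) := fun s hs =>
    (Real.contDiffAt_rpow_const_of_ne (ne_of_gt hs)).contDiffWithinAt
  have hΨC : ContDiffOn ℝ 1 Ψ (Ioi 0) := hΘ.mul hrC
  have hcut : TestFun (ball (0:E) 1) (fun x => cut r x ^ m) :=
    testFun_cut_pow hr0.le (closedBall_subset_ball hr) hm2
  have hη : TestFun (ball (0:E) 1) (fun x => Ψ (w x) * cut r x ^ m) :=
    hcut.mul_left isOpen_ball (hΨC.comp hwC hw)
  have hη0 : ∀ x, 0 ≤ Ψ (w x) * cut r x ^ m := fun x => by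
    by_cases hx : x ∈ ball (0:E) 1
    · exact mul_nonneg (mul_nonneg (hΘ0 _ (hw x hx)) (Real.rpow_nonneg (hw x hx).le _))
        (pow_nonneg (cut_nonneg _ _) _)
    · rw [cut_eq_zero hr0.le fun h => hx (ball_subset_ball hr.le h), zero_pow (by omega), mul_zero]
  have hpair := pair_ineq hp isOpen_ball hV hF hf hη hη0
  have hpos : 0 ≤ ∫ x, Real.exp (p * f x) * (pexcess p (gradient F x) (gradient f x) *
      (Ψ (w x) * cut r x ^ m)) := integral_nonneg fun x =>
    mul_nonneg (Real.exp_pos _).le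
      (mul_nonneg (pexcess_nonneg_and_eq hp _ _).1 (hη0 x))
  have hG := hpos.trans hpair
  have hexp : ContDiffOn ℝ 1 (fun x => Real.exp (p * f x)) (ball 0 1) :=
    (contDiffOn_const.mul hf.1).exp
  have hcP : ContinuousOn (fun x => Real.exp (p * f x) •
      (pflux p (gradient F x) - pflux p (gradient f x))) (ball 0 1) :=
    hexp.continuousOn.smul ((continuousOn_pflux_gradient hp isOpen_ball hF.1).sub
      (continuousOn_pflux_gradient hp isOpen_ball hf.1))
  have iG : Integrable fun x => Real.exp (p * f x) *
      ⟪pflux p (gradient F x) - pflux p (gradient f x),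
        gradient (fun x => Ψ (w x) * cut r x ^ m) x⟫ :=
    (hη.integrable_inner hcP).congr (ae_of_all _ fun x => by
      simp only [real_inner_smul_left])
  have hΘw : ContinuousOn (fun x => Θ (w x)) (ball 0 1) :=
    hΘ.continuousOn.comp hwC.continuousOn hw
  have i1 : Integrable fun x => cut r x ^ m * (‖gradient w x‖ / w x * Θ (w x)) :=
    (hcut.integrable_mul ((((hwC.continuousOn_gradient isOpen_ball).norm).div hwC.continuousOn
      fun x hx => (hw x hx).ne').mul hΘw)).congr (ae_of_all _ fun x => mul_comm _ _)
  have i2 : IntegrableOn (fun x => Θ (w x)) (ball 0 r) :=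
    ((hΘw.mono (closedBall_subset_ball hr)).integrableOn_compact
      (isCompact_closedBall _ _)).mono_set ball_subset_closedBall
  have i3 : Integrable ((ball (0:E) r).indicator fun x => Θ (w x)) :=
    i2.integrable_indicator measurableSet_ball
  set e₁ := Real.exp (p * (f 0 - M)) with he₁
  set e₂ := Real.exp (p * (f 0 + M)) with he₂
  have key : ∫ x, (e₁ * (cut r x ^ m * (‖gradient w x‖ / w x * Θ (w x))) +
      A' * (Real.exp (p * f x) * ⟪pflux p (gradient F x) - pflux p (gradient f x),
        gradient (fun x => Ψ (w x) * cut r x ^ m) x⟫)) ≤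
      ∫ x, B * e₂ * (ball (0:E) r).indicator (fun x => Θ (w x)) x := by
    refine integral_mono ((i1.const_mul e₁).add (iG.const_mul A')) (i3.const_mul _) fun x => ?_
    dsimp only
    by_cases hx : x ∈ ball (0:E) r
    swap
    · have hc0 := cut_eq_zero hr0.le hx
      have hg0 : ⟪pflux p (gradient F x) - pflux p (gradient f x),
          gradient (fun x => Ψ (w x) * cut r x ^ m) x⟫ = 0 := by
        by_cases hx1 : x ∈ ball (0:E) 1
        · have h1 := (hΨC.contDiffAt (Ioi_mem_nhds (hw x hx1))).differentiableAt
            (by norm_num) |>.hasDerivAt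
          rw [((HasGradientAt.comp_real (f := w) h1 (hgw x hx1)).mul'
            ((contDiff_cut_pow (E := E) r hm2).hasGradientAt' x)).gradient,
            gradient_cut_pow r hm2, hc0]
          simp [zero_pow (by omega : m ≠ 0), zero_pow (by omega : m - 1 ≠ 0)]
        · rw [hη.gradient_eq_zero hx1, inner_zero_right]
      rw [indicator_of_notMem hx, hg0, hc0, zero_pow (by omega)]
      simp
    rw [indicator_of_mem hx]
    have hx1 : x ∈ ball (0:E) 1 := ball_subset_ball hr.le hx
    have hwx := hw x hx1
    obtain ⟨hσ0, hσe, hσ1, hσ2⟩ := hσ x hx1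
    change w x ^ (1 - q) * _ = _ at hσe
    change b * min 1 (_ / w x) ≤ _ at hσ1
    change _ ≤ A * (1 + _ / w x) at hσ2
    set P := pflux p (gradient F x) - pflux p (gradient f x) with hP
    set S := ‖gradient F x‖ + ‖gradient f x‖ with hS
    have hgx : gradient w x = gradient F x - gradient f x := (hgw x hx1).gradient
    set t := ‖gradient F x - gradient f x‖ with ht
    have ht0 : 0 ≤ t := norm_nonneg _
    have hτ0 : 0 ≤ t / w x := by positivity
    have hc0 := cut_nonneg r x
    have hab := habs (cut r x) (t / w x) (σ x) hc0 (cut_le_one hr0.le hr.le x) hτ0 hσ0 hσ1 hσ2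
    have hd1 : DifferentiableAt ℝ Θ (w x) :=
      (hΘ.contDiffAt (Ioi_mem_nhds hwx)).differentiableAt (by norm_num)
    have hd2 : HasDerivAt (fun s : ℝ => s ^ (-q)) (-q * w x ^ (-q - 1)) (w x) :=
      Real.hasDerivAt_rpow_const (Or.inl hwx.ne')
    have hd : HasDerivAt Ψ (deriv Θ (w x) * w x ^ (-q) + Θ (w x) * (-q * w x ^ (-q - 1))) (w x) :=
      hd1.hasDerivAt.mul hd2
    have hΘd : deriv Θ (w x) ≤ 0 := by
      have := hΘa.derivWithin_nonpos (x := w x)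
      rwa [derivWithin_of_isOpen isOpen_Ioi hwx] at this
    have hgη := ((HasGradientAt.comp_real (f := w) hd (hgw x hx1)).mul'
            ((contDiff_cut_pow (E := E) r hm2).hasGradientAt' x)).gradient
    have hPw : c₀ * (S ^ (p - 2) * t ^ 2) ≤ ⟪P, gradient F x - gradient f x⟫ := hlo _ _
    have hPn : ‖P‖ ≤ C₁ * (S ^ (p - 2) * t) := hup _ _
    have hPφ : ⟪P, gradient (fun x => cut r x ^ m) x⟫ ≤
        C₁ * (S ^ (p - 2) * t) * (2 * m * cut r x ^ (m - 1)) :=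
      (real_inner_le_norm _ _).trans (mul_le_mul hPn
        (norm_gradient_cut_pow_le hr0.le hr.le hm2 x) (norm_nonneg _) (by positivity))
    have hΘx := hΘ0 _ hwx
    have hin : ⟪P, gradient (fun x => Ψ (w x) * cut r x ^ m) x⟫ ≤
        -(Θ (w x) * (q * c₀ * (cut r x ^ m * (σ x ^ (p - 2) * (t / w x) ^ 2)) -
          C₁ * (2 * m) * (cut r x ^ (m - 1) * (σ x ^ (p - 2) * (t / w x))))) := by
      have e0 : w x ^ (1 - q) = w x ^ (-q) * w x := by
        rw [← Real.rpow_add_one hwx.ne']; congr 1; ring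
      have e2 : w x ^ (-q - 1) = w x ^ (-q) / w x := Real.rpow_sub_one hwx.ne' _
      rw [hgη, inner_add_right, real_inner_smul_right, real_inner_smul_right,
        real_inner_smul_right, ← hσe, e0]
      rw [e2]
      have hwq : 0 < w x ^ (-q) := by positivity
      have h1 : 0 ≤ ⟪P, gradient F x - gradient f x⟫ := le_trans (by positivity) hPw
      have h2 : Ψ (w x) * ⟪P, gradient (fun x => cut r x ^ m) x⟫ ≤
          Θ (w x) * w x ^ (-q) * (C₁ * (S ^ (p - 2) * t) * (2 * m * cut r x ^ (m - 1))) :=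
        mul_le_mul_of_nonneg_left hPφ (by positivity)
      have h3 : (deriv Θ (w x) * w x ^ (-q) + Θ (w x) * (-q * (w x ^ (-q) / w x))) *
          ⟪P, gradient F x - gradient f x⟫ ≤
          -(Θ (w x) * (q * (w x ^ (-q) / w x))) * (c₀ * (S ^ (p - 2) * t ^ 2)) := by
        have h4 : deriv Θ (w x) * w x ^ (-q) * ⟪P, gradient F x - gradient f x⟫ ≤ 0 :=
          mul_nonpos_of_nonpos_of_nonneg (mul_nonpos_of_nonpos_of_nonneg hΘd hwq.le) h1
        have h5 : Θ (w x) * (q * (w x ^ (-q) / w x)) * (c₀ * (S ^ (p - 2) * t ^ 2)) ≤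
            Θ (w x) * (q * (w x ^ (-q) / w x)) * ⟪P, gradient F x - gradient f x⟫ :=
          mul_le_mul_of_nonneg_left hPw (by positivity)
        linarith
      have h6 := mul_le_mul_of_nonneg_left h3 (pow_nonneg hc0 m)
      have e3 : -(Θ (w x) * (q * c₀ * (cut r x ^ m * (w x ^ (-q) * w x * S ^ (p - 2) *
          (t / w x) ^ 2)) - C₁ * (2 * m) * (cut r x ^ (m - 1) * (w x ^ (-q) * w x * S ^ (p - 2) *
          (t / w x))))) = Θ (w x) * w x ^ (-q) * (C₁ * (S ^ (p - 2) * t) *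
          (2 * m * cut r x ^ (m - 1))) + cut r x ^ m * (-(Θ (w x) * (q * (w x ^ (-q) / w x))) *
          (c₀ * (S ^ (p - 2) * t ^ 2))) := by
        exact flux_identity hwx.ne' _ _ _ _ _ _ _ _ _ _
      rw [e3]
      linarith
    have hfx := abs_le.1 (hM x hx1)
    have hE1 : e₁ ≤ Real.exp (p * f x) := Real.exp_le_exp.2 (by nlinarith [hfx.1])
    have hE2 : Real.exp (p * f x) ≤ e₂ := Real.exp_le_exp.2 (by nlinarith [hfx.2])
    rw [hgx]
    have hX : 0 ≤ cut r x ^ m * (t / w x * Θ (w x)) := by positivity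
    have h1 : e₁ * (cut r x ^ m * (t / w x * Θ (w x))) ≤
        Real.exp (p * f x) * (cut r x ^ m * (t / w x * Θ (w x))) := by gcongr
    have h2 := mul_le_mul_of_nonneg_left hab (mul_nonneg (Real.exp_pos (p * f x)).le hΘx)
    have h3 := mul_le_mul_of_nonneg_left hin (mul_nonneg hA' (Real.exp_pos (p * f x)).le)
    have h4 : Real.exp (p * f x) * (B * Θ (w x)) ≤ e₂ * (B * Θ (w x)) := by gcongr
    linarith
  rw [integral_add (i1.const_mul e₁) (iG.const_mul A'), integral_const_mul, integral_const_mul,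
    integral_const_mul, integral_indicator measurableSet_ball] at key
  have hI0 : 0 ≤ ∫ x in ball (0:E) r, Θ (w x) :=
    setIntegral_nonneg measurableSet_ball fun x hx =>
      hΘ0 _ (hw x (ball_subset_ball hr.le hx))
  have hkey2 : e₁ * ∫ x, cut r x ^ m * (‖gradient w x‖ / w x * Θ (w x)) ≤
      B * e₂ * ∫ x in ball (0:E) r, Θ (w x) := by
    have := mul_nonneg hA' hG
    linarith
  have he : e₂ = e₁ * Real.exp (2 * (p * M)) := by
    rw [he₁, he₂, ← Real.exp_add]; congr 1; ring
  have h5 : e₁ * ∫ x, cut r x ^ m * (‖gradient w x‖ / w x * Θ (w x)) ≤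
      e₁ * (B * Real.exp (2 * (p * M)) * ∫ x in ball (0:E) r, Θ (w x)) := by
    rw [he] at hkey2; linarith
  have h6 := le_of_mul_le_mul_left h5 (Real.exp_pos _)
  linarith

end DifferenceDeGiorgi

section DifferenceChain

variable {E : Type*} [NormedAddCommGroup E] [InnerProductSpace ℝ E] [FiniteDimensional ℝ E]
  [MeasurableSpace E] [BorelSpace E]

/-- Where one of the gradients is bounded above and below, bounded positive differences satisfy the
De Giorgi inequality. -/
theorem LogSuper.deGiorgi_sub_of_gradient_ge {p c L K : ℝ} (hp : 1 < p) (hc : 0 < c) (hL : 0 < L)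
    (hK : 0 < K) {m : ℕ} (hm : p ≤ m) (hm2 : 2 ≤ m) (M : ℝ) :
    ∃ C : ℝ, 0 < C ∧ ∀ (V F f : E → ℝ) (k : ℝ), BddPot V (ball 0 1) →
      LogSuper p V (ball 0 1) F → LogSub p V (ball 0 1) f →
      (∀ x ∈ ball (0 : E) 1, |f x - f 0| ≤ M) →
      (∀ x ∈ ball (0 : E) 1, 0 < F x - f x + k ∧ F x - f x + k ≤ K) →
      (∀ x ∈ ball (0 : E) 1, (c ≤ ‖gradient F x‖ ∧ ‖gradient F x‖ ≤ L) ∨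
        (c ≤ ‖gradient f x‖ ∧ ‖gradient f x‖ ≤ L)) →
      DeGiorgi m C fun x => F x - f x + k := by
  obtain ⟨C, hC, H⟩ := LogSuper.deGiorgi_sub (E := E) (q := 1) (b := c) (A := 2 * L + K) hp
    one_pos hc (by positivity) hm hm2 M
  refine ⟨C, hC, fun V F f k hV hF hf hM hw hg => H V F f k
    (fun x => ‖gradient F x‖ + ‖gradient f x‖) hV hF hf hM (fun x hx => (hw x hx).1)
    fun x hx => ⟨by positivity, by simp, ?_, ?_⟩⟩
  · have h1 : c * min 1 (‖gradient F x - gradient f x‖ / (F x - f x + k)) ≤ c * 1 :=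
      mul_le_mul_of_nonneg_left (min_le_left _ _) hc.le
    have := norm_nonneg (gradient F x)
    have := norm_nonneg (gradient f x)
    rcases hg x hx with h | h <;> linarith [h.1]
  · obtain ⟨hw0, hwK⟩ := hw x hx
    set w := F x - f x + k
    set t := ‖gradient F x - gradient f x‖ with ht
    have ht0 : 0 ≤ t := norm_nonneg _
    have e : t = t / w * w := by field_simp
    have h1 : t ≤ t / w * K := by
      calc t = t / w * w := e
        _ ≤ _ := by gcongr
    have hτ : 0 ≤ t / w := by positivity
    have h2 : ‖gradient F x‖ ≤ ‖gradient f x‖ + t := by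
      have := norm_add_le (gradient f x) (gradient F x - gradient f x)
      simpa using this
    have h3 : ‖gradient f x‖ ≤ ‖gradient F x‖ + t := by
      have := norm_sub_le (gradient F x) (gradient F x - gradient f x)
      simpa using this
    have h4 : ‖gradient F x‖ + ‖gradient f x‖ ≤ 2 * L + t := by
      rcases hg x hx with h | h <;> linarith [h.2]
    nlinarith

/-- Where one of the gradients is at most `k`, nonnegative differences shifted by `k` satisfy the
De Giorgi inequality. -/
theorem LogSuper.deGiorgi_sub_of_gradient_le {p : ℝ} (hp : 1 < p) {m : ℕ} (hm : p ≤ m)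
    (hm2 : 2 ≤ m) (M : ℝ) :
    ∃ C : ℝ, 0 < C ∧ ∀ (V F f : E → ℝ) (l k : ℝ), 0 < k → BddPot V (ball 0 1) →
      LogSuper p V (ball 0 1) F → LogSub p V (ball 0 1) f →
      (∀ x ∈ ball (0 : E) 1, |f x - f 0| ≤ M) →
      (∀ x ∈ ball (0 : E) 1, k ≤ F x - f x + l) →
      (∀ x ∈ ball (0 : E) 1, ‖gradient F x‖ ≤ k ∨ ‖gradient f x‖ ≤ k) →
      DeGiorgi m C fun x => F x - f x + l := by
  obtain ⟨C, hC, H⟩ := LogSuper.deGiorgi_sub (E := E) (q := p - 1) (b := 1) (A := 2) hp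
    (by linarith) one_pos two_pos hm hm2 M
  refine ⟨C, hC, fun V F f l k hk hV hF hf hM hw hg => H V F f l
    (fun x => (‖gradient F x‖ + ‖gradient f x‖) / (F x - f x + l)) hV hF hf hM
    (fun x hx => hk.trans_le (hw x hx)) fun x hx => ?_⟩
  have hwk := hw x hx
  have hw0 : 0 < F x - f x + l := hk.trans_le hwk
  set w := F x - f x + l
  set t := ‖gradient F x - gradient f x‖ with ht
  have ht0 : 0 ≤ t := norm_nonneg _
  refine ⟨by positivity, ?_, ?_, ?_⟩
  · have e : 1 - (p - 1) = -(p - 2) := by ring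
    rw [Real.div_rpow (by positivity) hw0.le, e, Real.rpow_neg hw0.le]
    field_simp
  · rw [one_mul]
    exact (min_le_right _ _).trans (div_le_div_of_nonneg_right (norm_sub_le _ _) hw0.le)
  · have h2 : ‖gradient F x‖ ≤ ‖gradient f x‖ + t := by
      have := norm_add_le (gradient f x) (gradient F x - gradient f x)
      simpa using this
    have h3 : ‖gradient f x‖ ≤ ‖gradient F x‖ + t := by
      have := norm_sub_le (gradient F x) (gradient F x - gradient f x)
      simpa using this
    have h4 : ‖gradient F x‖ + ‖gradient f x‖ ≤ 2 * w + t := by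
      rcases hg x hx with h | h <;> linarith
    rw [div_le_iff₀ hw0]
    have e : 2 * (1 + t / w) * w = 2 * w + 2 * t := by field_simp
    rw [e]; linarith

/-- Two functions satisfying the De Giorgi inequality near a sphere that are both small somewhere
on the sphere are simultaneously small at some point near the sphere. -/
theorem DeGiorgi.exists_both_lt (hn : 2 ≤ Module.finrank ℝ E) (C : ℝ) (m : ℕ) (hC : 0 ≤ C)
    (hm : 2 ≤ m) (N : ℕ) : ∃ c : ℝ, 0 < c ∧ ∀ (u₁ u₂ : E → ℝ) (r R : ℝ), 0 < R →
      2 * r < √2 ^ N * (R / 4) →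
      (∀ z, |‖z‖ - r| < R / 4 →
        DeGiorgi m C (fun y => u₁ (simil z R (LinearIsometryEquiv.refl ℝ E) y)) ∧
        DeGiorgi m C (fun y => u₂ (simil z R (LinearIsometryEquiv.refl ℝ E) y))) →
      ∀ x₁ x₂ : E, ‖x₁‖ = r → ‖x₂‖ = r → ∀ δ > 0, u₁ x₁ < c * δ → u₂ x₂ < c * δ →
      ∃ y, |‖y‖ - r| < R / 4 ∧ u₁ y < δ ∧ u₂ y < δ := by
  set v := volume.real (ball (0 : E) (1 / 4)) with hv
  have hv0 : 0 < v := volume_real_ball_pos _ (by norm_num)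
  obtain ⟨c, hc, H⟩ := DeGiorgi.lower_bound (E := E) hn C (v / 2) m hC hm (by positivity)
  refine ⟨c * c ^ 2 ^ N, by positivity, fun u₁ u₂ r R hR hN hu x₁ x₂ hx₁ hx₂ δ hδ h₁ h₂ => ?_⟩
  have hfin : ∀ (x : E) (s : ℝ) (P : E → Prop), volume {z ∈ ball x s | P z} ≠ ⊤ := fun x s P =>
    ne_top_of_le_ne_top measure_ball_lt_top.ne (measure_mono fun z hz => hz.1)
  have hRn : 0 < R ^ Module.finrank ℝ E := by positivity
  have hvol : ∀ x : E, volume.real (ball x (R / 4)) = R ^ Module.finrank ℝ E * v := fun x => by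
    rw [volume_real_preimage_simil x hR, hv]
    congr 2
    ext y
    have := simil_mem_ball (x₀ := x) hR (LinearIsometryEquiv.refl ℝ E) (y := y) (r := 1 / 4)
    rw [← this, mem_preimage]
    congr! 2
    ring
  have hnear : ∀ x z : E, ‖x‖ = r → z ∈ ball x (R / 4) → |‖z‖ - r| < R / 4 := fun x z hx hz => by
    rw [← hx]
    exact (abs_norm_sub_norm_le z x).trans_lt (by rwa [mem_ball, dist_eq_norm] at hz)
  have hsmall : ∀ u : E → ℝ, (∀ z, |‖z‖ - r| < R / 4 →
      DeGiorgi m C (fun y => u (simil z R (LinearIsometryEquiv.refl ℝ E) y))) →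
      ∀ z, |‖z‖ - r| < R / 4 → ∀ δ > 0, u z < c * δ → ∀ x, ball x (R / 4) ⊆ ball z (R * (3 / 4)) →
      volume.real {y ∈ ball x (R / 4) | δ ≤ u y} < R ^ Module.finrank ℝ E * (v / 2) := by
    intro u hu z hz δ hδ huz x hsub
    by_contra! hcon
    have h1 : volume.real {y ∈ ball x (R / 4) | δ ≤ u y} ≤
        volume.real {y ∈ ball z (R * (3 / 4)) | δ ≤ u y} :=
      measureReal_mono (fun y hy => ⟨hsub hy.1, hy.2⟩) (hfin _ _ _)
    have h2 := hcon.trans h1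
    rw [volume_real_preimage_simil z hR] at h2
    have h3 := le_of_mul_le_mul_left h2 hRn
    have h4 := H _ (hu z hz) δ hδ (h3.trans (le_of_eq (by
      congr 1
      ext y
      exact and_congr_left fun _ => simil_mem_ball hR _)))
    simp only [simil_refl_apply, smul_zero, add_zero] at h4
    linarith
  have hprop : ∀ u : E → ℝ, (∀ z, |‖z‖ - r| < R / 4 →
      DeGiorgi m C (fun y => u (simil z R (LinearIsometryEquiv.refl ℝ E) y))) →
      ∀ x y : E, ‖x‖ = r → ‖y‖ = r → u x < c * c ^ 2 ^ N * δ →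
      volume.real {z ∈ ball y (R / 4) | δ ≤ u z} < R ^ Module.finrank ℝ E * (v / 2) := by
    intro u hu x y hx hy hux
    have hstart := hsmall u hu x (by rw [hx]; simpa using hR) (c ^ 2 ^ N * δ) (by positivity)
      (by rwa [← mul_assoc]) x (ball_subset_ball (by linarith))
    refine sphere_chain hn (r := r) (s := R / 4) (fun j x y => ∀ δ > 0,
      volume.real {z ∈ ball x (R / 4) | c ^ 2 ^ j * δ ≤ u z} < R ^ Module.finrank ℝ E * (v / 2) →
      volume.real {z ∈ ball y (R / 4) | δ ≤ u z} < R ^ Module.finrank ℝ E * (v / 2))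
      (fun a b ha hb hab δ hδ h => ?_) (fun j a m b _ _ _ h1 h2 δ hδ h => ?_) N x y hx hy ?_ δ hδ
      hstart
    · obtain ⟨z, hz, huz⟩ : ∃ z ∈ ball a (R / 4), u z < c * δ := by
        by_contra! hcon
        have e : {z ∈ ball a (R / 4) | c ^ 2 ^ 0 * δ ≤ u z} = ball a (R / 4) := by
          ext z
          refine ⟨fun hz => hz.1, fun hz => ⟨hz, ?_⟩⟩
          simpa using hcon z hz
        rw [e, hvol] at h
        nlinarith
      refine hsmall u hu z (hnear a z ha hz) δ hδ huz b fun w hw => ?_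
      rw [mem_ball] at hz hw ⊢
      have h1 := dist_triangle w b z
      have h2 := dist_triangle b a z
      rw [← dist_eq_norm, dist_comm] at hab
      rw [dist_comm] at hz
      linarith
    · refine h2 δ hδ (h1 _ (by positivity) ?_)
      rwa [← mul_assoc, ← pow_add, ← two_mul, ← pow_succ']
    · have := norm_sub_le x y
      rw [hx, hy] at this
      linarith
  have hA := hprop u₁ (fun z hz => (hu z hz).1) x₁ x₁ hx₁ hx₁ h₁
  have hB := hprop u₂ (fun z hz => (hu z hz).2) x₂ x₁ hx₂ hx₁ h₂
  by_contra! hcon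
  have hsub : ball x₁ (R / 4) ⊆ {z ∈ ball x₁ (R / 4) | δ ≤ u₁ z} ∪
      {z ∈ ball x₁ (R / 4) | δ ≤ u₂ z} := fun z hz => by
    by_cases h : u₁ z < δ
    · exact Or.inr ⟨hz, hcon z (hnear x₁ z hx₁ hz) h⟩
    · exact Or.inl ⟨hz, not_lt.1 h⟩
  have h5 := (measureReal_mono hsub (measure_union_lt_top (hfin _ _ _).lt_top
    (hfin _ _ _).lt_top).ne).trans (measureReal_union_le _ _)
  rw [hvol] at h5
  linarith

end DifferenceChain

section RadialBracket

theorem pflux_real_of_pos {q y : ℝ} (hy : 0 < y) : pflux q y = y ^ (q - 1) := by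
  rw [pflux, Real.norm_of_nonneg hy.le, smul_eq_mul, ← Real.rpow_add_one hy.ne']
  congr 1; ring

theorem pflux_pflux_conjugate {p : ℝ} (hp : 1 < p) (y : ℝ) :
    pflux p (pflux (p / (p - 1)) y) = y := by
  have hp' : 0 < p - 1 := by linarith
  rcases eq_or_ne y 0 with rfl | hy
  · simp [pflux]
  have hy' : 0 < |y| := abs_pos.2 hy
  have e : ((p / (p - 1) - 1) * (p - 2)) + (p / (p - 1) - 2) = 0 := by
    field_simp; ring
  have hq : 1 < p / (p - 1) := by rw [lt_div_iff₀ hp']; linarith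
  rw [pflux, norm_pflux hq, pflux, smul_eq_mul, smul_eq_mul, Real.norm_eq_abs, ← Real.rpow_mul hy'.le,
    ← mul_assoc, ← Real.rpow_add hy', e, Real.rpow_zero, one_mul]

/-- The nonlinearity of the radial logarithmic equation, frozen outside a compact interval. -/
theorem exists_lipschitz_riccati (n : ℝ) {p q : ℝ} (hq : 1 < q) {R : ℝ} (hR : 0 ≤ R) :
    ∃ (Φ : ℝ → ℝ) (K : NNReal) (N : ℝ), 0 ≤ N ∧ LipschitzWith K Φ ∧ (∀ y, |Φ y| ≤ N) ∧
      ∀ y, |y| ≤ R → Φ y = (n - p) * y + (p - 1) * |y| ^ q := by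
  have hle : -R ≤ R := by linarith
  set F : ℝ → ℝ := fun y => (n - p) * y + (p - 1) * |y| ^ q with hF
  have hFd : ContDiff ℝ 1 F := by
    refine (contDiff_const.mul contDiff_id).add (contDiff_const.mul ?_)
    exact contDiff_norm_rpow (E := ℝ) hq
  obtain ⟨K, hK⟩ := (hFd.locallyLipschitz.locallyLipschitzOn (s := Icc (-R) R)).exists_lipschitzOnWith_of_compact
    isCompact_Icc
  obtain ⟨N, hN⟩ := isCompact_Icc.exists_bound_of_continuousOn (s := Icc (-R) R)
    hFd.continuous.continuousOn
  refine ⟨fun y => F (projIcc (-R) R hle y), K, N, (norm_nonneg _).trans (hN 0 ⟨by linarith, hR⟩), ?_,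
    fun y => hN _ (projIcc (-R) R hle y).2, fun y hy => ?_⟩
  · have h2 := (lipschitzOnWith_iff_restrict.1 hK).comp (LipschitzWith.projIcc hle)
    rwa [mul_one] at h2
  · simp only
    rw [projIcc_of_mem hle (abs_le.1 hy)]

variable {E : Type*} [NormedAddCommGroup E] [InnerProductSpace ℝ E] [FiniteDimensional ℝ E]
  [MeasurableSpace E] [BorelSpace E]

set_option maxHeartbeats 1000000 in
/-- A solution on an annulus of small oscillation is bracketed by radial solutions, with a slope
that is bounded and equicontinuous. -/
theorem LogSol.exists_radial_bracket {p : ℝ} (hp : 1 < p) (hn : 2 ≤ Module.finrank ℝ E) (C₀ : ℝ)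
    (hC₀ : 0 ≤ C₀) : ∃ (τ Λ : ℝ) (ω : ℝ → ℝ), 0 < τ ∧ τ ≤ 1 / 16 ∧ 0 < Λ ∧ (∀ e, 0 < e → 0 < ω e) ∧
      ∀ (V f : E → ℝ) (K : ℝ), FuchsPot p C₀ V → LogSol p V (ann 0 4) f →
        (∀ t, |t| ≤ 1 / 2 → sphOsc f (Real.exp t) ≤ K) →
        ∃ g Γ : ℝ → ℝ, (∀ t, |g t| ≤ Λ) ∧
          (∀ e, 0 < e → ∀ s t, |s - t| < ω e → |g s - g t| < e) ∧
          (∀ t, HasDerivAt Γ (g t) t) ∧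
          LogSol p V (ann (Real.exp (-(2 * τ))) (Real.exp (2 * τ))) (fun x => Γ (Real.log ‖x‖)) ∧
          ∀ x : E, Real.exp (-τ) ≤ ‖x‖ → ‖x‖ ≤ Real.exp τ →
            Γ (Real.log ‖x‖) ≤ f x ∧ f x ≤ Γ (Real.log ‖x‖) + K := by
  have : Nontrivial E := Module.nontrivial_of_finrank_pos (R := ℝ) (by omega)
  have hp' : 0 < p - 1 := by linarith
  obtain ⟨μ, hμ, hmin⟩ := LogSol.sphMin_lipschitz (E := E) hp hn C₀ hC₀
  have hμ0 : 0 < μ := by linarith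
  set q := p / (p - 1) with hqdef
  have hq : 1 < q := by rw [hqdef, lt_div_iff₀ hp']; linarith
  have hq1 : q - 1 = (p - 1)⁻¹ := by rw [hqdef]; field_simp; ring
  set Y := 2 * μ ^ (p - 1) with hYdef
  have hY : 0 < Y := by positivity
  obtain ⟨Φ, K₀, N, hN0, hΦ, hN, hΦe⟩ :=
    exists_lipschitz_riccati (Module.finrank ℝ E : ℝ) (p := p) hq (R := 3 / 2 * Y) (by positivity)
  set γ : ℝ → ℝ := fun y => pflux q y with hγdef
  have hγc : Continuous γ := continuous_pflux hq
  have hγ1 : ∀ y, Y / 2 ≤ y → μ ≤ γ y := by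
    intro y hy
    have h1 : μ ^ (p - 1) ≤ y := by rw [hYdef] at hy; linarith
    have h2 := Real.rpow_le_rpow (by positivity) h1 (inv_pos.2 hp').le
    rw [Real.rpow_rpow_inv hμ0.le hp'.ne'] at h2
    rw [hγdef]; simp only
    rw [pflux_real_of_pos (by linarith), hq1]
    exact h2
  have hγ2 : ∀ y, y ≤ -(Y / 2) → γ y ≤ -μ := by
    intro y hy
    have := hγ1 (-y) (by linarith)
    have e : γ (-y) = - γ y := pflux_neg q y
    linarith
  set τ := min (1 / 2048) (Y / 2 / (N + C₀ + 1) / 2) with hτdef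
  have hτ : 0 < τ := by positivity
  have hτ1 : τ ≤ 1 / 2048 := min_le_left _ _
  have hτ2 : (N + C₀) * (2 * τ) ≤ Y / 2 := by
    have h : τ ≤ Y / 2 / (N + C₀ + 1) / 2 := min_le_right _ _
    have h3 : 2 * τ ≤ Y / 2 / (N + C₀ + 1) := by linarith
    rw [le_div_iff₀ (by positivity)] at h3
    nlinarith
  obtain ⟨Λ, hΛ⟩ := isCompact_Icc.exists_bound_of_continuousOn (s := Icc (-(3 / 2 * Y)) (3 / 2 * Y))
    hγc.continuousOn
  have huc := isCompact_Icc.uniformContinuousOn_of_continuous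
    (s := Icc (-(3 / 2 * Y)) (3 / 2 * Y)) hγc.continuousOn
  rw [Metric.uniformContinuousOn_iff] at huc
  have hω : ∀ e : ℝ, ∃ w : ℝ, 0 < e → 0 < w ∧ ∀ y : ℝ → ℝ, LipschitzWith (N + C₀).toNNReal y →
      (∀ t, |y t| ≤ 3 / 2 * Y) → ∀ s t, |s - t| < w → |γ (y s) - γ (y t)| < e := by
    intro e
    by_cases he : 0 < e
    · obtain ⟨δ, hδ, h⟩ := huc e he
      refine ⟨δ / (N + C₀ + 1), fun _ => ⟨by positivity, fun y hy hyb s t hst => ?_⟩⟩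
      refine h (y s) (abs_le.1 (hyb s)) (y t) (abs_le.1 (hyb t)) ?_
      rw [lt_div_iff₀ (by positivity)] at hst
      have h1 := hy.dist_le_mul s t
      rw [Real.coe_toNNReal _ (by positivity), Real.dist_eq s t] at h1
      nlinarith [abs_nonneg (s - t)]
    · exact ⟨0, fun h => absurd h he⟩
  choose ω hω using hω
  refine ⟨τ, Λ ⊔ 1, ω, hτ, by linarith, by positivity, fun e he => (hω e he).1, ?_⟩
  intro V f K hV hf hK
  obtain ⟨e₀, he₀⟩ := exists_norm_eq E (zero_le_one' ℝ)
  set U : ℝ → ℝ := fun t => Real.exp t ^ p * V (Real.exp t • e₀) with hU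
  have hUn : ∀ t, ‖Real.exp t • e₀‖ = Real.exp t := fun t => by
    rw [norm_smul, he₀, mul_one, Real.norm_of_nonneg (Real.exp_pos t).le]
  have hUm : Measurable U := by
    have h1 : Measurable fun t : ℝ => V (Real.exp t • e₀) :=
      hV.meas.comp (by fun_prop : Continuous fun t : ℝ => Real.exp t • e₀).measurable
    exact (Real.measurable_exp.pow_const p).mul h1
  have hUb : ∀ t, |U t| ≤ C₀ := fun t => by
    have := hV.bound (Real.exp t • e₀)
    rw [hUn] at this
    rw [hU]; simp only
    rwa [abs_mul, abs_of_pos (by positivity)]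
  have hUx : ∀ x : E, 0 < ‖x‖ → U (Real.log ‖x‖) = ‖x‖ ^ p * V x := fun x hx => by
    rw [hU]; simp only
    rw [Real.exp_log hx]
    congr 1
    apply hV.radial
    rw [norm_smul, he₀, mul_one, norm_norm]
  set Δ := sphMin f (Real.exp τ) - sphMin f (Real.exp (-τ)) with hΔdef
  have hΔ : |Δ| ≤ 2 * μ * τ := by
    have a1 : |τ| = τ := abs_of_pos hτ
    have a2 : |-τ| = τ := by rw [abs_neg, a1]
    have a3 : |τ - -τ| = 2 * τ := by rw [abs_of_pos (by linarith)]; ring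
    have a4 : |-τ - τ| = 2 * τ := by rw [abs_of_neg (by linarith)]; ring
    have h1 := hmin V f hV hf τ (-τ) (by rw [a1]; linarith) (by rw [a3]; linarith)
    have h2 := hmin V f hV hf (-τ) τ (by rw [a2]; linarith) (by rw [a4]; linarith)
    rw [a3] at h1
    rw [a4] at h2
    rw [abs_le]
    constructor <;> linarith
  obtain ⟨y, hyL, hyb, hyd, hyi⟩ := exists_slope_of_increment hΦ hN hUm hUb hτ
    (by linarith : τ ≤ 2 * τ) hτ2 hγc hγ1 hγ2 hΔ
  have hgc : Continuous fun t => γ (y t) := hγc.comp hyL.continuous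
  set Γ : ℝ → ℝ := fun t => sphMin f (Real.exp (-τ)) + ∫ s in (-τ)..t, γ (y s) with hΓdef
  have hΓ : ∀ t, HasDerivAt Γ (γ (y t)) t := fun t =>
    (intervalIntegral.integral_hasDerivAt_right (hgc.intervalIntegrable _ _)
      (hgc.stronglyMeasurableAtFilter _ _) hgc.continuousAt).const_add _
  have hΓ1 : Γ (-τ) = sphMin f (Real.exp (-τ)) := by simp [hΓdef]
  have hΓ2 : Γ τ = sphMin f (Real.exp τ) := by
    rw [hΓdef]; simp only
    rw [hyi, hΔdef]; ring
  have hsol : LogSol p V (ann (Real.exp (-(2 * τ))) (Real.exp (2 * τ)))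
      (fun x => Γ (Real.log ‖x‖)) := by
    have hpy : (fun t => pflux p (γ (y t))) = y := funext fun t => pflux_pflux_conjugate hp (y t)
    refine logSol_radial hp (Real.exp_pos _) (hV.bddPot (by linarith) (Real.exp_pos _) _)
      (L := (N + C₀).toNNReal) (h := fun t => U t - Φ (y t)) hΓ hgc (by rw [hpy]; exact hyL) ?_ ?_
    · rw [Real.log_exp, Real.log_exp, hpy]
      exact hyd
    · intro x hx
      have hx0 : 0 < ‖x‖ := (Real.exp_pos _).trans hx.1
      rw [hUx x hx0, show pflux p (γ (y (Real.log ‖x‖))) = y (Real.log ‖x‖) from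
        pflux_pflux_conjugate hp _, hΦe _ (hyb _)]
      have e : |γ (y (Real.log ‖x‖))| ^ p = |y (Real.log ‖x‖)| ^ q := by
        rw [← Real.norm_eq_abs, hγdef]; simp only
        rw [norm_pflux hq, ← Real.rpow_mul (norm_nonneg _), hq1, Real.norm_eq_abs]
        congr 1
        rw [hqdef]; field_simp
      rw [e]; ring
  refine ⟨fun t => γ (y t), Γ, fun t => (hΛ _ (abs_le.1 (hyb t))).trans (le_max_left _ _),
    fun e he s t hst => (hω e he).2 y hyL hyb s t hst, hΓ, hsol, ?_⟩
  have hb4 : Real.exp (2 * τ) < 4 := by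
    have := Real.exp_lt_exp.2 (show 2 * τ < 1 by linarith)
    have := Real.exp_one_lt_d9
    linarith
  have hsub : (ann (Real.exp (-(2 * τ))) (Real.exp (2 * τ)) : Set E) ⊆ ann 0 4 :=
    ann_mono (Real.exp_pos _).le hb4.le
  have hfm := hf.mono hsub
  have hsphere : ∀ t, |t| ≤ τ → ∀ x : E, ‖x‖ = Real.exp t →
      sphMin f (Real.exp t) ≤ f x ∧ f x ≤ sphMin f (Real.exp t) + K := by
    intro t ht x hx
    have hc : ContinuousOn f (sphere 0 (Real.exp t)) :=
      hf.1.1.continuousOn.mono (sphere_subset_ann (Real.exp_pos _) ((Real.exp_le_exp.2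
        ((le_abs_self t).trans (by linarith : |t| ≤ 2 * τ))).trans_lt hb4))
    have h0 := hK t (by linarith)
    have h1 := le_sphMax hc hx
    rw [sphOsc] at h0
    exact ⟨sphMin_le hc hx, by linarith⟩
  have hm1 : Real.exp (-(2 * τ)) < Real.exp (-τ) := Real.exp_lt_exp.2 (by linarith)
  have hm2 : Real.exp τ < Real.exp (2 * τ) := Real.exp_lt_exp.2 (by linarith)
  have hs1 := hsphere (-τ) (by rw [abs_neg, abs_of_pos hτ])
  have hs2 := hsphere τ (by rw [abs_of_pos hτ])
  intro x hx1 hx2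
  constructor
  · refine comparison_ann hp hV (Real.exp_pos _) hm1 hm2 hfm.1 hsol.2 ?_ ?_ x hx1 hx2
    · intro z hz
      rw [hz, Real.log_exp, hΓ1]; exact (hs1 z hz).1
    · intro z hz
      rw [hz, Real.log_exp, hΓ2]; exact (hs2 z hz).1
  · refine comparison_ann hp hV (Real.exp_pos _) hm1 hm2 (hsol.1.add_const K) hfm.2 ?_ ?_ x hx1 hx2
    · intro z hz
      rw [hz, Real.log_exp, hΓ1]; exact (hs1 z hz).2
    · intro z hz
      rw [hz, Real.log_exp, hΓ2]; exact (hs2 z hz).2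

end RadialBracket

section OscillationGap

theorem abs_log_sub_log_lt {a r h : ℝ} (hr : 1 / 2 ≤ r) (h1 : h ≤ 1 / 16)
    (ha : |a - r| < 5 / 256 * h) : |Real.log a - Real.log r| < h := by
  have hh : 0 < h := by linarith [abs_nonneg (a - r)]
  obtain ⟨h2, h3⟩ := abs_lt.1 ha
  have ha' : 1 / 4 ≤ a := by linarith
  have ha0 : 0 < a := by linarith
  have hr0 : 0 < r := by linarith
  have e1 := Real.log_le_sub_one_of_pos (div_pos ha0 hr0)
  have e2 := Real.log_le_sub_one_of_pos (div_pos hr0 ha0)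
  rw [Real.log_div ha0.ne' hr0.ne'] at e1
  rw [Real.log_div hr0.ne' ha0.ne'] at e2
  have e3 : a / r < 1 + h := by rw [div_lt_iff₀ hr0]; nlinarith
  have e4 : r / a < 1 + h := by rw [div_lt_iff₀ ha0]; nlinarith
  rw [abs_lt]
  constructor <;> linarith

variable {E : Type*} [NormedAddCommGroup E] [InnerProductSpace ℝ E] [FiniteDimensional ℝ E]
  [MeasurableSpace E] [BorelSpace E]

theorem FuchsPot.bddPot_simil {p C₀ : ℝ} (hp : 0 < p) {V : E → ℝ} (hV : FuchsPot p C₀ V)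
    {z : E} {R a b : ℝ} (hR : 0 < R) (ha : 0 < a)
    (hsub : ∀ y ∈ ball (0 : E) 1, simil z R (LinearIsometryEquiv.refl ℝ E) y ∈ ann a b) :
    BddPot (fun y => R ^ p * V (simil z R (LinearIsometryEquiv.refl ℝ E) y)) (ball 0 1) := by
  obtain ⟨hm, M, hM⟩ := hV.bddPot hp ha b
  refine ⟨(hm.comp (contDiff_simil _ _ _).continuous.measurable).const_mul _, R ^ p * M,
    fun y hy => ?_⟩
  rw [abs_mul, abs_of_pos (by positivity)]
  exact mul_le_mul_of_nonneg_left (hM _ (hsub y hy)) (by positivity)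

theorem norm_gradient_radial_simil {Γ g : ℝ → ℝ} (hΓ : ∀ t, HasDerivAt Γ (g t) t) {z y : E} {R : ℝ}
    (hR : 0 < R) (h0 : simil z R (LinearIsometryEquiv.refl ℝ E) y ≠ 0) :
    ‖gradient (fun y => Γ (Real.log ‖simil z R (LinearIsometryEquiv.refl ℝ E) y‖)) y‖ =
      R * |g (Real.log ‖simil z R (LinearIsometryEquiv.refl ℝ E) y‖)| /
        ‖simil z R (LinearIsometryEquiv.refl ℝ E) y‖ := by
  set w := simil z R (LinearIsometryEquiv.refl ℝ E) y with hw
  have hn : 0 < ‖w‖ := norm_pos_iff.2 h0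
  have h1 : HasGradientAt (fun x : E => Γ (Real.log ‖x‖))
      (g (Real.log ‖w‖) • (‖w‖ ^ 2)⁻¹ • w) w :=
    HasGradientAt.comp_real (f := fun x : E => Real.log ‖x‖) (hΓ _) (hasGradientAt_log_norm h0)
  rw [(hasGradientAt_comp_simil (f := fun x : E => Γ (Real.log ‖x‖)) h1).gradient, norm_smul,
    LinearIsometryEquiv.norm_map, norm_smul, norm_smul, Real.norm_of_nonneg hR.le, norm_inv,
    norm_pow, norm_norm, Real.norm_eq_abs]
  field_simp

/-- The data of a bracketed solution, rescaled to a small ball close to a sphere. -/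
theorem rescaled_bracket {p C₀ : ℝ} (hp : 1 < p) {V f : E → ℝ} (hV : FuchsPot p C₀ V)
    {a b M K τ : ℝ} (ha : 0 < a) (hf : LogSol p V (ann 0 4) f) {Γ g : ℝ → ℝ}
    (hΓ : ∀ t, HasDerivAt Γ (g t) t) (hG : LogSol p V (ann a b) fun x => Γ (Real.log ‖x‖))
    (haτ : a ≤ Real.exp (-τ)) (hbτ : Real.exp τ ≤ b) (hτ : τ ≤ 1 / 16)
    (hbr : ∀ x : E, Real.exp (-τ) ≤ ‖x‖ → ‖x‖ ≤ Real.exp τ →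
      Γ (Real.log ‖x‖) ≤ f x ∧ f x ≤ Γ (Real.log ‖x‖) + K)
    (hM : ∀ x y : E, x ≠ 0 → 3 / 2 * ‖x‖ ≤ 4 → ‖x - y‖ < ‖x‖ / 128 → |f x - f y| ≤ M)
    {t₁ h R : ℝ} (ht₁ : |t₁| ≤ τ / 2) (hh : 0 < h) (hhτ : h ≤ τ / 2) (hR : R = h / 64) {z : E}
    (hz : |‖z‖ - Real.exp t₁| < R / 4) :
    let S := simil z R (LinearIsometryEquiv.refl ℝ E)
    BddPot (fun y => R ^ p * V (S y)) (ball 0 1) ∧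
    LogSol p (fun y => R ^ p * V (S y)) (ball 0 1) (fun y => f (S y)) ∧
    LogSol p (fun y => R ^ p * V (S y)) (ball 0 1) (fun y => Γ (Real.log ‖S y‖)) ∧
    ∀ y ∈ ball (0 : E) 1, |f (S y) - f (S 0)| ≤ M ∧
      |Γ (Real.log ‖S y‖) - Γ (Real.log ‖S 0‖)| ≤ M + K ∧
      Γ (Real.log ‖S y‖) ≤ f (S y) ∧ f (S y) ≤ Γ (Real.log ‖S y‖) + K ∧
      ∃ t, |t - t₁| < h ∧ R / 2 * |g t| ≤ ‖gradient (fun y => Γ (Real.log ‖S y‖)) y‖ ∧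
        ‖gradient (fun y => Γ (Real.log ‖S y‖)) y‖ ≤ 2 * R * |g t| := by
  intro S
  have hR0 : 0 < R := by rw [hR]; positivity
  obtain ⟨ht1, ht2⟩ := abs_le.1 ht₁
  have hr1 : 3 / 4 ≤ Real.exp t₁ := by linarith [Real.add_one_le_exp t₁]
  have hr2 : Real.exp t₁ ≤ 4 / 3 := by
    have h1 := Real.add_one_le_exp (-t₁)
    rw [Real.exp_neg] at h1
    have h2 : (3:ℝ) / 4 ≤ (Real.exp t₁)⁻¹ := by linarith
    rw [le_inv_comm₀ (by norm_num) (Real.exp_pos _)] at h2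
    norm_num at h2 ⊢
    exact h2
  obtain ⟨hz1, hz2⟩ := abs_lt.1 hz
  have hz3 : 1 / 2 ≤ ‖z‖ := by linarith
  have hdist : ∀ y ∈ ball (0 : E) 1, ‖z - S y‖ < R := by
    intro y hy
    rw [mem_ball_zero_iff] at hy
    have e : z - S y = -(R • y) := by
      show z - (z + R • y) = _
      abel
    rw [e, norm_neg, norm_smul, Real.norm_of_nonneg hR0.le]
    nlinarith
  have hSn : ∀ y ∈ ball (0 : E) 1, |‖S y‖ - Real.exp t₁| < 5 / 256 * h := by
    intro y hy
    have h1 := abs_norm_sub_norm_le z (S y)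
    have h2 := hdist y hy
    obtain ⟨h3, h4⟩ := abs_le.1 h1
    rw [abs_lt]
    constructor <;> linarith
  have hlog : ∀ y ∈ ball (0 : E) 1, |Real.log ‖S y‖ - t₁| < h := by
    intro y hy
    have := abs_log_sub_log_lt (by linarith) (by linarith : h ≤ 1 / 16) (hSn y hy)
    rwa [Real.log_exp] at this
  have hS0 : ∀ y ∈ ball (0 : E) 1, 1 / 2 ≤ ‖S y‖ ∧ ‖S y‖ ≤ 2 := by
    intro y hy
    obtain ⟨h3, h4⟩ := abs_lt.1 (hSn y hy)
    constructor <;> linarith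
  have hann : ∀ y ∈ ball (0 : E) 1, Real.exp (-τ) < ‖S y‖ ∧ ‖S y‖ < Real.exp τ := by
    intro y hy
    have h0 : 0 < ‖S y‖ := by linarith [(hS0 y hy).1]
    obtain ⟨h3, h4⟩ := abs_lt.1 (hlog y hy)
    rw [← Real.lt_log_iff_exp_lt h0, ← Real.log_lt_iff_lt_exp h0]
    constructor <;> linarith
  have hab : ∀ y ∈ ball (0 : E) 1, S y ∈ (ann a b : Set E) := fun y hy =>
    ⟨haτ.trans_lt (hann y hy).1, (hann y hy).2.trans_le hbτ⟩
  have h04 : ∀ y ∈ ball (0 : E) 1, S y ∈ (ann 0 4 : Set E) := fun y hy =>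
    ⟨by linarith [(hS0 y hy).1], by linarith [(hS0 y hy).2]⟩
  have hSz : S 0 = z := by
    show z + R • (0 : E) = z
    simp
  have hzb : (0 : E) ∈ ball (0 : E) 1 := mem_ball_self one_pos
  have hfM : ∀ y ∈ ball (0 : E) 1, |f (S y) - f (S 0)| ≤ M := by
    intro y hy
    rw [hSz, abs_sub_comm]
    refine hM z (S y) (norm_pos_iff.1 (by linarith)) (by linarith) ((hdist y hy).trans_le ?_)
    linarith
  refine ⟨hV.bddPot_simil (by linarith) hR0 ha hab,
    (hf.comp_simil hp hR0 _ (isOpen_ann _ _)).mono h04,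
    (hG.comp_simil hp hR0 _ (isOpen_ann _ _)).mono hab, fun y hy => ?_⟩
  have b1 := hbr (S y) (hann y hy).1.le (hann y hy).2.le
  have b0 := hbr (S 0) (hann 0 hzb).1.le (hann 0 hzb).2.le
  refine ⟨hfM y hy, ?_, b1.1, b1.2, Real.log ‖S y‖, hlog y hy, ?_⟩
  · obtain ⟨h3, h4⟩ := abs_le.1 (hfM y hy)
    rw [abs_le]
    constructor <;> linarith
  · obtain ⟨h3, h4⟩ := hS0 y hy
    have h0 : 0 < ‖S y‖ := by linarith
    rw [norm_gradient_radial_simil hΓ hR0 (norm_pos_iff.1 h0), le_div_iff₀ h0, div_le_iff₀ h0]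
    have : 0 ≤ R * |g (Real.log ‖S y‖)| := by positivity
    constructor <;> nlinarith

/-- Two nonnegative functions with a positive constant sum cannot both satisfy the De Giorgi
inequality near a sphere on which each of them nearly vanishes somewhere. -/
theorem DeGiorgi.not_touching (hn : 2 ≤ Module.finrank ℝ E) {C R κ : ℝ} {m : ℕ} (hC : 0 ≤ C)
    (hm : 2 ≤ m) (hR : 0 < R) (hκ : 0 < κ) : ∃ c : ℝ, 0 < c ∧ ∀ (u₁ u₂ : E → ℝ) (r : ℝ), r ≤ 2 →
      (∀ x, κ ≤ u₁ x + u₂ x) →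
      (∀ z, |‖z‖ - r| < R / 4 →
        DeGiorgi m C (fun y => u₁ (simil z R (LinearIsometryEquiv.refl ℝ E) y)) ∧
        DeGiorgi m C (fun y => u₂ (simil z R (LinearIsometryEquiv.refl ℝ E) y))) →
      ∀ x₁ x₂ : E, ‖x₁‖ = r → ‖x₂‖ = r → u₁ x₁ < c → u₂ x₂ < c → False := by
  have h2 : 1 < √2 := by
    rw [Real.lt_sqrt zero_le_one]; norm_num
  obtain ⟨N, hN⟩ := pow_unbounded_of_one_lt (16 / R) h2
  rw [div_lt_iff₀ hR] at hN
  obtain ⟨c, hc, H⟩ := DeGiorgi.exists_both_lt (E := E) hn C m hC hm N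
  refine ⟨c * (κ / 2), by positivity, fun u₁ u₂ r hr hκu hD x₁ x₂ h1 h2 h3 h4 => ?_⟩
  obtain ⟨y, _, hy1, hy2⟩ := H u₁ u₂ r R hR (by linarith) hD x₁ x₂ h1 h2 (κ / 2) (by positivity)
    h3 h4
  linarith [hκu y]

set_option maxHeartbeats 1000000 in
/-- The oscillation on spheres of a solution cannot stay close to a positive constant. -/
theorem LogSol.sphOsc_ne_const {p : ℝ} (hp : 1 < p) (hn : 2 ≤ Module.finrank ℝ E) {C₀ : ℝ}
    (hC₀ : 0 ≤ C₀) {κ : ℝ} (hκ : 0 < κ) : ∃ ε : ℝ, 0 < ε ∧ ∀ V f : E → ℝ, FuchsPot p C₀ V →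
      LogSol p V (ann 0 4) f → ¬ ∀ t : ℝ, |t| ≤ 1 / 2 → |sphOsc f (Real.exp t) - κ| ≤ ε := by
  have : Nontrivial E := Module.nontrivial_of_finrank_pos (R := ℝ) (by omega)
  obtain ⟨τ, Λ, ω, hτ, hτ1, hΛ, hω, hbracket⟩ := LogSol.exists_radial_bracket (E := E) hp hn C₀ hC₀
  obtain ⟨M, hM0, hM⟩ := LogSol.local_harnack (E := E) hp hn C₀ hC₀
  obtain ⟨m, hpm, hm2⟩ := exists_nat_exponent p
  obtain ⟨C₂, hC₂, H₂⟩ := LogSuper.deGiorgi_sub_of_gradient_le (E := E) hp hpm hm2 (M + 2 * κ)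
  set R₂ := τ / 2 / 64 with hR₂
  obtain ⟨c₂, hc₂, T₂⟩ := DeGiorgi.not_touching (E := E) (R := R₂) hn hC₂.le hm2
    (by positivity) hκ
  set k := c₂ / 2 with hk
  have hk0 : 0 < k := by positivity
  set h₁ := min (ω (k / 2)) (τ / 2) with hh₁
  have hh₁0 : 0 < h₁ := lt_min (hω _ (by positivity)) (by positivity)
  set R₁ := h₁ / 64 with hR₁
  have hR₁0 : 0 < R₁ := by positivity
  obtain ⟨C₁, hC₁, H₁⟩ := LogSuper.deGiorgi_sub_of_gradient_ge (E := E) (c := R₁ / 2 * (k / 2))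
    (L := 2 * R₁ * Λ) (K := 3 * κ) hp (by positivity) (by positivity) (by positivity) hpm hm2
    (M + 2 * κ)
  obtain ⟨c₁, hc₁, T₁⟩ := DeGiorgi.not_touching (E := E) (R := R₁) hn hC₁.le hm2 hR₁0 hκ
  set ε := min κ (min (c₂ / 8) (c₁ / 4)) with hε
  have hε0 : 0 < ε := by positivity
  have hεκ : ε ≤ κ := min_le_left _ _
  have hεc₂ : ε ≤ c₂ / 8 := (min_le_right _ _).trans (min_le_left _ _)
  have hεc₁ : ε ≤ c₁ / 4 := (min_le_right _ _).trans (min_le_right _ _)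
  refine ⟨ε, hε0, fun V f hV hf hosc => ?_⟩
  obtain ⟨g, Γ, hg, hgω, hΓ, hG, hbr⟩ := hbracket V f (κ + ε) hV hf fun t ht => by
    linarith [(abs_le.1 (hosc t ht)).2]
  have hM' := hM V f 4 hV hf
  have e1 : Real.exp (-(2 * τ)) ≤ Real.exp (-τ) := Real.exp_le_exp.2 (by linarith)
  have e2 : Real.exp τ ≤ Real.exp (2 * τ) := Real.exp_le_exp.2 (by linarith)
  have e3 : ∀ t, |t| ≤ τ → Real.exp t ≤ 2 := fun t ht => by
    have h1 := Real.add_one_le_exp (-t)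
    have h2 := (abs_le.1 ht).2
    rw [Real.exp_neg] at h1
    have h3 : (1:ℝ) / 2 ≤ (Real.exp t)⁻¹ := by linarith
    rw [le_inv_comm₀ (by norm_num) (Real.exp_pos _)] at h3
    norm_num at h3
    exact h3
  -- the two near-touching points on a sphere
  have hpts : ∀ t, |t| ≤ τ → ∃ x₁ x₂ : E, ‖x₁‖ = Real.exp t ∧ ‖x₂‖ = Real.exp t ∧
      Γ (Real.log ‖x₁‖) - f x₁ + (κ + ε) ≤ 2 * ε ∧ f x₂ - Γ (Real.log ‖x₂‖) ≤ 2 * ε := by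
    intro t ht
    have hc : ContinuousOn f (sphere 0 (Real.exp t)) :=
      hf.1.1.continuousOn.mono (sphere_subset_ann (Real.exp_pos _) (by linarith [e3 t ht]))
    obtain ⟨x₁, hx₁, hm₁⟩ := exists_eq_sphMax (Real.exp_pos t).le hc
    obtain ⟨x₂, hx₂, hm₂⟩ := exists_eq_sphMin (Real.exp_pos t).le hc
    have ho := (abs_le.1 (hosc t (by linarith))).1
    rw [sphOsc, ← hm₁, ← hm₂] at ho
    have ht' := abs_le.1 ht
    have b1 := hbr x₁ (by rw [hx₁]; exact Real.exp_le_exp.2 (by linarith))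
      (by rw [hx₁]; exact Real.exp_le_exp.2 ht'.2)
    have b2 := hbr x₂ (by rw [hx₂]; exact Real.exp_le_exp.2 (by linarith))
      (by rw [hx₂]; exact Real.exp_le_exp.2 ht'.2)
    rw [hx₁] at b1
    rw [hx₂] at b2
    refine ⟨x₁, x₂, hx₁, hx₂, ?_, ?_⟩
    · rw [hx₁]; linarith
    · rw [hx₂]; linarith
  by_cases hcase : ∀ t, |t| ≤ τ / 2 → |g t| ≤ k
  · obtain ⟨x₁, x₂, hx₁, hx₂, hu₁, hu₂⟩ := hpts 0 (by rw [abs_zero]; exact hτ.le)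
    refine T₂ (fun x => Γ (Real.log ‖x‖) - f x + (κ + ε + k)) (fun x => f x - Γ (Real.log ‖x‖) + k)
      (Real.exp 0) (e3 0 (by rw [abs_zero]; exact hτ.le)) (fun x => by linarith)
      (fun z hz => ?_) x₁ x₂ hx₁ hx₂ (by linarith) (by linarith)
    obtain ⟨hV', hf', hG', hall⟩ := rescaled_bracket hp hV (Real.exp_pos _) hf hΓ hG e1 e2 hτ1 hbr
      hM' (t₁ := 0) (h := τ / 2) (by rw [abs_zero]; positivity) (by positivity) le_rfl hR₂ hz
    have hgr : ∀ y ∈ ball (0 : E) 1, ‖gradient (fun y => Γ (Real.log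
        ‖simil z R₂ (LinearIsometryEquiv.refl ℝ E) y‖)) y‖ ≤ k := by
      intro y hy
      obtain ⟨-, -, -, -, t, ht, -, h3⟩ := hall y hy
      rw [sub_zero] at ht
      have h4 := hcase t ht.le
      refine h3.trans ?_
      have : 2 * R₂ ≤ 1 := by rw [hR₂]; linarith
      nlinarith [abs_nonneg (g t)]
    constructor
    · refine H₂ _ _ _ (κ + ε + k) k hk0 hV' hG'.1 hf'.2 (fun y hy => ?_) (fun y hy => ?_)
        fun y hy => Or.inl (hgr y hy)
      · linarith [(hall y hy).1]
      · linarith [(hall y hy).2.2.2.1]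
    · refine H₂ _ _ _ k k hk0 hV' hf'.1 hG'.2 (fun y hy => ?_) (fun y hy => ?_)
        fun y hy => Or.inr (hgr y hy)
      · linarith [(hall y hy).2.1]
      · linarith [(hall y hy).2.2.1]
  · push Not at hcase
    obtain ⟨t₁, ht₁, hgt₁⟩ := hcase
    obtain ⟨x₁, x₂, hx₁, hx₂, hu₁, hu₂⟩ := hpts t₁ (by linarith)
    refine T₁ (fun x => Γ (Real.log ‖x‖) - f x + (κ + ε + ε)) (fun x => f x - Γ (Real.log ‖x‖) + ε)
      (Real.exp t₁) (e3 t₁ (by linarith)) (fun x => by linarith)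
      (fun z hz => ?_) x₁ x₂ hx₁ hx₂ (by linarith) (by linarith)
    obtain ⟨hV', hf', hG', hall⟩ := rescaled_bracket hp hV (Real.exp_pos _) hf hΓ hG e1 e2 hτ1 hbr
      hM' (t₁ := t₁) (h := h₁) ht₁ hh₁0 (min_le_right _ _) hR₁ hz
    have hgr : ∀ y ∈ ball (0 : E) 1, R₁ / 2 * (k / 2) ≤ ‖gradient (fun y => Γ (Real.log
          ‖simil z R₁ (LinearIsometryEquiv.refl ℝ E) y‖)) y‖ ∧
        ‖gradient (fun y => Γ (Real.log
          ‖simil z R₁ (LinearIsometryEquiv.refl ℝ E) y‖)) y‖ ≤ 2 * R₁ * Λ := by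
      intro y hy
      obtain ⟨-, -, -, -, t, ht, h2, h3⟩ := hall y hy
      have h4 := hgω (k / 2) (by positivity) t t₁ (ht.trans_le (min_le_left _ _))
      have h5 : k / 2 ≤ |g t| := by
        have := abs_sub_abs_le_abs_sub (g t₁) (g t)
        rw [abs_sub_comm] at this
        linarith
      exact ⟨(mul_le_mul_of_nonneg_left h5 (by positivity)).trans h2,
        h3.trans (mul_le_mul_of_nonneg_left (hg t) (by positivity))⟩
    constructor
    · refine H₁ _ _ _ (κ + ε + ε) hV' hG'.1 hf'.2 (fun y hy => ?_) (fun y hy => ?_)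
        fun y hy => Or.inl (hgr y hy)
      · linarith [(hall y hy).1]
      · obtain ⟨-, -, h3, h4, -⟩ := hall y hy
        constructor <;> linarith
    · refine H₁ _ _ _ ε hV' hf'.1 hG'.2 (fun y hy => ?_) (fun y hy => ?_)
        fun y hy => Or.inr (hgr y hy)
      · linarith [(hall y hy).2.1]
      · obtain ⟨-, -, h3, h4, -⟩ := hall y hy
        constructor <;> linarith

end OscillationGap

section Limits

variable {E : Type*} [NormedAddCommGroup E] [InnerProductSpace ℝ E] [FiniteDimensional ℝ E]
  [MeasurableSpace E] [BorelSpace E]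

theorem sphMax_comp_smul (f : E → ℝ) {s : ℝ} (hs : 0 < s) (r : ℝ) :
    sphMax (fun x => f (s • x)) r = sphMax f (s * r) := by
  have e : (fun x : E => s • x) '' sphere 0 r = sphere (0 : E) (s * r) := by
    ext x
    constructor
    · rintro ⟨y, hy, rfl⟩
      rw [mem_sphere_zero_iff_norm] at hy ⊢
      rw [norm_smul, hy, Real.norm_of_nonneg hs.le]
    · intro hx
      rw [mem_sphere_zero_iff_norm] at hx
      refine ⟨s⁻¹ • x, ?_, smul_inv_smul₀ hs.ne' x⟩
      rw [mem_sphere_zero_iff_norm, norm_smul, hx, norm_inv, Real.norm_of_nonneg hs.le,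
        inv_mul_cancel_left₀ hs.ne']
  rw [sphMax, sphMax, ← e, image_image]

theorem sphOsc_comp_smul (f : E → ℝ) {s : ℝ} (hs : 0 < s) (r : ℝ) :
    sphOsc (fun x => f (s • x)) r = sphOsc f (s * r) := by
  rw [sphOsc, sphOsc, sphMin, sphMin, sphMax_comp_smul f hs,
    sphMax_comp_smul (fun x => -f x) hs]

theorem FuchsPot.comp_smul {p C₀ : ℝ} {V : E → ℝ} (hV : FuchsPot p C₀ V) {s : ℝ} (hs : 0 < s) :
    FuchsPot p C₀ fun y => s ^ p * V (s • y) := by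
  refine ⟨(hV.meas.comp (measurable_const_smul s)).const_mul _, fun x => ?_, fun x y h => ?_⟩
  · have := hV.bound (s • x)
    rw [norm_smul, Real.norm_of_nonneg hs.le, Real.mul_rpow hs.le (norm_nonneg _)] at this
    rw [abs_mul, abs_of_pos (by positivity)]
    linarith
  · rw [hV.radial (s • x) (s • y) (by rw [norm_smul, norm_smul, h])]

theorem LogSol.comp_smul {p : ℝ} (hp : 1 < p) {V f : E → ℝ} {ρ s b : ℝ} (hs : 0 < s)
    (hb : s * b ≤ ρ) (hf : LogSol p V (ann 0 ρ) f) :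
    LogSol p (fun y => s ^ p * V (s • y)) (ann 0 b) fun y => f (s • y) := by
  have e : ∀ y : E, simil 0 s (LinearIsometryEquiv.refl ℝ E) y = s • y := fun y => by
    rw [simil_refl_apply, zero_add]
  have h := hf.comp_simil hp (x₀ := 0) hs (LinearIsometryEquiv.refl ℝ E) (isOpen_ann _ _)
  simp only [e] at h
  refine h.mono fun y hy => ?_
  rw [mem_preimage, e]
  have hn : ‖s • y‖ = s * ‖y‖ := by rw [norm_smul, Real.norm_of_nonneg hs.le]
  refine ⟨?_, ?_⟩
  · rw [hn]; exact mul_pos hs hy.1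
  · rw [hn]; exact (mul_lt_mul_of_pos_left hy.2 hs).trans_le hb

/-- The oscillation of a solution on spheres vanishes at the origin. -/
theorem LogSol.tendsto_sphOsc {p : ℝ} (hp : 1 < p) (hn : 2 ≤ Module.finrank ℝ E) {C₀ ρ : ℝ}
    (hρ : 0 < ρ) {V f : E → ℝ} (hV : FuchsPot p C₀ V) (hf : LogSol p V (ann 0 ρ) f) :
    Tendsto (sphOsc f) (𝓝[>] 0) (𝓝 0) := by
  have : Nontrivial E := Module.nontrivial_of_finrank_pos (R := ℝ) (by omega)
  obtain ⟨l, hl⟩ := quasiconvex_tendsto hρ (sphOsc_quasiconvex hp hV hf)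
  obtain ⟨C, hC, hosc⟩ := LogSol.sphere_osc_bound (E := E) hp hn C₀ hV.nonneg
  have hc : ∀ r, 0 < r → r < ρ → ContinuousOn f (sphere (0 : E) r) := fun r h0 h1 =>
    hf.1.1.continuousOn.mono (sphere_subset_ann h0 h1)
  have hsmall : ∀ᶠ r : ℝ in 𝓝[>] 0, 0 < r ∧ 3 / 2 * r ≤ ρ := by
    filter_upwards [Ioo_mem_nhdsGT (show 0 < ρ / 2 by positivity)] with r hr
    exact ⟨hr.1, by linarith [hr.1, hr.2]⟩
  have h0 : ∀ᶠ r : ℝ in 𝓝[>] 0, (0 : EReal) ≤ sphOsc f r := by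
    filter_upwards [hsmall] with r hr
    exact_mod_cast sphOsc_nonneg hr.1.le (hc r hr.1 (by linarith [hr.1, hr.2]))
  have h1 : ∀ᶠ r : ℝ in 𝓝[>] 0, (sphOsc f r : EReal) ≤ (C : ℝ) := by
    filter_upwards [hsmall] with r hr
    have hcr := hc r hr.1 (by linarith [hr.1, hr.2])
    obtain ⟨x, hx, ex⟩ := exists_eq_sphMax hr.1.le hcr
    obtain ⟨y, hy, ey⟩ := exists_eq_sphMin hr.1.le hcr
    have := hosc V f ρ hV hf x y (norm_pos_iff.1 (hx ▸ hr.1)) (by rw [hx]; exact hr.2)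
      (by rw [hx, hy])
    rw [EReal.coe_le_coe_iff, sphOsc, ← ex, ← ey]
    exact (le_abs_self _).trans this
  have hl0 : 0 ≤ l := ge_of_tendsto hl h0
  have hl1 : l ≤ (C : ℝ) := le_of_tendsto hl h1
  obtain ⟨κ, rfl⟩ : ∃ κ : ℝ, (κ : EReal) = l :=
    ⟨l.toReal, EReal.coe_toReal (ne_top_of_le_ne_top (EReal.coe_ne_top C) hl1)
      (ne_bot_of_le_ne_bot EReal.zero_ne_bot hl0)⟩
  have hκ0 : 0 ≤ κ := by exact_mod_cast hl0
  have hl' : Tendsto (sphOsc f) (𝓝[>] 0) (𝓝 κ) := EReal.tendsto_coe.1 hl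
  rcases hκ0.eq_or_lt with h | hκ
  · rwa [← h] at hl'
  exfalso
  obtain ⟨ε, hε, H⟩ := LogSol.sphOsc_ne_const (E := E) hp hn hV.nonneg hκ
  have hev := hl'.eventually (Metric.closedBall_mem_nhds κ hε)
  obtain ⟨δ, hδ, hball⟩ := mem_nhdsGT_iff_exists_Ioo_subset.1 hev
  have hδ : 0 < δ := hδ
  set s := min (ρ / 4) (δ / 2) with hs
  have hs0 : 0 < s := by positivity
  have hs1 : s ≤ ρ / 4 := min_le_left _ _
  have hs2 : s ≤ δ / 2 := min_le_right _ _
  refine H _ _ (hV.comp_smul hs0) (hf.comp_smul hp hs0 (b := 4) (by linarith)) fun t ht => ?_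
  rw [sphOsc_comp_smul f hs0]
  have he : Real.exp t < 2 := by
    have h1 := Real.add_one_le_exp (-t)
    have h2 := (abs_le.1 ht).2
    have h4 : Real.exp (1 / 2) < 2 := by
      have h3 := Real.exp_one_lt_d9
      have h5 : Real.exp (1 / 2) * Real.exp (1 / 2) = Real.exp 1 := by
        rw [← Real.exp_add]; norm_num
      nlinarith [Real.exp_pos (1 / 2)]
    exact (Real.exp_le_exp.2 h2).trans_lt h4
  have hm : s * Real.exp t ∈ Ioo 0 δ := ⟨by positivity, by nlinarith⟩
  exact hball hm

/-- The difference of two solutions has a limit at the origin in the extended reals. -/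
theorem LogSol.exists_tendsto_sub {p : ℝ} (hp : 1 < p) (hn : 2 ≤ Module.finrank ℝ E) {C₀ ρ : ℝ}
    (hρ : 0 < ρ) {V f g : E → ℝ} (hV : FuchsPot p C₀ V) (hf : LogSol p V (ann 0 ρ) f)
    (hg : LogSol p V (ann 0 ρ) g) :
    ∃ l : EReal, Tendsto (fun x => ((f x - g x : ℝ) : EReal)) (𝓝[ann 0 ρ] 0) (𝓝 l) := by
  have : Nontrivial E := Module.nontrivial_of_finrank_pos (R := ℝ) (by omega)
  set φ := sphMax fun x => f x - g x with hφ
  obtain ⟨l, hl⟩ := quasiconvex_tendsto hρ (sphMax_sub_quasiconvex hp hV hg.1 hf.2)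
  refine ⟨l, ?_⟩
  have hnorm : Tendsto (fun x : E => ‖x‖) (𝓝[ann 0 ρ] 0) (𝓝[>] 0) := by
    refine tendsto_nhdsWithin_iff.2 ⟨?_, ?_⟩
    · exact (continuous_norm.tendsto' (0 : E) 0 norm_zero).mono_left nhdsWithin_le_nhds
    · filter_upwards [self_mem_nhdsWithin] with x hx using hx.1
  have herr : Tendsto (fun x => f x - g x - φ ‖x‖) (𝓝[ann 0 ρ] 0) (𝓝 0) := by
    have hosc := ((hf.tendsto_sphOsc hp hn hρ hV).add (hg.tendsto_sphOsc hp hn hρ hV)).comp hnorm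
    rw [add_zero] at hosc
    refine squeeze_zero_norm' ?_ hosc
    filter_upwards [self_mem_nhdsWithin] with x hx
    have hcf : ContinuousOn f (sphere (0 : E) ‖x‖) :=
      hf.1.1.continuousOn.mono (sphere_subset_ann hx.1 hx.2)
    have hcg : ContinuousOn g (sphere (0 : E) ‖x‖) :=
      hg.1.1.continuousOn.mono (sphere_subset_ann hx.1 hx.2)
    have hcs : ContinuousOn (fun x => f x - g x) (sphere (0 : E) ‖x‖) := hcf.sub hcg
    obtain ⟨y, hy, ey⟩ := exists_eq_sphMax (norm_nonneg x) hcs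
    have h1 : f x - g x ≤ φ ‖x‖ := le_sphMax hcs rfl
    have h2 := sub_le_sphOsc hcf (rfl : ‖x‖ = ‖x‖) hy
    have h3 := sub_le_sphOsc hcg hy (rfl : ‖x‖ = ‖x‖)
    rw [Real.norm_of_nonpos (by linarith), hφ, ← ey]
    show _ ≤ sphOsc f ‖x‖ + sphOsc g ‖x‖
    linarith
  have hsum : Tendsto (fun x : E => ((φ ‖x‖ : ℝ) : EReal) + ((f x - g x - φ ‖x‖ : ℝ) : EReal))
      (𝓝[ann 0 ρ] 0) (𝓝 (l + ((0 : ℝ) : EReal))) :=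
    (EReal.continuousAt_add (p := (l, ((0 : ℝ) : EReal))) (Or.inr (EReal.coe_ne_bot 0))
      (Or.inr (EReal.coe_ne_top 0))).tendsto.comp
      ((hl.comp hnorm).prodMk_nhds (EReal.tendsto_coe.2 herr))
  rw [EReal.coe_zero, add_zero] at hsum
  refine hsum.congr fun x => ?_
  rw [← EReal.coe_add]
  congr 1; ring

theorem logSol_log_of_weak {p ρ : ℝ} (hp : 1 < p) {V W u : E → ℝ}
    (hV : Measurable V)
    (hVloc : ∀ K : Set E, IsCompact K → K ⊆ ball (0 : E) ρ \ {0} → ∃ M : ℝ, ∀ x ∈ K, |V x| ≤ M)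
    (hW : ∀ᵐ x ∂(volume.restrict (ball (0 : E) ρ \ {0})), V x = W x)
    (hu : ContDiffOn ℝ 1 u (ball (0 : E) ρ \ {0})) (hpos : ∀ x ∈ ball (0 : E) ρ \ {0}, 0 < u x)
    (h : ∀ φ : E → ℝ, ContDiff ℝ (⊤ : ℕ∞) φ → HasCompactSupport φ →
      tsupport φ ⊆ ball (0 : E) ρ \ {0} →
      ∫ x in ball (0 : E) ρ \ {0}, (‖gradient u x‖ ^ (p - 2) * ⟪gradient u x, gradient φ x⟫ +
        V x * |u x| ^ (p - 2) * u x * φ x) = 0) :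
    LogSol p W (ball (0 : E) ρ \ {0}) fun x => Real.log (u x) := by
  have hΩ : IsOpen (ball (0 : E) ρ \ {0}) := isOpen_ball.sdiff isClosed_singleton
  have hlog : ContDiffOn ℝ 1 (fun x => Real.log (u x)) (ball (0 : E) ρ \ {0}) :=
    hu.log fun x hx => (hpos x hx).ne'
  have key : ∀ η : E → ℝ, TestFun (ball (0 : E) ρ \ {0}) η →
      ∫ x, logForm p W (fun x => Real.log (u x)) η x = 0 := by
    intro η hη
    rw [← logForm_integral_eq_zero hp hΩ hV hVloc hu hpos h hη]
    refine integral_congr_ae ?_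
    rw [ae_restrict_iff' hΩ.measurableSet] at hW
    filter_upwards [hW] with x hx
    by_cases hxΩ : x ∈ ball (0 : E) ρ \ {0}
    · simp only [logForm, hx hxΩ]
    · have h0 : η x = 0 := image_eq_zero_of_notMem_tsupport fun hs => hxΩ (hη.supp hs)
      simp only [logForm, h0, mul_zero]
  exact ⟨⟨hlog, fun η hη _ => (key η hη).ge⟩, ⟨hlog, fun η hη _ => (key η hη).le⟩⟩

theorem ann_zero_eq (ρ : ℝ) : (ann 0 ρ : Set E) = ball 0 ρ \ {0} := by
  ext x
  simp only [ann, Set.mem_ofPred_eq, Set.mem_sdiff, mem_ball_zero_iff, mem_singleton_iff, norm_pos_iff]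
  exact and_comm

open Classical in
/-- A locally bounded radial potential of Fuchsian type can be modified on a null set so that the
bound holds everywhere. -/
theorem exists_fuchsPot {p C₀ ρ : ℝ} (hC₀ : 0 ≤ C₀) {V : E → ℝ} (hV : Measurable V)
    (hsym : ∀ x y : E, ‖x‖ = ‖y‖ → V x = V y)
    (hF : ∀ᵐ x ∂(volume.restrict (ball (0 : E) ρ \ {0})), ‖x‖ ^ p * |V x| ≤ C₀) :
    ∃ W : E → ℝ, FuchsPot p C₀ W ∧
      ∀ᵐ x ∂(volume.restrict (ball (0 : E) ρ \ {0})), V x = W x := by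
  refine ⟨fun x => if ‖x‖ ^ p * |V x| ≤ C₀ then V x else 0, ⟨?_, fun x => ?_, fun x y h => ?_⟩, ?_⟩
  · refine Measurable.ite (measurableSet_le ?_ measurable_const) hV measurable_const
    exact (measurable_norm.pow_const p).mul hV.abs
  · by_cases h : ‖x‖ ^ p * |V x| ≤ C₀
    · simp only [if_pos h]; exact h
    · simp only [if_neg h, abs_zero, mul_zero]; exact hC₀
  · simp only [h, hsym x y h]
  · filter_upwards [hF] with x hx
    rw [if_pos hx]

end Limits

theorem stmt14 (d : ℕ) (hd : 2 ≤ d) (p : ℝ) (hp : 1 < p) (C₀ : ℝ) (hC₀ : 0 < C₀)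
    (ρ : ℝ) (hρ : 0 < ρ)
    (V : EuclideanSpace ℝ (Fin d) → ℝ) (hVmeas : Measurable V)
    (hVloc : ∀ K : Set (EuclideanSpace ℝ (Fin d)), IsCompact K →
      K ⊆ ball (0 : EuclideanSpace ℝ (Fin d)) ρ \ {0} → ∃ M : ℝ, ∀ x ∈ K, |V x| ≤ M)
    -- spherical symmetry
    (hVsym : ∀ x y : EuclideanSpace ℝ (Fin d), ‖x‖ = ‖y‖ → V x = V y)
    (hFuchs : ∀ᵐ x ∂(volume.restrict (ball (0 : EuclideanSpace ℝ (Fin d)) ρ \ {0})),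
      ‖x‖ ^ p * |V x| ≤ C₀)
    (u v : EuclideanSpace ℝ (Fin d) → ℝ)
    (hu : IsPosWeakSol p V (ball (0 : EuclideanSpace ℝ (Fin d)) ρ \ {0}) u)
    (hv : IsPosWeakSol p V (ball (0 : EuclideanSpace ℝ (Fin d)) ρ \ {0}) v) :
    ∃ l : ℝ≥0∞, Tendsto (fun x => ENNReal.ofReal (u x / v x))
      (𝓝[ball (0 : EuclideanSpace ℝ (Fin d)) ρ \ {0}] 0) (𝓝 l) := by
  obtain ⟨W, hW, hVW⟩ := exists_fuchsPot hC₀.le hVmeas hVsym hFuchs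
  have hlu := logSol_log_of_weak hp hVmeas hVloc hVW hu.1 hu.2.1 hu.2.2
  have hlv := logSol_log_of_weak hp hVmeas hVloc hVW hv.1 hv.2.1 hv.2.2
  rw [← ann_zero_eq] at hlu hlv
  obtain ⟨l, hl⟩ := hlu.exists_tendsto_sub hp (by rwa [finrank_euclideanSpace_fin]) hρ hW hlv
  rw [ann_zero_eq] at hl
  refine ⟨l.exp, ((ENNReal.continuous_exp.tendsto l).comp hl).congr' ?_⟩
  filter_upwards [self_mem_nhdsWithin] with x hx
  have h1 := hu.2.1 x hx
  have h2 := hv.2.1 x hx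
  rw [Function.comp_apply, EReal.exp_coe, ← Real.log_div h1.ne' h2.ne',
    Real.exp_log (div_pos h1 h2)]
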